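/- Let Φ : 𝔗(ℋ) → 𝔗(ℋ') and Ψ : 𝔗(𝒦) → 𝔗(𝒦') be positive linear bounded maps each having continuous output entropy. If the tensor product map Φ⊗Ψ : 𝔗(ℋ⊗𝒦) → 𝔗(ℋ'⊗𝒦') is positive, then Φ⊗Ψ has continuous output entropy. -/

import Mathlib

open scoped ENNReal NNReal
open Filter Topology Classical
attribute [local instance] Classical.propDecidable

noncomputable section

namespace QIT

section Defs

variable {E F G : Type*}
variable [NormedAddCommGroup E] [InnerProductSpace ℂ E] [CompleteSpace E]
variable [NormedAddCommGroup F] [InnerProductSpace ℂ F] [CompleteSpace F]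
variable [NormedAddCommGroup G] [InnerProductSpace ℂ G] [CompleteSpace G]

/-- The real part of `⟪x, A x⟫`. -/
def qf (A : E →L[ℂ] E) (x : E) : ℝ := (inner ℂ x (A x) : ℂ).re

/-- The trace of a positive operator, as the supremum of finite diagonal sums over
finite orthonormal families.  For positive operators this coincides with the usual
trace (with value `∞` when the operator is not trace class). -/
def traceENN (A : E →L[ℂ] E) : ℝ≥0∞ :=
  ⨆ (n : ℕ) (e : Fin n → E) (_ : Orthonormal ℂ e), ∑ i, ENNReal.ofReal (qf A (e i))

/-- The trace norm `‖A‖₁`, as the supremum of `∑ |⟪e i, A (f i)⟫|` over pairs of finite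
orthonormal families; it is finite exactly on trace-class operators. -/
def traceNorm (A : E →L[ℂ] E) : ℝ≥0∞ :=
  ⨆ (n : ℕ) (e : Fin n → E) (f : Fin n → E) (_ : Orthonormal ℂ e) (_ : Orthonormal ℂ f),
    ∑ i, ENNReal.ofReal ‖(inner ℂ (e i) (A (f i)) : ℂ)‖

/-- `A` is a trace-class operator. -/
def IsTC (A : E →L[ℂ] E) : Prop := traceNorm A ≠ ∞

/-- The cone `𝔗₊(E)` of positive trace-class operators. -/
def posTC (E : Type*) [NormedAddCommGroup E] [InnerProductSpace ℂ E] [CompleteSpace E] :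
    Set (E →L[ℂ] E) := {A | A.IsPositive ∧ IsTC A}

/-- The set `𝔖(E)` of states (density operators). -/
def states (E : Type*) [NormedAddCommGroup E] [InnerProductSpace ℂ E] [CompleteSpace E] :
    Set (E →L[ℂ] E) := {A | A.IsPositive ∧ traceENN A = 1}

/-- The extended classical entropy `H({x_i}) = ∑ η(x_i) − η(∑ x_i)` of a nonnegative
summable family, written in the equivalent homogeneous form `(∑ x) · H({x_i/∑x})`. -/
def clEntropy {ι : Type*} (x : ι → ℝ) : ℝ≥0∞ :=
  ENNReal.ofReal (∑' i, x i) *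
    ∑' i, ENNReal.ofReal (Real.negMulLog (x i / (∑' j, x j)))

/-- An orthonormal subset with dense span (an orthonormal basis, as a set). -/
def IsONB (s : Set E) : Prop :=
  Orthonormal ℂ ((↑) : s → E) ∧ Dense ((Submodule.span ℂ s : Submodule ℂ E) : Set E)

/-- The quantum (von Neumann) entropy `H(A) = Tr η(A) − η(Tr A)` of a positive trace-class
operator, realized as the infimum over all orthonormal bases of the classical entropy of
the diagonal of `A` (the infimum is attained on an eigenbasis of `A`). -/
def qEntropy (A : E →L[ℂ] E) : ℝ≥0∞ :=
  ⨅ (s : Set E) (_ : IsONB s), clEntropy fun v : s => qf A v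

theorem exists_isONB (E : Type*) [NormedAddCommGroup E] [InnerProductSpace ℂ E]
    [CompleteSpace E] : ∃ s : Set E, IsONB s := by
  obtain ⟨w, b, hb⟩ := exists_hilbertBasis ℂ E
  refine ⟨w, ?_, ?_⟩
  · have h := b.orthonormal
    rwa [hb] at h
  · have h := b.dense_span
    rw [hb, Subtype.range_coe] at h
    rwa [Submodule.dense_iff_topologicalClosure_eq_top]

/-- A fixed orthonormal basis (as a set). -/
def stdONB (E : Type*) [NormedAddCommGroup E] [InnerProductSpace ℂ E] [CompleteSpace E] :
    Set E := (exists_isONB E).choose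

/-- The `ℂ`-valued trace, computed in a fixed orthonormal basis; for trace-class
operators it does not depend on the choice of the basis. -/
def traceC (A : E →L[ℂ] E) : ℂ := ∑' v : stdONB E, (inner ℂ (v : E) (A v) : ℂ)

/-- Continuity (including finiteness) of an `ℝ≥0∞`-valued function on a subset of
operators, with respect to the trace-norm distance. -/
def ContOn (f : (E →L[ℂ] E) → ℝ≥0∞) (𝒜 : Set (E →L[ℂ] E)) : Prop :=
  (∀ A ∈ 𝒜, f A ≠ ∞) ∧
  ∀ A ∈ 𝒜, ∀ ε : ℝ, 0 < ε → ∃ δ : ℝ, 0 < δ ∧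
    ∀ B ∈ 𝒜, traceNorm (B - A) < ENNReal.ofReal δ → |(f B).toReal - (f A).toReal| < ε

/-- Continuity of a real-valued function on a subset of operators with respect to the
trace-norm distance. -/
def RContOn (g : (E →L[ℂ] E) → ℝ) (𝒜 : Set (E →L[ℂ] E)) : Prop :=
  ∀ A ∈ 𝒜, ∀ ε : ℝ, 0 < ε → ∃ δ : ℝ, 0 < δ ∧
    ∀ B ∈ 𝒜, traceNorm (B - A) < ENNReal.ofReal δ → |g B - g A| < ε

/-- Boundedness of an `ℝ≥0∞`-valued function on a set. -/
def BddOn (f : (E →L[ℂ] E) → ℝ≥0∞) (𝒜 : Set (E →L[ℂ] E)) : Prop :=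
  ∃ C : ℝ, ∀ A ∈ 𝒜, f A ≤ ENNReal.ofReal C

/-- Convergence of a sequence of operators in the trace norm. -/
def TendstoTN (A : ℕ → (E →L[ℂ] E)) (A₀ : E →L[ℂ] E) : Prop :=
  ∀ ε : ℝ, 0 < ε → ∃ N : ℕ, ∀ n ≥ N, traceNorm (A n - A₀) < ENNReal.ofReal ε

/-- A positive linear map from the trace class of `E` to the trace class of `F`
(the values of `toFun` outside the trace class are irrelevant). -/
structure TraceMap (E F : Type*) [NormedAddCommGroup E] [InnerProductSpace ℂ E]
    [CompleteSpace E] [NormedAddCommGroup F] [InnerProductSpace ℂ F] [CompleteSpace F] where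
  toFun : (E →L[ℂ] E) → (F →L[ℂ] F)
  map_add : ∀ A B, IsTC A → IsTC B → toFun (A + B) = toFun A + toFun B
  map_smul : ∀ (c : ℂ) A, IsTC A → toFun (c • A) = c • toFun A
  maps_tc : ∀ A, IsTC A → IsTC (toFun A)
  pos : ∀ A, IsTC A → A.IsPositive → (toFun A).IsPositive

/-- A trace-non-increasing map. -/
def TraceMap.TNI (Φ : TraceMap E F) : Prop :=
  ∀ A, IsTC A → A.IsPositive → traceENN (Φ.toFun A) ≤ traceENN A

/-- A trace-preserving map. -/
def TraceMap.TP (Φ : TraceMap E F) : Prop :=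
  ∀ A, IsTC A → A.IsPositive → traceENN (Φ.toFun A) = traceENN A

/-- A map bounded with respect to the trace norm. -/
def TraceMap.Bounded (Φ : TraceMap E F) : Prop :=
  ∃ C : ℝ≥0, ∀ A, traceNorm (Φ.toFun A) ≤ (C : ℝ≥0∞) * traceNorm A

/-- The output entropy `H_Φ = H ∘ Φ`. -/
def outEntropy (Φ : TraceMap E F) (A : E →L[ℂ] E) : ℝ≥0∞ := qEntropy (Φ.toFun A)

/-- The rank-one operator `|x⟩⟨x|`. -/
def rankOne (x : E) : E →L[ℂ] E := (innerSL ℂ x).smulRight x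

/-- The rank-one operator `|x⟩⟨y|`. -/
def rankOneM (x y : E) : E →L[ℂ] E := (innerSL ℂ y).smulRight x

end Defs

section Defs2

variable {E F G : Type*}
variable [NormedAddCommGroup E] [InnerProductSpace ℂ E] [CompleteSpace E]
variable [NormedAddCommGroup F] [InnerProductSpace ℂ F] [CompleteSpace F]
variable [NormedAddCommGroup G] [InnerProductSpace ℂ G] [CompleteSpace G]

/-- The completely positive map `A ↦ ∑ᵢ Vᵢ A Vᵢ*` defined by a sequence of Kraus
operators. -/
def krausMap (V : ℕ → (E →L[ℂ] F)) (A : E →L[ℂ] E) : F →L[ℂ] F :=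
  ∑' i, V i ∘L A ∘L ContinuousLinearMap.adjoint (V i)

/-- The Kraus condition `∑ᵢ Vᵢ* Vᵢ ≤ I` (all partial sums are dominated by `I`). -/
def KrausTNI (V : ℕ → (E →L[ℂ] F)) : Prop :=
  ∀ n : ℕ,
    ((1 : E →L[ℂ] E) - ∑ i ∈ Finset.range n, ContinuousLinearMap.adjoint (V i) ∘L V i).IsPositive

/-- The Kraus condition `∑ᵢ Vᵢ* Vᵢ = I` (strong convergence), i.e. trace preservation. -/
def KrausTP (V : ℕ → (E →L[ℂ] F)) : Prop :=
  ∀ x : E, HasSum (fun i => (ContinuousLinearMap.adjoint (V i)) (V i x)) x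

/-- `(Φ, Φt)` is a complementary pair of quantum operations: for some Kraus
representation `Φ(·) = ∑ᵢ Vᵢ (·) Vᵢ*` and some orthonormal basis `{bᵢ}` of `G`,
`Φt(A) = ∑_{i,j} Tr[Vᵢ A Vⱼ*] |bᵢ⟩⟨bⱼ|` (characterized by its matrix entries). -/
def IsComplementaryPair (Φ : TraceMap E F) (Φt : TraceMap E G) : Prop :=
  ∃ (V : ℕ → (E →L[ℂ] F)) (b : HilbertBasis ℕ ℂ G),
    KrausTNI V ∧
    (∀ A, IsTC A → Φ.toFun A = krausMap V A) ∧
    (∀ A, IsTC A → ∀ i j : ℕ,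
      (inner ℂ (b i) (Φt.toFun A (b j)) : ℂ) =
        traceC (V i ∘L A ∘L ContinuousLinearMap.adjoint (V j)))

/-- A map (on trace-class operators) preserves continuity of the entropy:
its output entropy is continuous on every subset of the positive trace-class cone on
which the von Neumann entropy is continuous. -/
def PCE (Φf : (E →L[ℂ] E) → (F →L[ℂ] F)) : Prop :=
  ∀ 𝒜 : Set (E →L[ℂ] E), 𝒜 ⊆ posTC E → ContOn qEntropy 𝒜 →
    ContOn (fun A => qEntropy (Φf A)) 𝒜

/-- `μ` is the sequence of nonzero eigenvalues (with multiplicities, possibly padded by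
zeros) of the diagonalizable positive operator `T`, every vector orthogonal to the
eigenvectors being annihilated by `T`. -/
def IsEigenSeq (T : E →L[ℂ] E) (μ : ℕ → ℝ) : Prop :=
  ∃ e : ℕ → E,
    (∀ i j, i ≠ j → (inner ℂ (e i) (e j) : ℂ) = 0) ∧
    (∀ i, (μ i ≠ 0 → ‖e i‖ = 1) ∧ (μ i = 0 → e i = 0)) ∧
    (∀ i, T (e i) = (μ i : ℂ) • e i) ∧
    (∀ x : E, (∀ i, (inner ℂ (e i) x : ℂ) = 0) → T x = 0)

/-- `ν` is the sequence of singular values of `V` (eigenvalues of `√(V*V)`,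
equivalently `ν²` are the eigenvalues of `V*V`). -/
def IsSingularValues (V : E →L[ℂ] F) (ν : ℕ → ℝ) : Prop :=
  (∀ i, 0 ≤ ν i) ∧ IsEigenSeq (ContinuousLinearMap.adjoint V ∘L V) (fun i => ν i ^ 2)

/-- `∑ᵢ e^{−l/νᵢ²}`, the sum being taken over the indices with `νᵢ ≠ 0`. -/
def expSum (ν : ℕ → ℝ) (l : ℝ) : ℝ≥0∞ :=
  ∑' i, if ν i = 0 then 0 else ENNReal.ofReal (Real.exp (-(l / ν i ^ 2)))

/-- `λ*(V) < ∞`: `V` is compact (automatic here) and `∑ᵢ e^{−l/νᵢ²} < ∞` for some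
`l > 0`, where `{νᵢ}` are the singular values of `V`. -/
def LamStarFin (V : E →L[ℂ] F) : Prop :=
  ∃ ν : ℕ → ℝ, IsSingularValues V ν ∧ ∃ l : ℝ, 0 < l ∧ expSum ν l ≠ ∞

/-- `λ*(√S) < ∞` for a positive operator `S` (the singular values of `√S` are the
square roots of the eigenvalues of `S`). -/
def LamStarSqrtFin (S : E →L[ℂ] E) : Prop :=
  ∃ ν : ℕ → ℝ, (∀ i, 0 ≤ ν i) ∧ IsEigenSeq S (fun i => ν i ^ 2) ∧
    ∃ l : ℝ, 0 < l ∧ expSum ν l ≠ ∞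

/-- The value `λ*` associated to a sequence `ν` of singular values: the unique solution
of `∑ᵢ e^{−λ/νᵢ²} = 1` if it exists, and `inf{λ > 0 | ∑ᵢ e^{−λ/νᵢ²} < ∞}` otherwise. -/
def lamStarOf (ν : ℕ → ℝ) : ℝ≥0∞ :=
  if h : ∃ l : ℝ, expSum ν l = 1 then ENNReal.ofReal h.choose
  else ⨅ (l : ℝ) (_ : 0 < l ∧ expSum ν l ≠ ∞), ENNReal.ofReal l

/-- The parameter `λ*(V) ∈ [0,∞]` of a bounded operator `V`. -/
def lamStar (V : E →L[ℂ] F) : ℝ≥0∞ :=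
  if h : ∃ ν : ℕ → ℝ, IsSingularValues V ν then lamStarOf h.choose else ∞

/-- `rank A ≤ k`. -/
def rankLE (A : E →L[ℂ] E) (k : ℕ) : Prop :=
  Module.rank ℂ (LinearMap.range (A : E →ₗ[ℂ] E)) ≤ k

/-- The set `𝔗₊ᵏ(E)` of positive (trace-class) operators of rank at most `k`. -/
def rankCone (E : Type*) [NormedAddCommGroup E] [InnerProductSpace ℂ E] [CompleteSpace E]
    (k : ℕ) : Set (E →L[ℂ] E) := {A | A.IsPositive ∧ rankLE A k}

/-- A decomposition of `A` into a countable convex combination of positive operators of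
rank at most `k`. -/
structure Decomp (k : ℕ) (A : E →L[ℂ] E) where
  π : ℕ → ℝ
  op : ℕ → (E →L[ℂ] E)
  π_nonneg : ∀ i, 0 ≤ π i
  π_sum : HasSum π 1
  op_pos : ∀ i, (op i).IsPositive
  op_rank : ∀ i, rankLE (op i) k
  sum_eq : HasSum (fun i => π i • op i) A

/-- The `k`-order approximator `H_Φᵏ` of the output entropy of `Φ`. -/
def kApprox (Φf : (E →L[ℂ] E) → (F →L[ℂ] F)) (k : ℕ) (A : E →L[ℂ] E) : ℝ≥0∞ :=
  ⨆ d : Decomp k A, ∑' i, ENNReal.ofReal (d.π i) * qEntropy (Φf (d.op i))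

/-- The set of pure states (extreme points of `𝔖(E)`). -/
def pureStates (E : Type*) [NormedAddCommGroup E] [InnerProductSpace ℂ E]
    [CompleteSpace E] : Set (E →L[ℂ] E) := {A | ∃ x : E, ‖x‖ = 1 ∧ A = rankOne x}

end Defs2

section Tensor

variable (E F G : Type*)
variable [NormedAddCommGroup E] [InnerProductSpace ℂ E] [CompleteSpace E]
variable [NormedAddCommGroup F] [InnerProductSpace ℂ F] [CompleteSpace F]
variable [NormedAddCommGroup G] [InnerProductSpace ℂ G] [CompleteSpace G]

/-- A realization of `G` as the Hilbert tensor product `E ⊗ F`, together with the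
tensor product of (bounded) operators. -/
structure TensorData where
  tmul : E → F → G
  add_left : ∀ x y z, tmul (x + y) z = tmul x z + tmul y z
  add_right : ∀ x y z, tmul x (y + z) = tmul x y + tmul x z
  smul_left : ∀ (c : ℂ) x y, tmul (c • x) y = c • tmul x y
  smul_right : ∀ (c : ℂ) x y, tmul x (c • y) = c • tmul x y
  inner_tmul : ∀ x x' y y',
    (inner ℂ (tmul x y) (tmul x' y') : ℂ) = (inner ℂ x x' : ℂ) * (inner ℂ y y' : ℂ)
  dense_span : Dense ((Submodule.span ℂ {z | ∃ x y, z = tmul x y} : Submodule ℂ G) : Set G)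
  omul : (E →L[ℂ] E) → (F →L[ℂ] F) → (G →L[ℂ] G)
  omul_tmul : ∀ A B x y, omul A B (tmul x y) = tmul (A x) (B y)

end Tensor

set_option linter.unusedSectionVars false

section Classical

/-- The summand `x log (X / x)` of the homogeneous entropy of a family with total mass `X`. -/
def entTerm (X x : ℝ) : ℝ≥0∞ := ENNReal.ofReal (x * Real.log (X / x))

@[simp] lemma entTerm_zero (X : ℝ) : entTerm X 0 = 0 := by simp [entTerm]

lemma mul_log_div_nonneg {X x : ℝ} (hx : 0 ≤ x) (hX : x ≤ X) : 0 ≤ x * Real.log (X / x) := by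
  rcases hx.eq_or_lt with rfl | h
  · simp
  · exact mul_nonneg hx (Real.log_nonneg ((one_le_div h).2 hX))

lemma clEntropy_of_hasSum {ι : Type*} {x : ι → ℝ} {X : ℝ} (hx : ∀ i, 0 ≤ x i)
    (h : HasSum x X) : clEntropy x = ∑' i, entTerm X (x i) := by
  have hX : 0 ≤ X := h.nonneg hx
  rw [clEntropy, h.tsum_eq, ← ENNReal.tsum_mul_left]
  congr 1 with i
  rw [← ENNReal.ofReal_mul hX, entTerm]
  congr 1
  rcases hX.eq_or_lt with rfl | h0
  · simp
  rcases (hx i).eq_or_lt with h1 | h1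
  · simp [← h1]
  rw [Real.negMulLog, Real.log_div h1.ne' h0.ne', Real.log_div h0.ne' h1.ne']
  field_simp
  ring

/-- Gibbs' inequality for one summand. -/
lemma entTerm_add_le {X x q : ℝ} (hx : 0 ≤ x) (hX : x ≤ X) (hq : 0 < q) :
    entTerm X x + ENNReal.ofReal x ≤
      ENNReal.ofReal x * ENNReal.ofReal (Real.log (X / q)) + ENNReal.ofReal q := by
  rcases hx.eq_or_lt with rfl | h
  · simp
  have hX0 : 0 < X := h.trans_le hX
  rw [entTerm, ← ENNReal.ofReal_add (mul_log_div_nonneg hx hX) hx,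
    ← ENNReal.ofReal_mul hx]
  have key : x * Real.log (X / x) + x ≤ x * Real.log (X / q) + q := by
    have h1 := Real.log_le_sub_one_of_pos (div_pos hq h)
    have h2 : x * Real.log (q / x) ≤ q - x := by
      calc x * Real.log (q / x) ≤ x * (q / x - 1) := by gcongr
        _ = q - x := by field_simp
    rw [Real.log_div hX0.ne' h.ne', Real.log_div hX0.ne' hq.ne']
    rw [Real.log_div hq.ne' h.ne'] at h2
    nlinarith
  exact (ENNReal.ofReal_le_ofReal key).trans ENNReal.ofReal_add_le

lemma entTerm_superadd {X Y x y : ℝ} (hx : 0 ≤ x) (hX : x ≤ X) (hy : 0 ≤ y) (hY : y ≤ Y) :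
    entTerm X x + entTerm Y y ≤ entTerm (X + Y) (x + y) := by
  rw [entTerm, entTerm, entTerm,
    ← ENNReal.ofReal_add (mul_log_div_nonneg hx hX) (mul_log_div_nonneg hy hY)]
  apply ENNReal.ofReal_le_ofReal
  rcases (add_nonneg hx hy).eq_or_lt with h0 | h0
  · have hx0 : x = 0 := by linarith
    have hy0 : y = 0 := by linarith
    simp [hx0, hy0]
  have hT : 0 < X + Y := by linarith
  have key : ∀ z Z : ℝ, 0 ≤ z → z ≤ Z → z * Real.log (Z / z) ≤
      z * Real.log ((X + Y) / (x + y)) + (Z * ((x + y) / (X + Y)) - z) := by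
    intro z Z hz hZ
    rcases hz.eq_or_lt with rfl | hz
    · simp; positivity
    have hZ' : 0 < Z := hz.trans_le hZ
    have h1 := Real.log_le_sub_one_of_pos
      (div_pos (mul_pos hZ' (div_pos h0 hT)) hz : 0 < Z * ((x + y) / (X + Y)) / z)
    have h2 : z * Real.log (Z * ((x + y) / (X + Y)) / z) ≤ Z * ((x + y) / (X + Y)) - z := by
      calc _ ≤ z * (Z * ((x + y) / (X + Y)) / z - 1) := by gcongr
        _ = _ := by field_simp
    rw [Real.log_div (by positivity) hz.ne', Real.log_mul hZ'.ne' (by positivity),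
      Real.log_div h0.ne' hT.ne'] at h2
    rw [Real.log_div hZ'.ne' hz.ne', Real.log_div hT.ne' h0.ne']
    nlinarith
  have e : (X + Y) * ((x + y) / (X + Y)) = x + y := by field_simp
  linarith [key x X hx hX, key y Y hy hY]

lemma HasSum.le_total {ι : Type*} {x : ι → ℝ} {X : ℝ} (hx : ∀ i, 0 ≤ x i)
    (h : HasSum x X) (i : ι) : x i ≤ X := le_hasSum h i fun j _ => hx j

lemma clEntropy_superadd {ι : Type*} {x y : ι → ℝ} (hx : ∀ i, 0 ≤ x i)
    (hy : ∀ i, 0 ≤ y i) (hxs : Summable x) (hys : Summable y) :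
    clEntropy x + clEntropy y ≤ clEntropy (fun i => x i + y i) := by
  obtain ⟨X, hX⟩ := hxs
  obtain ⟨Y, hY⟩ := hys
  rw [clEntropy_of_hasSum hx hX, clEntropy_of_hasSum hy hY,
    clEntropy_of_hasSum (fun i => add_nonneg (hx i) (hy i)) (hX.add hY), ← ENNReal.tsum_add]
  exact ENNReal.tsum_le_tsum fun i => entTerm_superadd (hx i) (HasSum.le_total hx hX i)
    (hy i) (HasSum.le_total hy hY i)

lemma clEntropy_mono {ι : Type*} {x y : ι → ℝ} (hx : ∀ i, 0 ≤ x i) (hxy : ∀ i, x i ≤ y i)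
    (hys : Summable y) : clEntropy x ≤ clEntropy y := by
  have hxs : Summable x := hys.of_nonneg_of_le hx hxy
  have h := clEntropy_superadd hx (fun i => sub_nonneg.2 (hxy i)) hxs (hys.sub hxs)
  simp only [add_sub_cancel] at h
  exact le_self_add.trans h

lemma entTerm_smul {c : ℝ} (hc : 0 ≤ c) (X x : ℝ) :
    entTerm (c * X) (c * x) = ENNReal.ofReal c * entTerm X x := by
  rcases hc.eq_or_lt with rfl | h
  · simp [entTerm]
  rw [entTerm, entTerm, ← ENNReal.ofReal_mul hc, mul_div_mul_left _ _ h.ne', mul_assoc]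

lemma clEntropy_smul {ι : Type*} {x : ι → ℝ} {c : ℝ} (hc : 0 ≤ c) (hx : ∀ i, 0 ≤ x i)
    (hxs : Summable x) : clEntropy (fun i => c * x i) = ENNReal.ofReal c * clEntropy x := by
  obtain ⟨X, hX⟩ := hxs
  rw [clEntropy_of_hasSum hx hX, clEntropy_of_hasSum (fun i => mul_nonneg hc (hx i))
    (hX.mul_left c), ← ENNReal.tsum_mul_left]
  simp_rw [entTerm_smul hc]

lemma tsum_ofReal_of_hasSum {ι : Type*} {x : ι → ℝ} {X : ℝ} (hx : ∀ i, 0 ≤ x i)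
    (h : HasSum x X) : ∑' i, ENNReal.ofReal (x i) = ENNReal.ofReal X := by
  rw [← h.tsum_eq, ENNReal.ofReal_tsum_of_nonneg hx h.summable]

lemma entTerm_split {T X x : ℝ} (hx : 0 ≤ x) (hX : x ≤ X) (hT : X ≤ T) :
    entTerm T x = entTerm X x + ENNReal.ofReal x * ENNReal.ofReal (Real.log (T / X)) := by
  rcases hx.eq_or_lt with rfl | h
  · simp
  have hX0 := h.trans_le hX
  have hT0 := hX0.trans_le hT
  have hl : 0 ≤ Real.log (T / X) := Real.log_nonneg ((one_le_div hX0).2 hT)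
  rw [entTerm, entTerm, ← ENNReal.ofReal_mul hx,
    ← ENNReal.ofReal_add (mul_log_div_nonneg hx hX) (mul_nonneg hx hl)]
  congr 1
  rw [Real.log_div hT0.ne' h.ne', Real.log_div hT0.ne' hX0.ne', Real.log_div hX0.ne' h.ne']
  ring

lemma tsum_entTerm_of_le {ι : Type*} {x : ι → ℝ} {X T : ℝ} (hx : ∀ i, 0 ≤ x i)
    (h : HasSum x X) (hT : X ≤ T) :
    ∑' i, entTerm T (x i) = clEntropy x + entTerm T X := by
  have hX : 0 ≤ X := h.nonneg hx
  rw [clEntropy_of_hasSum hx h, entTerm, ENNReal.ofReal_mul hX, ← tsum_ofReal_of_hasSum hx h,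
    ← ENNReal.tsum_mul_right, ← ENNReal.tsum_add]
  congr 1 with i
  exact entTerm_split (hx i) (HasSum.le_total hx h i) hT

/-- Grouping property of the entropy for a family split into two pieces. -/
lemma clEntropy_sum {ι κ : Type*} {z : ι ⊕ κ → ℝ} {X Y : ℝ} (hz : ∀ i, 0 ≤ z i)
    (hX : HasSum (fun i => z (.inl i)) X) (hY : HasSum (fun i => z (.inr i)) Y) :
    clEntropy z = (clEntropy (fun i => z (.inl i)) + entTerm (X + Y) X) +
      (clEntropy (fun i => z (.inr i)) + entTerm (X + Y) Y) := by
  have hX0 : 0 ≤ X := hX.nonneg fun i => hz _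
  have hY0 : 0 ≤ Y := hY.nonneg fun i => hz _
  rw [clEntropy_of_hasSum hz (HasSum.sum hX hY),
    Summable.tsum_sum ENNReal.summable ENNReal.summable,
    tsum_entTerm_of_le (fun i => hz _) hX (by linarith),
    tsum_entTerm_of_le (fun i => hz _) hY (by linarith)]

lemma clEntropy_le_card {ι : Type*} [Fintype ι] {x : ι → ℝ} (hx : ∀ i, 0 ≤ x i) {N : ℝ}
    (hN : (Fintype.card ι : ℝ) ≤ N) :
    clEntropy x ≤ ENNReal.ofReal (∑ i, x i) * ENNReal.ofReal (Real.log N) := by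
  have h := hasSum_fintype x
  set X := ∑ i, x i
  have hX : 0 ≤ X := h.nonneg hx
  rcases hX.eq_or_lt with h0 | h0
  · rw [clEntropy, h.tsum_eq, ← h0]; simp
  have hne : Nonempty ι := by
    by_contra hne
    rw [not_nonempty_iff] at hne
    have : X = 0 := Fintype.sum_empty x
    linarith
  have hc : 0 < (Fintype.card ι : ℝ) := by exact_mod_cast Fintype.card_pos
  have key := ENNReal.tsum_le_tsum fun i =>
    entTerm_add_le (hx i) (HasSum.le_total hx h i) (div_pos h0 hc)
  rw [ENNReal.tsum_add, ENNReal.tsum_add, ← clEntropy_of_hasSum hx h, tsum_ofReal_of_hasSum hx h,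
    ENNReal.tsum_mul_right, tsum_ofReal_of_hasSum hx h] at key
  have e : ∑' i : ι, ENNReal.ofReal (X / (Fintype.card ι : ℝ)) = ENNReal.ofReal X := by
    rw [tsum_fintype, ← ENNReal.ofReal_sum_of_nonneg (fun _ _ => by positivity)]
    congr 1
    simp
    field_simp
  rw [e, ENNReal.add_le_add_iff_right ENNReal.ofReal_ne_top] at key
  refine key.trans ?_
  gcongr
  rw [div_div_cancel₀ h0.ne']
  exact hN

/-- Subadditivity of the entropy of a joint distribution. -/
lemma clEntropy_prod_le {ι κ : Type*} {p : ι × κ → ℝ} {r : ι → ℝ} {c : κ → ℝ}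
    (hp : ∀ i, 0 ≤ p i) (hps : Summable p) (hr : ∀ i, HasSum (fun j => p (i, j)) (r i))
    (hc : ∀ j, HasSum (fun i => p (i, j)) (c j)) :
    clEntropy p ≤ clEntropy r + clEntropy c := by
  obtain ⟨Z, hZ⟩ := hps
  have hrZ : HasSum r Z := hZ.prod_fiberwise hr
  have hcZ : HasSum c Z := by
    have := (Equiv.prodComm κ ι).hasSum_iff.2 hZ
    exact this.prod_fiberwise hc
  have hr0 : ∀ i, 0 ≤ r i := fun i => (hr i).nonneg fun j => hp _
  have hc0 : ∀ i, 0 ≤ c i := fun i => (hc i).nonneg fun j => hp _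
  have hZ0 : 0 ≤ Z := hZ.nonneg hp
  rw [clEntropy_of_hasSum hp hZ, clEntropy_of_hasSum hr0 hrZ, clEntropy_of_hasSum hc0 hcZ]
  have key : ∀ i, entTerm Z (p i) + ENNReal.ofReal (p i) ≤
      ENNReal.ofReal (p i) * ENNReal.ofReal (Real.log (Z / r i.1)) +
      ENNReal.ofReal (p i) * ENNReal.ofReal (Real.log (Z / c i.2)) +
      ENNReal.ofReal (r i.1 * (c i.2 / Z)) := by
    rintro ⟨i, j⟩
    rcases (hp (i, j)).eq_or_lt with h0 | h0
    · simp [← h0]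
    have hpZ : p (i, j) ≤ Z := HasSum.le_total hp hZ _
    have hZ1 : 0 < Z := h0.trans_le hpZ
    have hri : p (i, j) ≤ r i := HasSum.le_total (fun j => hp (i, j)) (hr i) j
    have hcj : p (i, j) ≤ c j := HasSum.le_total (fun i => hp (i, j)) (hc j) i
    have hri0 := h0.trans_le hri
    have hcj0 := h0.trans_le hcj
    refine (entTerm_add_le (hp _) hpZ (q := r i * (c j / Z)) (by positivity)).trans ?_
    gcongr
    rw [← mul_add]
    gcongr
    refine (ENNReal.ofReal_le_ofReal (le_of_eq ?_)).trans ENNReal.ofReal_add_le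
    rw [Real.log_div hZ1.ne' (by positivity), Real.log_mul hri0.ne' (by positivity),
      Real.log_div hcj0.ne' hZ1.ne', Real.log_div hZ1.ne' hri0.ne',
      Real.log_div hZ1.ne' hcj0.ne']
    ring
  have key2 := ENNReal.tsum_le_tsum key
  rw [ENNReal.tsum_add, ENNReal.tsum_add, ENNReal.tsum_add, tsum_ofReal_of_hasSum hp hZ] at key2
  have e1 : ∑' i : ι × κ, ENNReal.ofReal (r i.1 * (c i.2 / Z)) = ENNReal.ofReal Z := by
    rw [ENNReal.tsum_prod']
    simp_rw [ENNReal.ofReal_mul (hr0 _), ENNReal.tsum_mul_left]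
    rw [ENNReal.tsum_mul_right, tsum_ofReal_of_hasSum hr0 hrZ,
      tsum_ofReal_of_hasSum (fun j => div_nonneg (hc0 j) hZ0) (hcZ.div_const Z),
      ← ENNReal.ofReal_mul hZ0]
    rcases hZ0.eq_or_lt with h | h
    · simp [← h]
    · rw [div_self h.ne', mul_one]
  have e2 : ∑' i : ι × κ, ENNReal.ofReal (p i) * ENNReal.ofReal (Real.log (Z / r i.1)) =
      ∑' i, entTerm Z (r i) := by
    rw [ENNReal.tsum_prod']
    congr 1 with i
    dsimp only
    rw [ENNReal.tsum_mul_right, tsum_ofReal_of_hasSum (fun j => hp _) (hr i), entTerm,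
      ENNReal.ofReal_mul (hr0 i)]
  have e3 : ∑' i : ι × κ, ENNReal.ofReal (p i) * ENNReal.ofReal (Real.log (Z / c i.2)) =
      ∑' i, entTerm Z (c i) := by
    rw [ENNReal.tsum_prod', ENNReal.tsum_comm]
    congr 1 with j
    dsimp only
    rw [ENNReal.tsum_mul_right, tsum_ofReal_of_hasSum (fun i => hp (i, j)) (hc j), entTerm,
      ENNReal.ofReal_mul (hc0 j)]
  rw [e1, e2, e3] at key2
  exact (ENNReal.add_le_add_iff_right ENNReal.ofReal_ne_top).1 key2

/-- Schur-type concavity: mixing by a substochastic matrix does not decrease the entropy. -/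
lemma clEntropy_le_of_mixing {ι κ : Type*} {μ : ι → ℝ} {x : κ → ℝ} {M : ℝ}
    (hμ : ∀ i, 0 ≤ μ i) (hμM : HasSum μ M) (hx : ∀ j, 0 ≤ x j) (hxM : HasSum x M)
    (d : ι → κ → ℝ≥0∞) (hd : ∀ i, μ i ≠ 0 → ∑' j, d i j = 1) (hd' : ∀ j, ∑' i, d i j ≤ 1)
    (hdx : ∀ j, ∑' i, d i j * ENNReal.ofReal (μ i) = ENNReal.ofReal (x j)) :
    clEntropy μ ≤ clEntropy x := by
  rw [clEntropy_of_hasSum hμ hμM, clEntropy_of_hasSum hx hxM]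
  have hj : ∀ j, ∑' i, d i j * entTerm M (μ i) ≤ entTerm M (x j) := by
    intro j
    rcases (hx j).eq_or_lt with h0 | h0
    · have h := hdx j
      rw [← h0, ENNReal.ofReal_zero, ENNReal.tsum_eq_zero] at h
      rw [ENNReal.tsum_eq_zero.2 fun i => ?_]
      · exact zero_le
      rcases mul_eq_zero.1 (h i) with h | h
      · simp [h]
      · have : μ i = 0 := le_antisymm (ENNReal.ofReal_eq_zero.1 h) (hμ i)
        simp [this]
    have h := ENNReal.tsum_le_tsum fun i => mul_le_mul_right
      (entTerm_add_le (hμ i) (HasSum.le_total hμ hμM i) h0) (d i j)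
    simp_rw [mul_add, ← mul_assoc] at h
    rw [ENNReal.tsum_add, ENNReal.tsum_add, hdx j, ENNReal.tsum_mul_right, hdx j,
      ENNReal.tsum_mul_right, ← ENNReal.ofReal_mul (hx j)] at h
    have h2 : (∑' i, d i j) * ENNReal.ofReal (x j) ≤ ENNReal.ofReal (x j) := by
      calc _ ≤ 1 * ENNReal.ofReal (x j) := by gcongr; exact hd' j
        _ = _ := one_mul _
    exact (ENNReal.add_le_add_iff_right ENNReal.ofReal_ne_top).1 (h.trans (by gcongr; rfl))
  calc ∑' i, entTerm M (μ i) = ∑' i, ∑' j, d i j * entTerm M (μ i) := by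
        congr 1 with i
        rw [ENNReal.tsum_mul_right]
        by_cases h : μ i = 0
        · simp [h]
        · rw [hd i h, one_mul]
    _ = ∑' j, ∑' i, d i j * entTerm M (μ i) := ENNReal.tsum_comm
    _ ≤ _ := ENNReal.tsum_le_tsum hj

lemma clEntropy_equiv {ι κ : Type*} (e : ι ≃ κ) (x : κ → ℝ) :
    clEntropy (fun i => x (e i)) = clEntropy x := by
  rw [clEntropy, clEntropy, e.tsum_eq x,
    e.tsum_eq (fun i => ENNReal.ofReal (Real.negMulLog (x i / ∑' j, x j)))]

lemma clEntropy_subtype {ι : Type*} (S : Set ι) {x : ι → ℝ} (hx : ∀ i ∉ S, x i = 0) :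
    clEntropy (fun i : S => x i) = clEntropy x := by
  have h1 : ∑' i : S, x i = ∑' i, x i :=
    tsum_subtype_eq_of_support_subset fun i hi => by_contra fun h => hi (hx i h)
  rw [clEntropy, clEntropy, h1]
  congr 1
  refine tsum_subtype_eq_of_support_subset
    (f := fun i => ENNReal.ofReal (Real.negMulLog (x i / ∑' j, x j)))
    fun i hi => by_contra fun h => hi ?_
  simp [hx i h]

lemma clEntropy_fintype {ι : Type*} [Fintype ι] {x : ι → ℝ} (hx : ∀ i, 0 ≤ x i) :
    clEntropy x =
      ENNReal.ofReal (∑ i, Real.negMulLog (x i) - Real.negMulLog (∑ i, x i)) := by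
  have h := hasSum_fintype x
  rw [clEntropy_of_hasSum hx h, tsum_fintype]
  simp_rw [entTerm]
  rw [← ENNReal.ofReal_sum_of_nonneg
    fun i _ => mul_log_div_nonneg (hx i) (HasSum.le_total hx h i)]
  congr 1
  set X := ∑ i, x i with hX
  have : ∀ i, x i * Real.log (X / x i) = Real.negMulLog (x i) + x i * Real.log X := by
    intro i
    rcases (hx i).eq_or_lt with h0 | h0
    · simp [← h0]
    have : X ≠ 0 := (h0.trans_le (HasSum.le_total hx h i)).ne'
    rw [Real.negMulLog, Real.log_div this h0.ne']
    ring
  simp_rw [this, Finset.sum_add_distrib, ← Finset.sum_mul, ← hX, Real.negMulLog]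
  ring

end Classical

section Truncation

lemma tendsto_entTerm_self {u : ℕ → ℝ} {M : ℝ} (hu : Tendsto u atTop (𝓝 M)) :
    Tendsto (fun k => entTerm M (u k)) atTop (𝓝 0) := by
  have h : ∀ x : ℝ, M ≠ 0 → x * Real.log (M / x) = x * Real.log M + Real.negMulLog x := by
    intro x hM
    by_cases hx : x = 0
    · simp [hx]
    · rw [Real.log_div hM hx, Real.negMulLog]; ring
  by_cases hM : M = 0
  · simp [hM, entTerm]
  simp_rw [entTerm, h _ hM]
  have h2 : Tendsto (fun k => u k * Real.log M + Real.negMulLog (u k)) atTop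
      (𝓝 (M * Real.log M + Real.negMulLog M)) :=
    (hu.mul_const _).add ((Real.continuous_negMulLog.tendsto M).comp hu)
  have e : M * Real.log M + Real.negMulLog M = 0 := by rw [Real.negMulLog]; ring
  rw [e] at h2
  simpa using ENNReal.tendsto_ofReal h2

/-- A family with finite entropy is exhausted by the finite sets of its large members, with
explicit control of the cardinalities and of the remaining mass. -/
lemma exists_truncation {ι : Type*} {a : ι → ℝ} {M : ℝ} (ha : ∀ i, 0 ≤ a i) (hM : HasSum a M)
    (hfin : clEntropy a ≠ ∞) :
    ∃ S : ℕ → Finset ι, (∀ k, ((S k).card : ℝ) ≤ k + 1) ∧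
      Tendsto (fun k => M - ∑ i ∈ S k, a i) atTop (𝓝 0) ∧
      Tendsto (fun k : ℕ => (M - ∑ i ∈ S k, a i) * Real.log (k + 1)) atTop (𝓝 0) ∧
      Tendsto (fun k => clEntropy (fun i : S k => a i)) atTop (𝓝 (clEntropy a)) := by
  have hM0 : 0 ≤ M := hM.nonneg ha
  have haM : ∀ i, a i ≤ M := HasSum.le_total ha hM
  have hfinite : ∀ k : ℕ, {i | M / (k + 1) < a i}.Finite := by
    intro k
    rcases hM0.eq_or_lt with h | h
    · convert Set.finite_empty
      ext i
      simpa [← h] using (haM i).trans h.symm.le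
    · have h1 := hM.summable.tendsto_cofinite_zero.eventually
        (gt_mem_nhds (show 0 < M / ((k : ℝ) + 1) by positivity))
      rw [eventually_cofinite] at h1
      exact h1.subset fun i hi => by simpa using le_of_lt hi
  set S : ℕ → Finset ι := fun k => (hfinite k).toFinset with hS
  have hmem : ∀ k i, i ∈ S k ↔ M / (k + 1) < a i := by simp [hS]
  have hev : ∀ i, 0 < a i → ∀ᶠ k in atTop, i ∈ S k := by
    intro i hi
    have h1 : Tendsto (fun k : ℕ => M / ((k : ℝ) + 1)) atTop (𝓝 0) :=
      tendsto_const_nhds.div_atTop (tendsto_natCast_atTop_atTop.atTop_add tendsto_const_nhds)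
    filter_upwards [h1.eventually (gt_mem_nhds hi)] with k hk
    exact (hmem k i).2 hk
  set e : ι → ℝ := fun i => a i * Real.log (M / a i) with he
  have he0 : ∀ i, 0 ≤ e i := fun i => mul_log_div_nonneg (ha i) (haM i)
  have hes : Summable e := by
    rw [clEntropy_of_hasSum ha hM] at hfin
    have := ENNReal.summable_toReal hfin
    exact this.congr fun i => ENNReal.toReal_ofReal (he0 i)
  have htail : ∀ f : ι → ℝ, (∀ i, 0 ≤ f i) → (∀ i, a i = 0 → f i = 0) → Summable f →
      Tendsto (fun k => ∑' i, if i ∈ S k then 0 else f i) atTop (𝓝 0) := by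
    intro f hf hf' hfs
    have := tendsto_tsum_of_dominated_convergence (𝓕 := atTop)
      (f := fun k i => if i ∈ S k then 0 else f i) (g := fun _ : ι => (0 : ℝ)) hfs
      (fun i => ?_) (Eventually.of_forall fun k i => ?_)
    · simpa using this
    · rcases (ha i).eq_or_lt with h | h
      · simp [hf' i h.symm]
      · refine tendsto_const_nhds.congr' ?_
        filter_upwards [hev i h] with k hk
        simp [hk]
    · split_ifs <;> simp [hf i, abs_of_nonneg]
  have hsplit : ∀ f : ι → ℝ, Summable f → ∀ k,
      ∑' i, f i - ∑ i ∈ S k, f i = ∑' i, if i ∈ S k then 0 else f i := by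
    intro f hf k
    have h1 : HasSum (fun i => if i ∈ S k then f i else 0) (∑ i ∈ S k, f i) := by
      have : HasSum (fun i => if i ∈ S k then f i else 0)
          (∑ i ∈ S k, if i ∈ S k then f i else 0) :=
        hasSum_sum_of_ne_finset_zero (by intro i hi; simp [hi])
      rwa [Finset.sum_congr rfl fun i hi => by rw [if_pos hi]] at this
    rw [← (hf.hasSum.sub h1).tsum_eq]
    congr 1 with i
    split_ifs <;> simp
  have hm : Tendsto (fun k => M - ∑ i ∈ S k, a i) atTop (𝓝 0) := by
    have := htail a ha (fun i h => h) hM.summable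
    simp_rw [← hsplit a hM.summable, hM.tsum_eq] at this
    exact this
  have hte := htail e he0 (fun i h => by simp [he, h]) hes
  refine ⟨S, fun k => ?_, hm, ?_, ?_⟩
  · rcases hM0.eq_or_lt with h | h
    · have : S k = ∅ := by
        ext i
        simpa [hmem, ← h] using (haM i).trans h.symm.le
      rw [this]
      simp; positivity
    · have h1 : ∑ i ∈ S k, M / ((k : ℝ) + 1) ≤ M :=
        (Finset.sum_le_sum fun i hi => ((hmem k i).1 hi).le).trans
          (sum_le_hasSum _ (fun i _ => ha i) hM)
      rw [Finset.sum_const, nsmul_eq_mul, mul_div_assoc', div_le_iff₀ (by positivity)] at h1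
      nlinarith
  · refine squeeze_zero (fun k => ?_) (fun k => ?_) hte
    · exact mul_nonneg (sub_nonneg.2 (sum_le_hasSum _ (fun i _ => ha i) hM))
        (Real.log_nonneg (by linarith [(Nat.cast_nonneg k : (0 : ℝ) ≤ k)]))
    · have hi1 : Summable fun i => if i ∈ S k then 0 else a i :=
        hM.summable.of_nonneg_of_le (fun i => by split_ifs <;> simp [ha])
          (fun i => by split_ifs <;> simp [ha])
      have hi2 : Summable fun i => if i ∈ S k then 0 else e i :=
        hes.of_nonneg_of_le (fun i => by split_ifs <;> simp [he0])
          (fun i => by split_ifs <;> simp [he0])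
      rw [← hM.tsum_eq, hsplit a hM.summable, ← tsum_mul_right]
      refine (hi1.mul_right _).tsum_le_tsum (fun i => ?_) hi2
      split_ifs with h
      · simp
      · rcases (ha i).eq_or_lt with h0 | h0
        · simp [← h0, he]
        rw [hmem, not_lt] at h
        simp only [he]
        gcongr
        rw [le_div_iff₀ (by positivity)] at h ⊢
        linarith
  · have h1 : ∀ k, ∑ i ∈ S k, entTerm M (a i) =
        clEntropy (fun i : S k => a i) + entTerm M (∑ i ∈ S k, a i) := by
      intro k
      have h2 : HasSum (fun i : S k => a i) (∑ i ∈ S k, a i) := by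
        rw [← Finset.sum_coe_sort]
        exact hasSum_fintype _
      rw [← tsum_entTerm_of_le (x := fun i : S k => a i) (fun i => ha i) h2 (sum_le_hasSum _ (fun i _ => ha i) hM),
        tsum_fintype, Finset.sum_coe_sort (S k) fun i => entTerm M (a i)]
    have h2 : ∀ k, clEntropy (fun i : S k => a i) =
        ∑ i ∈ S k, entTerm M (a i) - entTerm M (∑ i ∈ S k, a i) := by
      intro k
      rw [h1, ENNReal.add_sub_cancel_right (by simp [entTerm])]
    have h3 : Tendsto (fun k => ∑ i ∈ S k, a i) atTop (𝓝 M) := by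
      have := (tendsto_const_nhds (x := M)).sub hm
      simpa using this
    have h4 : Tendsto (fun k => ∑ i ∈ S k, entTerm M (a i)) atTop (𝓝 (clEntropy a)) := by
      rw [clEntropy_of_hasSum ha hM]
      have h5 : Tendsto (fun k => ∑ i ∈ S k, e i) atTop (𝓝 (∑' i, e i)) := by
        simp_rw [← hsplit e hes] at hte
        simpa using (tendsto_const_nhds (x := ∑' i, e i)).sub hte
      have h6 := ENNReal.tendsto_ofReal h5
      rw [ENNReal.ofReal_tsum_of_nonneg he0 hes] at h6
      simp_rw [ENNReal.ofReal_sum_of_nonneg fun i _ => he0 i] at h6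
      exact h6
    simp_rw [h2]
    simpa using ENNReal.Tendsto.sub h4 (tendsto_entTerm_self h3) (Or.inl hfin)

end Truncation

section Operators

variable {E F G : Type*}
variable [NormedAddCommGroup E] [InnerProductSpace ℂ E] [CompleteSpace E]
variable [NormedAddCommGroup F] [InnerProductSpace ℂ F] [CompleteSpace F]
variable [NormedAddCommGroup G] [InnerProductSpace ℂ G] [CompleteSpace G]

lemma sum_le_traceNorm {ι : Type*} [Fintype ι] (A : E →L[ℂ] E) {e f : ι → E}
    (he : Orthonormal ℂ e) (hf : Orthonormal ℂ f) :
    ∑ i, ENNReal.ofReal ‖(inner ℂ (e i) (A (f i)) : ℂ)‖ ≤ traceNorm A := by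
  let σ := (Fintype.equivFin ι).symm
  rw [← Equiv.sum_comp σ]
  exact le_iSup_of_le (Fintype.card ι) (le_iSup_of_le (e ∘ σ) (le_iSup_of_le (f ∘ σ)
    (le_iSup_of_le (he.comp σ σ.injective) (le_iSup_of_le (hf.comp σ σ.injective) le_rfl))))

lemma sum_le_traceENN {ι : Type*} [Fintype ι] (A : E →L[ℂ] E) {e : ι → E}
    (he : Orthonormal ℂ e) : ∑ i, ENNReal.ofReal (qf A (e i)) ≤ traceENN A := by
  let σ := (Fintype.equivFin ι).symm
  rw [← Equiv.sum_comp σ]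
  exact le_iSup_of_le (Fintype.card ι) (le_iSup_of_le (e ∘ σ)
    (le_iSup_of_le (he.comp σ σ.injective) le_rfl))

lemma traceNorm_le {A : E →L[ℂ] E} {C : ℝ≥0∞}
    (h : ∀ (n : ℕ) (e f : Fin n → E), Orthonormal ℂ e → Orthonormal ℂ f →
      ∑ i, ENNReal.ofReal ‖(inner ℂ (e i) (A (f i)) : ℂ)‖ ≤ C) : traceNorm A ≤ C :=
  iSup_le fun n => iSup_le fun e => iSup_le fun f => iSup_le fun he => iSup_le fun hf =>
    h n e f he hf

lemma traceNorm_add_le (A B : E →L[ℂ] E) : traceNorm (A + B) ≤ traceNorm A + traceNorm B := by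
  refine traceNorm_le fun n e f he hf => ?_
  refine le_trans ?_ (add_le_add (sum_le_traceNorm A he hf) (sum_le_traceNorm B he hf))
  rw [← Finset.sum_add_distrib]
  refine Finset.sum_le_sum fun i _ => ?_
  rw [← ENNReal.ofReal_add (norm_nonneg _) (norm_nonneg _)]
  apply ENNReal.ofReal_le_ofReal
  rw [add_apply, inner_add_right]
  exact norm_add_le _ _

lemma traceNorm_smul_le (c : ℂ) (A : E →L[ℂ] E) :
    traceNorm (c • A) ≤ ENNReal.ofReal ‖c‖ * traceNorm A := by
  refine traceNorm_le fun n e f he hf => ?_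
  refine le_trans (le_of_eq ?_) (mul_le_mul_right (sum_le_traceNorm A he hf) _)
  rw [Finset.mul_sum]
  refine Finset.sum_congr rfl fun i _ => ?_
  rw [← ENNReal.ofReal_mul (norm_nonneg _), smul_apply, inner_smul_right,
    norm_mul]

@[simp] lemma traceNorm_zero : traceNorm (0 : E →L[ℂ] E) = 0 := by
  refine le_antisymm (traceNorm_le fun n e f he hf => ?_) zero_le
  simp

lemma traceNorm_sub_comm (A B : E →L[ℂ] E) : traceNorm (A - B) = traceNorm (B - A) := by
  have h : ∀ A B : E →L[ℂ] E, traceNorm (A - B) ≤ traceNorm (B - A) := fun A B => by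
    have := traceNorm_smul_le (-1) (B - A)
    simpa using this
  exact le_antisymm (h _ _) (h _ _)

lemma isTC_zero : IsTC (0 : E →L[ℂ] E) := by simp [IsTC]

lemma IsTC.add {A B : E →L[ℂ] E} (hA : IsTC A) (hB : IsTC B) : IsTC (A + B) :=
  ne_top_of_le_ne_top (ENNReal.add_ne_top.2 ⟨hA, hB⟩) (traceNorm_add_le A B)

lemma IsTC.smul {A : E →L[ℂ] E} (hA : IsTC A) (c : ℂ) : IsTC (c • A) :=
  ne_top_of_le_ne_top (ENNReal.mul_ne_top ENNReal.ofReal_ne_top hA) (traceNorm_smul_le c A)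

lemma IsTC.sub {A B : E →L[ℂ] E} (hA : IsTC A) (hB : IsTC B) : IsTC (A - B) := by
  have := hA.add (hB.smul (-1))
  simpa [sub_eq_add_neg] using this

lemma norm_inner_le_traceNorm {A : E →L[ℂ] E} (hA : IsTC A) (x y : E) :
    ‖(inner ℂ x (A y) : ℂ)‖ ≤ ‖x‖ * ‖y‖ * (traceNorm A).toReal := by
  by_cases hx : x = 0
  · simp [hx]
  by_cases hy : y = 0
  · simp [hy]
  have hx' : 0 < ‖x‖ := norm_pos_iff.2 hx
  have hy' : 0 < ‖y‖ := norm_pos_iff.2 hy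
  have ho : ∀ z : E, z ≠ 0 → Orthonormal ℂ (fun _ : Unit => ((‖z‖ : ℂ)⁻¹) • z) := fun z hz => by
    refine ⟨fun i => ?_, fun i j hij => (hij rfl).elim⟩
    rw [norm_smul]
    simp [norm_ne_zero_iff.2 hz]
  have h := sum_le_traceNorm A (ho x hx) (ho y hy)
  rw [Fintype.sum_unique, ENNReal.ofReal_le_iff_le_toReal hA] at h
  simp only [map_smul, inner_smul_left, inner_smul_right, norm_mul] at h
  simp only [map_inv₀, Complex.conj_ofReal, norm_inv, Complex.norm_real, norm_norm] at h
  have e : ‖(inner ℂ x (A y) : ℂ)‖ = ‖x‖ * ‖y‖ * (‖y‖⁻¹ * (‖x‖⁻¹ * ‖(inner ℂ x (A y) : ℂ)‖)) := by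
    field_simp
  rw [e]
  gcongr

lemma abs_qf_le_traceNorm {A : E →L[ℂ] E} (hA : IsTC A) (x : E) :
    |qf A x| ≤ ‖x‖ * ‖x‖ * (traceNorm A).toReal :=
  (Complex.abs_re_le_norm _).trans (norm_inner_le_traceNorm hA x x)

lemma qf_add (A B : E →L[ℂ] E) (x : E) : qf (A + B) x = qf A x + qf B x := by
  simp [qf]

lemma qf_sub (A B : E →L[ℂ] E) (x : E) : qf (A - B) x = qf A x - qf B x := by
  simp [qf]

lemma qf_real_smul (c : ℝ) (A : E →L[ℂ] E) (x : E) : qf ((c : ℂ) • A) x = c * qf A x := by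
  simp [qf]

lemma qf_nonneg {A : E →L[ℂ] E} (hA : A.IsPositive) (x : E) : 0 ≤ qf A x :=
  hA.re_inner_nonneg_right x

lemma inner_eq_qf {A : E →L[ℂ] E} (hA : A.IsPositive) (x : E) :
    (inner ℂ x (A x) : ℂ) = qf A x := by
  have h := hA.inner_nonneg_right x
  rw [Complex.le_def] at h
  refine Complex.ext rfl ?_
  simpa using h.2.symm

lemma exists_sqrt {A : E →L[ℂ] E} (hA : A.IsPositive) :
    ∃ R : E →L[ℂ] E, (∀ x y, (inner ℂ (R x) y : ℂ) = inner ℂ x (R y)) ∧ ∀ x, A x = R (R x) := by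
  have h0 : 0 ≤ A := (ContinuousLinearMap.nonneg_iff_isPositive A).2 hA
  refine ⟨CFC.sqrt A, fun x y => ?_, fun x => ?_⟩
  · exact ((ContinuousLinearMap.nonneg_iff_isPositive _).1 (CFC.sqrt_nonneg A)).isSymmetric x y
  · conv_lhs => rw [← CFC.sqrt_mul_sqrt_self A h0]
    rfl

lemma qf_eq_norm_sq {A R : E →L[ℂ] E} (hR : ∀ x y, (inner ℂ (R x) y : ℂ) = inner ℂ x (R y))
    (hA : ∀ x, A x = R (R x)) (x : E) : qf A x = ‖R x‖ ^ 2 := by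
  rw [qf, hA, ← hR, ← inner_self_eq_norm_sq (𝕜 := ℂ)]
  rfl

lemma tsum_norm_inner_sq {ι : Type*} (b : HilbertBasis ι ℂ E) (x : E) :
    ∑' i, ENNReal.ofReal (‖(inner ℂ (b i) x : ℂ)‖ ^ 2) = ENNReal.ofReal (‖x‖ ^ 2) := by
  have h := Complex.hasSum_re (b.hasSum_inner_mul_inner x x)
  refine tsum_ofReal_of_hasSum (fun i => by positivity) ?_
  convert h using 1
  · ext i
    rw [← inner_conj_symm x (b i), ← Complex.normSq_eq_conj_mul_self, Complex.ofReal_re,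
      Complex.normSq_eq_norm_sq]
  · rw [← inner_self_eq_norm_sq (𝕜 := ℂ)]; rfl

lemma tsum_norm_inner_sq_le {ι : Type*} {e : ι → E} (he : Orthonormal ℂ e) (x : E) :
    ∑' i, ENNReal.ofReal (‖(inner ℂ (e i) x : ℂ)‖ ^ 2) ≤ ENNReal.ofReal (‖x‖ ^ 2) := by
  rw [← ENNReal.ofReal_tsum_of_nonneg (fun i => by positivity) (he.inner_products_summable x)]
  exact ENNReal.ofReal_le_ofReal (he.tsum_inner_products_le x)

/-- The diagonal sum of a positive operator over an orthonormal family is dominated by the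
diagonal sum over any orthonormal basis. -/
lemma tsum_qf_le_tsum_qf {ι κ : Type*} {A : E →L[ℂ] E} (hA : A.IsPositive) {e : ι → E}
    (he : Orthonormal ℂ e) (b : HilbertBasis κ ℂ E) :
    ∑' i, ENNReal.ofReal (qf A (e i)) ≤ ∑' j, ENNReal.ofReal (qf A (b j)) := by
  obtain ⟨R, hR, hAR⟩ := exists_sqrt hA
  simp_rw [qf_eq_norm_sq hR hAR, ← tsum_norm_inner_sq b (R (e _))]
  rw [ENNReal.tsum_comm]
  refine ENNReal.tsum_le_tsum fun j => ?_
  refine le_trans (le_of_eq ?_) (tsum_norm_inner_sq_le he (R (b j)))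
  congr 1 with i
  rw [← hR, norm_inner_symm]

lemma traceENN_eq_tsum {ι : Type*} {A : E →L[ℂ] E} (hA : A.IsPositive)
    (b : HilbertBasis ι ℂ E) : traceENN A = ∑' i, ENNReal.ofReal (qf A (b i)) := by
  apply le_antisymm
  · refine iSup_le fun n => iSup_le fun e => iSup_le fun he => ?_
    rw [← tsum_fintype (L := .unconditional _)]
    exact tsum_qf_le_tsum_qf hA he b
  · rw [ENNReal.tsum_eq_iSup_sum]
    refine iSup_le fun s => ?_
    rw [← Finset.sum_coe_sort]
    exact sum_le_traceENN A (b.orthonormal.comp _ Subtype.val_injective)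

lemma traceNorm_eq_traceENN {A : E →L[ℂ] E} (hA : A.IsPositive) :
    traceNorm A = traceENN A := by
  apply le_antisymm
  · refine traceNorm_le fun n e f he hf => ?_
    obtain ⟨R, hR, hAR⟩ := exists_sqrt hA
    have h2 : ∀ i, ENNReal.ofReal ‖(inner ℂ (e i) (A (f i)) : ℂ)‖ ≤
        2⁻¹ * ENNReal.ofReal (qf A (e i)) + 2⁻¹ * ENNReal.ofReal (qf A (f i)) := by
      intro i
      have e2 : (2⁻¹ : ℝ≥0∞) = ENNReal.ofReal 2⁻¹ := by
        rw [ENNReal.ofReal_inv_of_pos two_pos]; simp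
      rw [e2, ← ENNReal.ofReal_mul (by positivity), ← ENNReal.ofReal_mul (by positivity),
        ← ENNReal.ofReal_add (mul_nonneg (by positivity) (qf_nonneg hA _))
          (mul_nonneg (by positivity) (qf_nonneg hA _)), qf_eq_norm_sq hR hAR,
        qf_eq_norm_sq hR hAR, hAR, ← hR]
      apply ENNReal.ofReal_le_ofReal
      have := norm_inner_le_norm (𝕜 := ℂ) (R (e i)) (R (f i))
      nlinarith [sq_nonneg (‖R (e i)‖ - ‖R (f i)‖)]
    refine (Finset.sum_le_sum fun i _ => h2 i).trans ?_
    rw [Finset.sum_add_distrib, ← Finset.mul_sum, ← Finset.mul_sum]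
    refine (add_le_add (mul_le_mul_right (sum_le_traceENN A he) _)
      (mul_le_mul_right (sum_le_traceENN A hf) _)).trans ?_
    rw [← add_mul, ENNReal.inv_two_add_inv_two, one_mul]
  · refine iSup_le fun n => iSup_le fun e => iSup_le fun he => ?_
    refine le_trans (Finset.sum_le_sum fun i _ => ENNReal.ofReal_le_ofReal ?_)
      (sum_le_traceNorm A he he)
    exact Complex.re_le_norm _

/-- The trace of a positive trace-class operator, as a real number. -/
def rtr (A : E →L[ℂ] E) : ℝ := (traceENN A).toReal

lemma rtr_nonneg (A : E →L[ℂ] E) : 0 ≤ rtr A := ENNReal.toReal_nonneg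

lemma hasSum_qf {ι : Type*} {A : E →L[ℂ] E} (hA : A.IsPositive) (hTC : IsTC A)
    (b : HilbertBasis ι ℂ E) : HasSum (fun i => qf A (b i)) (rtr A) := by
  have h := traceENN_eq_tsum hA b
  have ht : ∑' i, ENNReal.ofReal (qf A (b i)) ≠ ∞ := by
    rw [← h, ← traceNorm_eq_traceENN hA]; exact hTC
  have h1 := ENNReal.hasSum_toReal ht
  rw [← ENNReal.tsum_toReal_eq fun i => ENNReal.ofReal_ne_top, ← h] at h1
  simp only [ENNReal.toReal_ofReal (qf_nonneg hA _)] at h1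
  exact h1

lemma qf_le_rtr {A : E →L[ℂ] E} (hA : A.IsPositive) (hTC : IsTC A) (x : E) :
    qf A x ≤ ‖x‖ * ‖x‖ * rtr A := by
  rw [rtr, ← traceNorm_eq_traceENN hA]
  exact (le_abs_self _).trans (abs_qf_le_traceNorm hTC x)

/-- The compression `V† A V`. -/
def compr (V : F →L[ℂ] E) (A : E →L[ℂ] E) : F →L[ℂ] F :=
  ContinuousLinearMap.adjoint V ∘L A ∘L V

lemma inner_compr (V : F →L[ℂ] E) (A : E →L[ℂ] E) (x y : F) :
    (inner ℂ x (compr V A y) : ℂ) = inner ℂ (V x) (A (V y)) := by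
  simp [compr, ContinuousLinearMap.adjoint_inner_right]

lemma qf_compr (V : F →L[ℂ] E) (A : E →L[ℂ] E) (x : F) : qf (compr V A) x = qf A (V x) := by
  rw [qf, inner_compr, qf]

lemma compr_isPositive (V : F →L[ℂ] E) {A : E →L[ℂ] E} (hA : A.IsPositive) :
    (compr V A).IsPositive := hA.adjoint_conj V

lemma compr_sub (V : F →L[ℂ] E) (A B : E →L[ℂ] E) :
    compr V (A - B) = compr V A - compr V B := by
  ext x; simp [compr]

lemma traceNorm_compr_le (V : F →ₗᵢ[ℂ] E) (A : E →L[ℂ] E) :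
    traceNorm (compr V.toContinuousLinearMap A) ≤ traceNorm A := by
  refine traceNorm_le fun n e f he hf => ?_
  simp_rw [inner_compr]
  exact sum_le_traceNorm A (he.comp_linearIsometry V) (hf.comp_linearIsometry V)

lemma compr_isTC (V : F →ₗᵢ[ℂ] E) {A : E →L[ℂ] E} (hA : IsTC A) :
    IsTC (compr V.toContinuousLinearMap A) :=
  ne_top_of_le_ne_top hA (traceNorm_compr_le V A)

end Operators

section Spectral

variable {E F G : Type*}
variable [NormedAddCommGroup E] [InnerProductSpace ℂ E] [CompleteSpace E]
variable [NormedAddCommGroup F] [InnerProductSpace ℂ F] [CompleteSpace F]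
variable [NormedAddCommGroup G] [InnerProductSpace ℂ G] [CompleteSpace G]

lemma isCompactOperator_rankOneM (x y : E) : IsCompactOperator (rankOneM x y) :=
  (isCompactOperator_of_locallyCompactSpace_dom (innerSL ℂ y)).continuous_comp
    (g := fun c : ℂ => c • x) (by fun_prop)

/-- The operator `R` is a norm limit of its finite-rank truncations along `b`, provided that the
Hilbert-Schmidt norm of `R` is finite. -/
lemma isCompactOperator_of_hilbertSchmidt {ι : Type*} {R : E →L[ℂ] E}
    (hR : ∀ x y, (inner ℂ (R x) y : ℂ) = inner ℂ x (R y)) (b : HilbertBasis ι ℂ E)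
    (hs : ∑' i, ENNReal.ofReal (‖R (b i)‖ ^ 2) ≠ ∞) : IsCompactOperator R := by
  let P : Finset ι → E →L[ℂ] E := fun s => ∑ i ∈ s, rankOneM (b i) (R (b i))
  have hPapply : ∀ s x, P s x = ∑ i ∈ s, (inner ℂ (b i) (R x) : ℂ) • b i := by
    intro s x
    simp [P, rankOneM, hR]
  have hPcompact : ∀ s, IsCompactOperator (P s) := by
    intro s
    have : P s ∈ compactOperator (RingHom.id ℂ) E E :=
      Submodule.sum_mem _ fun i _ => isCompactOperator_rankOneM _ _
    exact this
  have htail := ENNReal.tendsto_tsum_compl_atTop_zero hs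
  refine isCompactOperator_of_tendsto (F := P) (l := atTop) ?_ (Eventually.of_forall hPcompact)
  rw [tendsto_iff_norm_sub_tendsto_zero]
  have hbound : ∀ s x, ENNReal.ofReal (‖(P s - R) x‖ ^ 2) ≤
      ENNReal.ofReal (‖x‖ ^ 2) * ∑' i : {i // i ∉ s}, ENNReal.ofReal (‖R (b i)‖ ^ 2) := by
    intro s x
    rw [← tsum_norm_inner_sq b, ← ENNReal.tsum_mul_left]
    have hzero : ∀ i ∈ s, (inner ℂ (b i) ((P s - R) x) : ℂ) = 0 := by
      intro i hi
      rw [sub_apply, inner_sub_right, hPapply, b.orthonormal.inner_right_sum _ hi, sub_self]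
    rw [← tsum_subtype_eq_of_support_subset (s := {i | i ∉ s})]
    · refine ENNReal.tsum_le_tsum fun i => ?_
      rw [← ENNReal.ofReal_mul (by positivity)]
      apply ENNReal.ofReal_le_ofReal
      have h0 : (inner ℂ (b i) (P s x) : ℂ) = 0 := by
        rw [hPapply, inner_sum]
        refine Finset.sum_eq_zero fun j hj => ?_
        rw [inner_smul_right, b.orthonormal.2 (fun h => i.2 (by rw [h]; exact hj)), mul_zero]
      rw [sub_apply, inner_sub_right, h0, zero_sub, norm_neg, ← hR, ← mul_pow]
      gcongr
      rw [mul_comm]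
      exact norm_inner_le_norm _ _
    · intro i hi
      by_contra h
      exact hi (by beta_reduce; rw [hzero i (not_not.1 h)]; simp)
  have hnorm : ∀ s, ENNReal.ofReal (‖P s - R‖ ^ 2) ≤
      ∑' i : {i // i ∉ s}, ENNReal.ofReal (‖R (b i)‖ ^ 2) := by
    intro s
    have hfin : ∑' i : {i // i ∉ s}, ENNReal.ofReal (‖R (b i)‖ ^ 2) ≠ ∞ :=
      ne_top_of_le_ne_top hs (ENNReal.tsum_comp_le_tsum_of_injective Subtype.val_injective _)
    rw [ENNReal.ofReal_le_iff_le_toReal hfin, ← Real.le_sqrt (norm_nonneg _) ENNReal.toReal_nonneg]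
    refine ContinuousLinearMap.opNorm_le_bound _ (Real.sqrt_nonneg _) fun x => ?_
    rw [← Real.sqrt_sq (norm_nonneg x), ← Real.sqrt_mul ENNReal.toReal_nonneg]
    refine Real.le_sqrt_of_sq_le ?_
    have := hbound s x
    rw [ENNReal.ofReal_le_iff_le_toReal (ENNReal.mul_ne_top ENNReal.ofReal_ne_top hfin),
      ENNReal.toReal_mul, ENNReal.toReal_ofReal (by positivity)] at this
    linarith
  have h2 : Tendsto (fun s => ‖P s - R‖ ^ 2) atTop (𝓝 0) := by
    have h3 := tendsto_of_tendsto_of_tendsto_of_le_of_le tendsto_const_nhds htail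
      (fun s => zero_le) hnorm
    have h4 := (ENNReal.tendsto_toReal ENNReal.zero_ne_top).comp h3
    simpa [Function.comp_def, ENNReal.toReal_ofReal] using h4
  have h5 := (Real.continuous_sqrt.tendsto 0).comp h2
  simpa [Function.comp_def, Real.sqrt_sq] using h5

lemma isCompactOperator_of_isTC {A : E →L[ℂ] E} (hA : A.IsPositive) (hTC : IsTC A) :
    IsCompactOperator A := by
  obtain ⟨R, hR, hAR⟩ := exists_sqrt hA
  obtain ⟨w, b, -⟩ := exists_hilbertBasis ℂ E
  have hc : IsCompactOperator R := by
    refine isCompactOperator_of_hilbertSchmidt hR b ?_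
    simp_rw [← qf_eq_norm_sq hR hAR]
    rw [← traceENN_eq_tsum hA b, ← traceNorm_eq_traceENN hA]
    exact hTC
  have : (A : E → E) = R ∘ R := funext hAR
  rw [this]
  exact hc.comp_clm R

/-- A Hilbert basis consisting of eigenvectors. -/
def IsEigenbasis {ι : Type*} (A : E →L[ℂ] E) (b : HilbertBasis ι ℂ E) : Prop :=
  ∀ i, A (b i) = (qf A (b i) : ℂ) • b i

lemma eigen_of_smul {A : E →L[ℂ] E} (hA : A.IsPositive) {x : E} (hx : ‖x‖ = 1) {c : ℂ}
    (h : A x = c • x) : A x = (qf A x : ℂ) • x := by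
  rw [← inner_eq_qf hA, h, inner_smul_right, inner_self_eq_norm_sq_to_K, hx]
  simp

lemma exists_eigenbasis {A : E →L[ℂ] E} (hA : A.IsPositive) (hTC : IsTC A) :
    ∃ (s : Set E) (b : HilbertBasis s ℂ E), IsEigenbasis A b := by
  have hsym : (A : E →ₗ[ℂ] E).IsSymmetric := hA.isSymmetric
  have hbot := ContinuousLinearMap.orthogonalComplement_iSup_eigenspaces_eq_bot
    (isCompactOperator_of_isTC hA hTC) hsym
  let V := fun c : ℂ => Module.End.eigenspace (A : Module.End ℂ E) c
  have hcl : ∀ c, IsClosed (V c : Set E) := by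
    intro c
    have : (V c : Set E) = {x | A x = c • x} := by
      ext x; simp [V]
    rw [this]
    exact isClosed_eq A.continuous (by fun_prop)
  have : ∀ c, CompleteSpace (V c) := fun c => (hcl c).completeSpace_coe
  choose w b hb using fun c => exists_hilbertBasis ℂ (V c)
  have ho : Orthonormal ℂ (fun a : Σ c, w c => ((V a.1).subtypeₗᵢ (b a.1 a.2) : E)) :=
    hsym.orthogonalFamily_eigenspaces.orthonormal_sigma_orthonormal fun c => (b c).orthonormal
  set v : (Σ c, w c) → E := fun a => ((V a.1).subtypeₗᵢ (b a.1 a.2) : E) with hv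
  have hspan : (Submodule.span ℂ (Set.range ((↑) : Set.range v → E)))ᗮ = ⊥ := by
    rw [Subtype.range_coe, ← le_bot_iff, ← hbot]
    intro x hx
    rw [Submodule.mem_orthogonal] at hx
    rw [← Submodule.iInf_orthogonal, Submodule.mem_iInf]
    intro c
    rw [Submodule.mem_orthogonal']
    intro y hy
    have h1 := ((b c).hasSum_repr ⟨y, hy⟩).mapL ((innerSL ℂ x) ∘L (V c).subtypeL)
    refine h1.unique ?_
    have h0 : ∀ i, ((innerSL ℂ x) ∘L (V c).subtypeL) ((b c).repr ⟨y, hy⟩ i • b c i) = 0 := by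
      intro i
      rw [map_smul]
      have := hx _ (Submodule.subset_span ⟨⟨c, i⟩, rfl⟩)
      rw [inner_eq_zero_symm] at this
      simp only [ContinuousLinearMap.comp_apply, innerSL_apply_apply]
      rw [smul_eq_zero]
      exact Or.inr this
    simp_rw [h0]
    exact hasSum_zero
  refine ⟨Set.range v, HilbertBasis.mkOfOrthogonalEqBot ho.toSubtypeRange hspan, ?_⟩
  rintro ⟨_, ⟨c, j⟩, rfl⟩
  rw [HilbertBasis.coe_mkOfOrthogonalEqBot]
  refine eigen_of_smul hA (ho.1 _) (c := c) ?_
  exact Module.End.mem_eigenspace_iff.1 (b c j).2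

end Spectral

section QuantumEntropy

variable {E F G : Type*}
variable [NormedAddCommGroup E] [InnerProductSpace ℂ E] [CompleteSpace E]
variable [NormedAddCommGroup F] [InnerProductSpace ℂ F] [CompleteSpace F]
variable [NormedAddCommGroup G] [InnerProductSpace ℂ G] [CompleteSpace G]

lemma qEntropy_le {ι : Type*} (A : E →L[ℂ] E) (b : HilbertBasis ι ℂ E) :
    qEntropy A ≤ clEntropy (fun i => qf A (b i)) := by
  have hO : IsONB (Set.range b) := by
    refine ⟨b.orthonormal.toSubtypeRange, ?_⟩
    rw [Submodule.dense_iff_topologicalClosure_eq_top]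
    exact b.dense_span
  refine (iInf₂_le (Set.range b) hO).trans (le_of_eq ?_)
  exact (clEntropy_equiv (Equiv.ofInjective b b.orthonormal.linearIndependent.injective)
    (fun v : Set.range b => qf A v)).symm

lemma IsONB.exists_hilbertBasis {s : Set E} (hs : IsONB s) :
    ∃ b : HilbertBasis s ℂ E, ⇑b = ((↑) : s → E) := by
  refine ⟨HilbertBasis.mk hs.1 ?_, HilbertBasis.coe_mk _ _⟩
  rw [Subtype.range_coe, (Submodule.dense_iff_topologicalClosure_eq_top).1 hs.2]

/-- A family `x` with `∑ |x_j⟩⟨x_j| = X` has weights `‖x_j‖²` that are more mixed than the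
eigenvalues of `X`. -/
lemma clEntropy_eigen_le {ι κ : Type*} {X : E →L[ℂ] E} (hX : X.IsPositive) (hTC : IsTC X)
    {u : HilbertBasis ι ℂ E} (hu : IsEigenbasis X u) {x : κ → E}
    (hx : ∀ y, ∑' j, ENNReal.ofReal (‖(inner ℂ (x j) y : ℂ)‖ ^ 2) = ENNReal.ofReal (qf X y)) :
    clEntropy (fun i => qf X (u i)) ≤ clEntropy (fun j => ‖x j‖ ^ 2) := by
  have hμ : ∀ i, 0 ≤ qf X (u i) := fun i => qf_nonneg hX _
  have hz : ∀ i j, qf X (u i) = 0 → ‖(inner ℂ (u i) (x j) : ℂ)‖ ^ 2 = 0 := by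
    intro i j h
    have h1 := hx (u i)
    rw [h, ENNReal.ofReal_zero, ENNReal.tsum_eq_zero] at h1
    have h2 := ENNReal.ofReal_eq_zero.1 (h1 j)
    rw [norm_inner_symm]
    exact le_antisymm h2 (by positivity)
  have hxM : HasSum (fun j => ‖x j‖ ^ 2) (rtr X) := by
    have h1 : ∑' j, ENNReal.ofReal (‖x j‖ ^ 2) = traceENN X := by
      rw [traceENN_eq_tsum hX u]
      simp_rw [← tsum_norm_inner_sq u (x _), ← hx]
      rw [ENNReal.tsum_comm]
      simp_rw [norm_inner_symm]
    have h2 : ∑' j, ENNReal.ofReal (‖x j‖ ^ 2) ≠ ∞ := by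
      rw [h1, ← traceNorm_eq_traceENN hX]; exact hTC
    have h3 := ENNReal.hasSum_toReal h2
    rw [← ENNReal.tsum_toReal_eq fun i => ENNReal.ofReal_ne_top, h1] at h3
    simp only [ENNReal.toReal_ofReal (sq_nonneg _)] at h3
    exact h3
  refine clEntropy_le_of_mixing hμ (hasSum_qf hX hTC u) (fun j => by positivity) hxM
    (fun i j => ENNReal.ofReal (‖(inner ℂ (u i) (x j) : ℂ)‖ ^ 2 / qf X (u i))) ?_ ?_ ?_
  · intro i hi
    have hpos : 0 < qf X (u i) := (hμ i).lt_of_ne hi.symm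
    simp_rw [ENNReal.ofReal_div_of_pos hpos, div_eq_mul_inv]
    rw [ENNReal.tsum_mul_right]
    simp_rw [norm_inner_symm (u i)]
    rw [hx, ENNReal.mul_inv_cancel (by simpa using hpos) ENNReal.ofReal_ne_top]
  · intro j
    rw [ENNReal.tsum_eq_iSup_sum]
    refine iSup_le fun s => ?_
    rw [← ENNReal.ofReal_sum_of_nonneg fun i _ => div_nonneg (by positivity) (hμ i)]
    set c := ∑ i ∈ s, ‖(inner ℂ (u i) (x j) : ℂ)‖ ^ 2 / qf X (u i) with hc
    let l : ι → ℂ := fun i => (inner ℂ (u i) (x j) : ℂ) / (qf X (u i) : ℂ)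
    have hy1 : (inner ℂ (x j) (∑ i ∈ s, l i • u i) : ℂ) = (c : ℂ) := by
      rw [inner_sum, hc]
      push_cast
      refine Finset.sum_congr rfl fun i _ => ?_
      rw [inner_smul_right, ← inner_conj_symm (x j) (u i), div_mul_eq_mul_div, Complex.mul_conj,
        Complex.normSq_eq_norm_sq]
      push_cast
      rfl
    have hy2 : qf X (∑ i ∈ s, l i • u i) = c := by
      have : X (∑ i ∈ s, l i • u i) = ∑ i ∈ s, (l i * qf X (u i)) • u i := by
        rw [map_sum]
        refine Finset.sum_congr rfl fun i _ => ?_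
        rw [map_smul, hu i, smul_smul]
      rw [qf, this, u.orthonormal.inner_sum, hc, Complex.re_sum]
      refine Finset.sum_congr rfl fun i _ => ?_
      have e : (starRingEnd ℂ) (l i) * (l i * (qf X (u i) : ℂ)) =
          ((‖l i‖ ^ 2 * qf X (u i) : ℝ) : ℂ) := by
        rw [← mul_assoc, mul_comm _ (l i), Complex.mul_conj, Complex.normSq_eq_norm_sq]
        push_cast
        rfl
      rw [e, Complex.ofReal_re]
      simp only [l, norm_div, Complex.norm_real, Real.norm_eq_abs, abs_of_nonneg (hμ i), div_pow]
      rcases eq_or_ne (qf X (u i)) 0 with h | h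
      · simp [h]
      · field_simp
    have h3 := hx (∑ i ∈ s, l i • u i)
    rw [hy2] at h3
    have hc0 : 0 ≤ c := Finset.sum_nonneg fun i _ => div_nonneg (by positivity) (hμ i)
    have h4 := (ENNReal.le_tsum j).trans h3.le
    rw [hy1, ENNReal.ofReal_le_ofReal_iff hc0, Complex.norm_real, Real.norm_eq_abs, sq_abs] at h4
    rw [← ENNReal.ofReal_one]
    apply ENNReal.ofReal_le_ofReal
    nlinarith
  · intro j
    rw [← tsum_norm_inner_sq u (x j)]
    congr 1 with i
    rw [← ENNReal.ofReal_mul (div_nonneg (by positivity) (hμ i))]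
    rcases eq_or_ne (qf X (u i)) 0 with h | h
    · rw [hz i j h]; simp
    · rw [div_mul_cancel₀ _ h]

lemma qEntropy_eq {ι : Type*} {A : E →L[ℂ] E} (hA : A.IsPositive) (hTC : IsTC A)
    {u : HilbertBasis ι ℂ E} (hu : IsEigenbasis A u) :
    qEntropy A = clEntropy (fun i => qf A (u i)) := by
  refine le_antisymm (qEntropy_le A u) (le_iInf₂ fun s hs => ?_)
  obtain ⟨b, hb⟩ := hs.exists_hilbertBasis
  obtain ⟨R, hR, hAR⟩ := exists_sqrt hA
  refine (clEntropy_eigen_le hA hTC hu (x := fun j => R (b j)) fun y => ?_).trans (le_of_eq ?_)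
  · simp_rw [hR]
    rw [tsum_norm_inner_sq, qf_eq_norm_sq hR hAR]
  · simp_rw [← qf_eq_norm_sq hR hAR, hb]

lemma qEntropy_le_of_family {κ : Type*} {X : E →L[ℂ] E} (hX : X.IsPositive) (hTC : IsTC X)
    {x : κ → E}
    (hx : ∀ y, ∑' j, ENNReal.ofReal (‖(inner ℂ (x j) y : ℂ)‖ ^ 2) = ENNReal.ofReal (qf X y)) :
    qEntropy X ≤ clEntropy (fun j => ‖x j‖ ^ 2) := by
  obtain ⟨s, u, hu⟩ := exists_eigenbasis hX hTC
  rw [qEntropy_eq hX hTC hu]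
  exact clEntropy_eigen_le hX hTC hu hx

lemma qEntropy_superadd {A B : E →L[ℂ] E} (hA : A.IsPositive) (hAT : IsTC A)
    (hB : B.IsPositive) (hBT : IsTC B) : qEntropy A + qEntropy B ≤ qEntropy (A + B) := by
  obtain ⟨s, u, hu⟩ := exists_eigenbasis (hA.add hB) (hAT.add hBT)
  rw [qEntropy_eq (hA.add hB) (hAT.add hBT) hu]
  simp_rw [qf_add]
  exact (add_le_add (qEntropy_le A u) (qEntropy_le B u)).trans
    (clEntropy_superadd (fun i => qf_nonneg hA _) (fun i => qf_nonneg hB _)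
      (hasSum_qf hA hAT u).summable (hasSum_qf hB hBT u).summable)

lemma isPositive_real_smul {A : E →L[ℂ] E} (hA : A.IsPositive) {c : ℝ} (hc : 0 ≤ c) :
    ((c : ℂ) • A).IsPositive :=
  hA.smul_of_nonneg (by exact_mod_cast hc)

lemma qEntropy_smul {A : E →L[ℂ] E} (hA : A.IsPositive) (hAT : IsTC A) {c : ℝ} (hc : 0 ≤ c) :
    qEntropy ((c : ℂ) • A) = ENNReal.ofReal c * qEntropy A := by
  obtain ⟨s, u, hu⟩ := exists_eigenbasis hA hAT
  have hu' : IsEigenbasis ((c : ℂ) • A) u := by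
    intro i
    rw [smul_apply, hu i, qf_real_smul, smul_smul]
    push_cast
    rfl
  rw [qEntropy_eq hA hAT hu, qEntropy_eq (isPositive_real_smul hA hc) (hAT.smul _) hu']
  simp_rw [qf_real_smul]
  exact clEntropy_smul hc (fun i => qf_nonneg hA _) (hasSum_qf hA hAT u).summable

lemma qf_eq_tsum_eigen {ι : Type*} {A : E →L[ℂ] E} (hA : A.IsPositive)
    {u : HilbertBasis ι ℂ E} (hu : IsEigenbasis A u) (z : E) :
    ∑' i, ENNReal.ofReal (qf A (u i) * ‖(inner ℂ (u i) z : ℂ)‖ ^ 2) = ENNReal.ofReal (qf A z) := by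
  refine tsum_ofReal_of_hasSum (fun i => mul_nonneg (qf_nonneg hA _) (by positivity)) ?_
  have h := Complex.hasSum_re (u.hasSum_inner_mul_inner z (A z))
  have key : ∀ i, (inner ℂ z (u i) * inner ℂ (u i) (A z) : ℂ).re =
      qf A (u i) * ‖(inner ℂ (u i) z : ℂ)‖ ^ 2 := by
    intro i
    have hsym : (inner ℂ (A (u i)) z : ℂ) = inner ℂ (u i) (A z) := hA.isSymmetric (u i) z
    have e : (starRingEnd ℂ) (inner ℂ (u i) z : ℂ) * ((qf A (u i) : ℂ) * inner ℂ (u i) z) =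
        ((qf A (u i) * ‖(inner ℂ (u i) z : ℂ)‖ ^ 2 : ℝ) : ℂ) := by
      rw [mul_left_comm, mul_comm _ (inner ℂ (u i) z : ℂ), Complex.mul_conj,
        Complex.normSq_eq_norm_sq]
      push_cast
      rfl
    rw [← hsym, hu i, inner_smul_left, Complex.conj_ofReal, ← inner_conj_symm z (u i), e,
      Complex.ofReal_re]
  simp_rw [key] at h
  exact h

lemma qEntropy_compr_le {ι : Type*} (V : F →ₗᵢ[ℂ] E) {A : E →L[ℂ] E} (hA : A.IsPositive)
    (hAT : IsTC A) {u : HilbertBasis ι ℂ E} (hu : IsEigenbasis A u) :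
    qEntropy (compr V.toContinuousLinearMap A) ≤ clEntropy (fun i =>
      qf A (u i) * ‖ContinuousLinearMap.adjoint V.toContinuousLinearMap (u i)‖ ^ 2) := by
  have h := qEntropy_le_of_family (compr_isPositive V.toContinuousLinearMap hA)
    (compr_isTC V hAT) (x := fun i => ((Real.sqrt (qf A (u i)) : ℝ) : ℂ) •
      ContinuousLinearMap.adjoint V.toContinuousLinearMap (u i)) fun y => by
    rw [qf_compr, ← qf_eq_tsum_eigen hA hu]
    congr 1 with i
    rw [inner_smul_left, norm_mul, mul_pow, Complex.conj_ofReal, Complex.norm_real,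
      Real.norm_eq_abs, sq_abs, Real.sq_sqrt (qf_nonneg hA _),
      ContinuousLinearMap.adjoint_inner_left]
  refine h.trans (le_of_eq ?_)
  congr 1 with i
  rw [norm_smul, mul_pow, Complex.norm_real, Real.norm_eq_abs, sq_abs,
    Real.sq_sqrt (qf_nonneg hA _)]

/-- Pinching onto two complementary subspaces does not increase the sum of the entropies. -/
lemma qEntropy_pinching (V : F →ₗᵢ[ℂ] E) (W : G →ₗᵢ[ℂ] E)
    (hVW : ∀ x, ‖ContinuousLinearMap.adjoint V.toContinuousLinearMap x‖ ^ 2 +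
      ‖ContinuousLinearMap.adjoint W.toContinuousLinearMap x‖ ^ 2 = ‖x‖ ^ 2)
    {A : E →L[ℂ] E} (hA : A.IsPositive) (hAT : IsTC A) :
    qEntropy (compr V.toContinuousLinearMap A) + qEntropy (compr W.toContinuousLinearMap A) ≤
      qEntropy A := by
  obtain ⟨s, u, hu⟩ := exists_eigenbasis hA hAT
  rw [qEntropy_eq hA hAT hu]
  have hs := (hasSum_qf hA hAT u).summable
  have key : ∀ i, qf A (u i) * ‖ContinuousLinearMap.adjoint V.toContinuousLinearMap (u i)‖ ^ 2 +
      qf A (u i) * ‖ContinuousLinearMap.adjoint W.toContinuousLinearMap (u i)‖ ^ 2 =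
      qf A (u i) := by
    intro i
    rw [← mul_add, hVW, u.orthonormal.1 i]
    simp
  have n1 : ∀ i, 0 ≤ qf A (u i) *
      ‖ContinuousLinearMap.adjoint V.toContinuousLinearMap (u i)‖ ^ 2 :=
    fun i => mul_nonneg (qf_nonneg hA _) (by positivity)
  have n2 : ∀ i, 0 ≤ qf A (u i) *
      ‖ContinuousLinearMap.adjoint W.toContinuousLinearMap (u i)‖ ^ 2 :=
    fun i => mul_nonneg (qf_nonneg hA _) (by positivity)
  have := clEntropy_superadd n1 n2
    (hs.of_nonneg_of_le n1 fun i => by linarith [key i, n2 i])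
    (hs.of_nonneg_of_le n2 fun i => by linarith [key i, n1 i])
  simp_rw [key] at this
  exact (add_le_add (qEntropy_compr_le V hA hAT hu) (qEntropy_compr_le W hA hAT hu)).trans this

lemma qEntropy_zero : qEntropy (0 : E →L[ℂ] E) = 0 := by
  obtain ⟨w, b, -⟩ := exists_hilbertBasis ℂ E
  refine le_antisymm ((qEntropy_le 0 b).trans (le_of_eq ?_)) zero_le
  simp [clEntropy, qf]

end QuantumEntropy

section Tail

variable {E F : Type*}
variable [NormedAddCommGroup E] [InnerProductSpace ℂ E] [CompleteSpace E]
variable [NormedAddCommGroup F] [InnerProductSpace ℂ F] [CompleteSpace F]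

lemma tsum_sum_type {ι κ : Type*} (f : ι ⊕ κ → ℝ≥0∞) :
    ∑' k, f k = ∑' i, f (Sum.inl i) + ∑' j, f (Sum.inr j) :=
  (HasSum.sum ENNReal.summable.hasSum ENNReal.summable.hasSum).tsum_eq

lemma exists_eigenbasis_fin [FiniteDimensional ℂ F] {A : F →L[ℂ] F} (hA : A.IsPositive) :
    ∃ u : HilbertBasis (Fin (Module.finrank ℂ F)) ℂ F, IsEigenbasis A u := by
  have hsym : (A : F →ₗ[ℂ] F).IsSymmetric := hA.isSymmetric
  refine ⟨(hsym.eigenvectorBasis rfl).toHilbertBasis, fun i => ?_⟩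
  rw [OrthonormalBasis.coe_toHilbertBasis]
  exact eigen_of_smul hA ((hsym.eigenvectorBasis rfl).orthonormal.1 i)
    (hsym.apply_eigenvectorBasis rfl i)

lemma toReal_traceNorm_tendsto {A : ℕ → E →L[ℂ] E} {A₀ : E →L[ℂ] E}
    (hlim : Tendsto (fun n => traceNorm (A n - A₀)) atTop (𝓝 0)) :
    Tendsto (fun n => (traceNorm (A n - A₀)).toReal) atTop (𝓝 0) := by
  exact (ENNReal.tendsto_toReal ENNReal.zero_ne_top).comp hlim

lemma abs_qf_sub_le {A B : E →L[ℂ] E} (hA : IsTC A) (hB : IsTC B) {x : E} (hx : ‖x‖ = 1) :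
    |qf A x - qf B x| ≤ (traceNorm (A - B)).toReal := by
  have := abs_qf_le_traceNorm (hA.sub hB) x
  rwa [qf_sub, hx, one_mul, one_mul] at this

/-- Lower semicontinuity of the entropy in finite dimensions. -/
lemma eventually_qEntropy_ge_of_finiteDimensional [FiniteDimensional ℂ F]
    {A : ℕ → F →L[ℂ] F} {A₀ : F →L[ℂ] F} (hA : ∀ n, (A n).IsPositive) (hAT : ∀ n, IsTC (A n))
    (hA₀ : A₀.IsPositive) (hAT₀ : IsTC A₀)
    (hlim : Tendsto (fun n => traceNorm (A n - A₀)) atTop (𝓝 0)) {ε : ℝ} (hε : 0 < ε) :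
    ∀ᶠ n in atTop, qEntropy A₀ ≤ qEntropy (A n) + ENNReal.ofReal ε := by
  choose u hu using fun n => exists_eigenbasis_fin (hA n)
  let f : (Fin (Module.finrank ℂ F) → ℝ) → ℝ :=
    fun x => ∑ i, Real.negMulLog (x i) - Real.negMulLog (∑ i, x i)
  have hf : Continuous f := by
    refine Continuous.sub ?_ ?_
    · exact continuous_finsetSum _ fun i _ => Real.continuous_negMulLog.comp (continuous_apply i)
    · exact Real.continuous_negMulLog.comp (continuous_finsetSum _ fun i _ => continuous_apply i)
  have hlim' := toReal_traceNorm_tendsto hlim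
  have hunif := (isCompact_closedBall (0 : Fin (Module.finrank ℂ F) → ℝ)
    (rtr A₀ + 1)).uniformContinuousOn_of_continuous hf.continuousOn
  obtain ⟨δ, hδ, hδf⟩ := Metric.uniformContinuousOn_iff.1 hunif ε hε
  filter_upwards [hlim'.eventually (gt_mem_nhds hδ), hlim'.eventually (gt_mem_nhds one_pos)]
    with n h1 h2
  have hn : ∀ i, ‖u n i‖ = 1 := (u n).orthonormal.1
  have hd : ∀ i, |qf (A n) (u n i) - qf A₀ (u n i)| ≤ (traceNorm (A n - A₀)).toReal :=
    fun i => abs_qf_sub_le (hAT n) hAT₀ (hn i)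
  have hb : ∀ i, qf A₀ (u n i) ≤ rtr A₀ := fun i => by
    simpa [hn i] using qf_le_rtr hA₀ hAT₀ (u n i)
  have hr := rtr_nonneg A₀
  have hx : (fun i => qf (A n) (u n i)) ∈
      Metric.closedBall (0 : Fin (Module.finrank ℂ F) → ℝ) (rtr A₀ + 1) := by
    rw [mem_closedBall_zero_iff, pi_norm_le_iff_of_nonneg (by positivity)]
    intro i
    rw [Real.norm_eq_abs, abs_of_nonneg (qf_nonneg (hA n) _)]
    linarith [(abs_le.1 (hd i)).2, hb i]
  have hy : (fun i => qf A₀ (u n i)) ∈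
      Metric.closedBall (0 : Fin (Module.finrank ℂ F) → ℝ) (rtr A₀ + 1) := by
    rw [mem_closedBall_zero_iff, pi_norm_le_iff_of_nonneg (by positivity)]
    intro i
    rw [Real.norm_eq_abs, abs_of_nonneg (qf_nonneg hA₀ _)]
    linarith [hb i]
  have hdist := hδf _ hy _ hx (by
    rw [dist_pi_lt_iff hδ]
    intro i
    rw [Real.dist_eq, abs_sub_comm]
    exact (hd i).trans_lt h1)
  rw [Real.dist_eq] at hdist
  refine (qEntropy_le A₀ (u n)).trans ?_
  rw [qEntropy_eq (hA n) (hAT n) (hu n), clEntropy_fintype fun i => qf_nonneg hA₀ _,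
    clEntropy_fintype fun i => qf_nonneg (hA n) _]
  refine le_trans (ENNReal.ofReal_le_ofReal ?_) ENNReal.ofReal_add_le
  have := (abs_lt.1 hdist).2
  simp only [f] at this
  linarith

/-- The inclusion of the orthogonal complement of a family of vectors. -/
def complIncl {κ : Type*} (v : κ → E) : (Submodule.span ℂ (Set.range v))ᗮ →ₗᵢ[ℂ] E :=
  (Submodule.span ℂ (Set.range v))ᗮ.subtypeₗᵢ

lemma inner_complIncl {κ : Type*} (v : κ → E) (i : κ)
    (x : (Submodule.span ℂ (Set.range v))ᗮ) : (inner ℂ (v i) (complIncl v x) : ℂ) = 0 :=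
  (Submodule.mem_orthogonal _ _).1 x.2 _ (Submodule.subset_span ⟨i, rfl⟩)

lemma exists_glued_basis {κ σ : Type*} {v : κ → E} (hv : Orthonormal ℂ v)
    (w : HilbertBasis σ ℂ (Submodule.span ℂ (Set.range v))ᗮ) :
    ∃ B : HilbertBasis (κ ⊕ σ) ℂ E, (∀ i, B (Sum.inl i) = v i) ∧
      ∀ j, B (Sum.inr j) = complIncl v (w j) := by
  let z : κ ⊕ σ → E := Sum.elim v fun j => complIncl v (w j)
  have hw : Orthonormal ℂ fun j => complIncl v (w j) := w.orthonormal.comp_linearIsometry _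
  have hz : Orthonormal ℂ z := by
    refine ⟨?_, ?_⟩
    · rintro (i | j)
      · exact hv.1 i
      · exact hw.1 j
    · rintro (i | i) (j | j) hij
      · exact hv.2 (by simpa using hij)
      · exact inner_complIncl v i _
      · rw [inner_eq_zero_symm]
        exact inner_complIncl v j _
      · exact hw.2 (by simpa using hij)
  have hbot : (Submodule.span ℂ (Set.range z))ᗮ = ⊥ := by
    rw [Submodule.eq_bot_iff]
    intro x hx
    rw [Submodule.mem_orthogonal] at hx
    have hx' : x ∈ (Submodule.span ℂ (Set.range v))ᗮ := by
      rw [Submodule.mem_orthogonal]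
      intro y hy
      refine hx y (Submodule.span_mono ?_ hy)
      rintro _ ⟨i, rfl⟩
      exact ⟨Sum.inl i, rfl⟩
    have h0 : ∀ j, (inner ℂ (w j) (⟨x, hx'⟩ : (Submodule.span ℂ (Set.range v))ᗮ) : ℂ) = 0 :=
      fun j => hx _ (Submodule.subset_span ⟨Sum.inr j, rfl⟩)
    have h1 := tsum_norm_inner_sq w ⟨x, hx'⟩
    simp only [h0, norm_zero, ne_eq, OfNat.ofNat_ne_zero, not_false_eq_true, zero_pow,
      ENNReal.ofReal_zero, tsum_zero] at h1
    have h2 : ‖x‖ ^ 2 ≤ 0 := ENNReal.ofReal_eq_zero.1 h1.symm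
    exact norm_eq_zero.1 (pow_eq_zero_iff two_ne_zero |>.1 (le_antisymm h2 (by positivity)))
  refine ⟨HilbertBasis.mkOfOrthogonalEqBot hz hbot, fun i => ?_, fun j => ?_⟩ <;>
    rw [HilbertBasis.coe_mkOfOrthogonalEqBot] <;> rfl

lemma exists_isometry_of_orthonormal {κ : Type*} [Fintype κ] {v : κ → E} (hv : Orthonormal ℂ v) :
    ∃ V : EuclideanSpace ℂ κ →ₗᵢ[ℂ] E, ∀ i, V (EuclideanSpace.basisFun κ ℂ i) = v i := by
  let b := EuclideanSpace.basisFun κ ℂ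
  let f := b.toBasis.constr ℂ v
  have hf : ∀ i, f (b.toBasis i) = v i := fun i => b.toBasis.constr_basis ℂ v i
  have hfv : f ∘ b.toBasis = v := funext hf
  refine ⟨f.isometryOfOrthonormal (v := b.toBasis) (by simp)
    (by rw [hfv]; exact hv), fun i => ?_⟩
  have := hf i
  rw [OrthonormalBasis.coe_toBasis] at this
  exact this

/-- Along a convergent sequence of positive operators, finitely many eigenvectors of the limit
carry asymptotically at least their share of the entropy. -/
lemma eventually_tail {κ : Type*} [Fintype κ]
    {A : ℕ → E →L[ℂ] E} {A₀ : E →L[ℂ] E} (hA : ∀ n, (A n).IsPositive) (hAT : ∀ n, IsTC (A n))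
    (hA₀ : A₀.IsPositive) (hAT₀ : IsTC A₀)
    (hlim : Tendsto (fun n => traceNorm (A n - A₀)) atTop (𝓝 0))
    {v : κ → E} (hv : Orthonormal ℂ v) (hev : ∀ i, A₀ (v i) = (qf A₀ (v i) : ℂ) • v i)
    {ε : ℝ} (hε : 0 < ε) :
    ∀ᶠ n in atTop, clEntropy (fun i => qf A₀ (v i)) +
      qEntropy (compr (complIncl v).toContinuousLinearMap (A n)) ≤
        qEntropy (A n) + ENNReal.ofReal ε := by
  obtain ⟨V, hV⟩ := exists_isometry_of_orthonormal hv
  let b := (EuclideanSpace.basisFun κ ℂ).toHilbertBasis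
  have hVb : ∀ i, V (b i) = v i := fun i => by
    rw [← hV i, OrthonormalBasis.coe_toHilbertBasis]
  have hlimV : Tendsto (fun n => traceNorm (compr V.toContinuousLinearMap (A n) -
      compr V.toContinuousLinearMap A₀)) atTop (𝓝 0) := by
    refine tendsto_of_tendsto_of_tendsto_of_le_of_le tendsto_const_nhds hlim
      (fun s => zero_le) fun n => ?_
    rw [← compr_sub]
    exact traceNorm_compr_le V _
  have hbe : IsEigenbasis (compr V.toContinuousLinearMap A₀) b := by
    intro i
    rw [qf_compr]
    have e1 : V.toContinuousLinearMap (b i) = v i := hVb i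
    refine ext_inner_left ℂ fun x => ?_
    rw [inner_compr, e1, hev i, inner_smul_right, inner_smul_right, ← e1]
    congr 1
    exact V.inner_map_map x (b i)
  have hpin : ∀ x, ‖ContinuousLinearMap.adjoint V.toContinuousLinearMap x‖ ^ 2 +
      ‖ContinuousLinearMap.adjoint (complIncl v).toContinuousLinearMap x‖ ^ 2 = ‖x‖ ^ 2 := by
    intro x
    obtain ⟨s, w, -⟩ := exists_hilbertBasis ℂ (Submodule.span ℂ (Set.range v))ᗮ
    obtain ⟨B, hB1, hB2⟩ := exists_glued_basis hv w
    have h := tsum_norm_inner_sq B x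
    rw [tsum_sum_type] at h
    have h1 : ∀ i, (inner ℂ (B (Sum.inl i)) x : ℂ) =
        inner ℂ (b i) (ContinuousLinearMap.adjoint V.toContinuousLinearMap x) := fun i => by
      rw [hB1, ← hVb, ContinuousLinearMap.adjoint_inner_right]
      rfl
    have h2 : ∀ j, (inner ℂ (B (Sum.inr j)) x : ℂ) =
        inner ℂ (w j) (ContinuousLinearMap.adjoint (complIncl v).toContinuousLinearMap x) :=
      fun j => by
        rw [hB2, ContinuousLinearMap.adjoint_inner_right]
        rfl
    simp_rw [h1, h2] at h
    rw [tsum_norm_inner_sq, tsum_norm_inner_sq, ← ENNReal.ofReal_add (by positivity)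
      (by positivity), ENNReal.ofReal_eq_ofReal_iff (by positivity) (by positivity)] at h
    exact h
  have hev' := eventually_qEntropy_ge_of_finiteDimensional
    (fun n => compr_isPositive V.toContinuousLinearMap (hA n)) (fun n => compr_isTC V (hAT n))
    (compr_isPositive V.toContinuousLinearMap hA₀) (compr_isTC V hAT₀) hlimV hε
  rw [qEntropy_eq (compr_isPositive V.toContinuousLinearMap hA₀) (compr_isTC V hAT₀) hbe] at hev'
  have e : (fun i => qf (compr V.toContinuousLinearMap A₀) (b i)) = fun i => qf A₀ (v i) := by
    ext i
    rw [qf_compr]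
    exact congrArg (qf A₀) (hVb i)
  rw [e] at hev'
  filter_upwards [hev'] with n hn
  refine (add_le_add_left hn _).trans ?_
  rw [add_right_comm]
  exact add_le_add_left (qEntropy_pinching V (complIncl v) hpin (hA n) (hAT n)) _

end Tail

section ClassicalBlock

lemma entTerm_pair_le {X Y : ℝ} (hX : 0 ≤ X) (hY : 0 ≤ Y) :
    entTerm (X + Y) X + entTerm (X + Y) Y ≤ ENNReal.ofReal ((X + Y) * Real.log 2) := by
  have hx : ∀ i : Fin 2, 0 ≤ (![X, Y] : Fin 2 → ℝ) i := by
    intro i; fin_cases i <;> simpa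
  have h := clEntropy_le_card hx (N := 2) (by simp)
  have hs : HasSum (![X, Y] : Fin 2 → ℝ) (X + Y) := by
    simpa [Fin.sum_univ_two] using hasSum_fintype (![X, Y] : Fin 2 → ℝ)
  rw [clEntropy_of_hasSum hx hs, tsum_fintype, Fin.sum_univ_two, Fin.sum_univ_two,
    ← ENNReal.ofReal_mul (by simpa using add_nonneg hX hY)] at h
  simpa using h

lemma clEntropy_sum_le {κ σ : Type*} [Fintype κ] {r : κ ⊕ σ → ℝ} (hr : ∀ i, 0 ≤ r i)
    {N : ℝ} (hN : (Fintype.card κ : ℝ) ≤ N) (hN₁ : 1 ≤ N) {a b : ℝ}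
    (ha : HasSum (fun j => r (Sum.inr j)) a) (hb : ∑ i, r (Sum.inl i) ≤ b) :
    clEntropy r ≤ clEntropy (fun j => r (Sum.inr j)) +
      ENNReal.ofReal (b * Real.log N + (a + b) * Real.log 2) := by
  have hX : HasSum (fun i => r (Sum.inl i)) (∑ i, r (Sum.inl i)) := hasSum_fintype _
  have hX0 : 0 ≤ ∑ i, r (Sum.inl i) := Finset.sum_nonneg fun i _ => hr _
  have ha0 : 0 ≤ a := ha.nonneg fun j => hr _
  have hl := Real.log_nonneg hN₁
  have hl2 : 0 ≤ Real.log 2 := Real.log_nonneg one_le_two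
  rw [clEntropy_sum hr hX ha, ENNReal.ofReal_add (mul_nonneg (hX0.trans hb) hl)
    (mul_nonneg (by linarith) hl2)]
  have h₁ : clEntropy (fun i => r (Sum.inl i)) ≤ ENNReal.ofReal (b * Real.log N) := by
    refine (clEntropy_le_card (fun i => hr _) hN).trans ?_
    rw [← ENNReal.ofReal_mul hX0]
    exact ENNReal.ofReal_le_ofReal (mul_le_mul_of_nonneg_right hb hl)
  have h₂ := (entTerm_pair_le hX0 ha0).trans (ENNReal.ofReal_le_ofReal
    (mul_le_mul_of_nonneg_right (by linarith : _ ≤ a + b) hl2))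
  calc _ = clEntropy (fun j => r (Sum.inr j)) + (clEntropy (fun i => r (Sum.inl i)) +
        (entTerm (∑ i, r (Sum.inl i) + a) (∑ i, r (Sum.inl i)) +
          entTerm (∑ i, r (Sum.inl i) + a) a)) := by
        ring
    _ ≤ _ := by gcongr

/-- `p` with its finite upper left block removed. -/
def offBlock {κ σ κ' σ' : Type*} (p : (κ ⊕ σ) × (κ' ⊕ σ') → ℝ) :
    (κ ⊕ σ) × (κ' ⊕ σ') → ℝ
  | (Sum.inl _, Sum.inl _) => 0
  | (Sum.inl i, Sum.inr j) => p (Sum.inl i, Sum.inr j)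
  | (Sum.inr i, j) => p (Sum.inr i, j)

variable {κ σ κ' σ' : Type*} [Fintype κ] [Fintype κ'] {p : (κ ⊕ σ) × (κ' ⊕ σ') → ℝ}

lemma offBlock_nonneg (hp : ∀ i, 0 ≤ p i) (i) : 0 ≤ offBlock p i := by
  rcases i with ⟨i | i, j | j⟩ <;> simp [offBlock, hp]

lemma offBlock_le (hp : ∀ i, 0 ≤ p i) (i) : offBlock p i ≤ p i := by
  rcases i with ⟨i | i, j | j⟩ <;> simp [offBlock, hp]

lemma offBlock_swap (i) : offBlock p i = offBlock (fun j => p j.swap) i.swap := by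
  rcases i with ⟨i | i, j | j⟩ <;> simp [offBlock]

lemma sum_row_offBlock_le (hp : ∀ i, 0 ≤ p i) (hps : Summable p) {c : κ' ⊕ σ' → ℝ}
    (hc : ∀ j, HasSum (fun i => p (i, j)) (c j)) {b : ℝ}
    (hb : HasSum (fun j => c (Sum.inr j)) b) :
    ∑ i : κ, ∑' j, offBlock p (Sum.inl i, j) ≤ b := by
  have h : ∀ i : κ, ∑' j, offBlock p (Sum.inl i, j) = ∑' j, p (Sum.inl i, Sum.inr j) := by
    intro i
    have h1 : HasSum (fun j => p (Sum.inl i, Sum.inr j)) (∑' j, p (Sum.inl i, Sum.inr j)) :=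
      (hps.comp_injective ((Prod.mk_right_injective (Sum.inl i)).comp
        Sum.inr_injective)).hasSum
    have h2 := HasSum.sum (f := fun j => offBlock p (Sum.inl i, j)) (a := 0)
      (by simp [Function.comp_def, offBlock]) h1
    rw [h2.tsum_eq, zero_add]
  simp_rw [h]
  rw [← Summable.tsum_finsetSum (f := fun i j => p (Sum.inl i, Sum.inr j)) fun i _ =>
    hps.comp_injective ((Prod.mk_right_injective (Sum.inl i)).comp Sum.inr_injective),
    ← hb.tsum_eq]
  have hle : ∀ j : σ', ∑ i : κ, p (Sum.inl i, Sum.inr j) ≤ c (Sum.inr j) := fun j => by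
    have := sum_le_hasSum (Finset.univ.map ⟨Sum.inl, Sum.inl_injective⟩)
      (fun i _ => hp (i, Sum.inr j)) (hc (Sum.inr j))
    simpa using this
  exact Summable.tsum_le_tsum hle (Summable.of_nonneg_of_le
    (fun j => Finset.sum_nonneg fun i _ => hp _) hle hb.summable) hb.summable

lemma clEntropy_row_offBlock_le (hp : ∀ i, 0 ≤ p i) (hps : Summable p) {r : κ ⊕ σ → ℝ}
    {c : κ' ⊕ σ' → ℝ} (hr : ∀ i, HasSum (fun j => p (i, j)) (r i))
    (hc : ∀ j, HasSum (fun i => p (i, j)) (c j)) {a b : ℝ}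
    (ha : HasSum (fun i => r (Sum.inr i)) a) (hb : HasSum (fun j => c (Sum.inr j)) b)
    {N : ℝ} (hN : (Fintype.card κ : ℝ) ≤ N) (hN₁ : 1 ≤ N) :
    clEntropy (fun i => ∑' j, offBlock p (i, j)) ≤ clEntropy (fun i => r (Sum.inr i)) +
      ENNReal.ofReal (b * Real.log N + (a + b) * Real.log 2) := by
  have hinr : ∀ i : σ, ∑' j, offBlock p (Sum.inr i, j) = r (Sum.inr i) := fun i =>
    (hr (Sum.inr i)).tsum_eq
  have h := clEntropy_sum_le (r := fun i => ∑' j, offBlock p (i, j))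
    (fun i => tsum_nonneg fun j => offBlock_nonneg hp _) hN hN₁ (a := a)
    (by simpa only [hinr] using ha) (sum_row_offBlock_le hp hps hc hb)
  simpa only [hinr] using h

lemma clEntropy_offBlock_le (hp : ∀ i, 0 ≤ p i) (hps : Summable p) {r : κ ⊕ σ → ℝ}
    {c : κ' ⊕ σ' → ℝ} (hr : ∀ i, HasSum (fun j => p (i, j)) (r i))
    (hc : ∀ j, HasSum (fun i => p (i, j)) (c j)) {a b : ℝ}
    (ha : HasSum (fun i => r (Sum.inr i)) a) (hb : HasSum (fun j => c (Sum.inr j)) b)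
    {N : ℝ} (hN : (Fintype.card κ : ℝ) ≤ N) (hN' : (Fintype.card κ' : ℝ) ≤ N) (hN₁ : 1 ≤ N) :
    clEntropy (offBlock p) ≤ clEntropy (fun i => r (Sum.inr i)) +
      clEntropy (fun j => c (Sum.inr j)) +
      ENNReal.ofReal ((a + b) * Real.log N + 2 * (a + b) * Real.log 2) := by
  have hs : Summable (offBlock p) :=
    Summable.of_nonneg_of_le (offBlock_nonneg hp) (offBlock_le hp) hps
  have hps' : Summable fun j : (κ' ⊕ σ') × (κ ⊕ σ) => p j.swap :=
    hps.comp_injective Prod.swap_injective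
  have h := clEntropy_prod_le (offBlock_nonneg hp) hs
    (fun i => (hs.comp_injective (Prod.mk_right_injective i)).hasSum)
    (fun j => (hs.comp_injective (Prod.mk_left_injective j)).hasSum)
  have h₁ := clEntropy_row_offBlock_le hp hps hr hc ha hb hN hN₁
  have h₂ := clEntropy_row_offBlock_le (fun j => hp j.swap) hps' hc hr hb ha hN' hN₁
  have hsw : (fun j => ∑' i, offBlock (fun k => p k.swap) (j, i)) =
      fun j => ∑' i, offBlock p (i, j) := by
    funext j
    exact tsum_congr fun i => (offBlock_swap (p := p) (i, j)).symm
  rw [hsw] at h₂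
  have ha0 : 0 ≤ a := ha.nonneg fun i => (hr _).nonneg fun j => hp _
  have hb0 : 0 ≤ b := hb.nonneg fun j => (hc _).nonneg fun i => hp _
  have hl := Real.log_nonneg hN₁
  have hl2 : 0 ≤ Real.log 2 := Real.log_nonneg one_le_two
  refine (h.trans (add_le_add h₁ h₂)).trans (le_of_eq ?_)
  rw [add_add_add_comm, ← ENNReal.ofReal_add (by positivity) (by positivity)]
  congr 2
  ring

lemma tsum_offBlock_le (hp : ∀ i, 0 ≤ p i) (hps : Summable p) {r : κ ⊕ σ → ℝ}
    {c : κ' ⊕ σ' → ℝ} (hr : ∀ i, HasSum (fun j => p (i, j)) (r i))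
    (hc : ∀ j, HasSum (fun i => p (i, j)) (c j)) {a b : ℝ}
    (ha : HasSum (fun i => r (Sum.inr i)) a) (hb : HasSum (fun j => c (Sum.inr j)) b) :
    ∑' i, offBlock p i ≤ a + b := by
  have hs : Summable (offBlock p) :=
    Summable.of_nonneg_of_le (offBlock_nonneg hp) (offBlock_le hp) hps
  have hinr : (fun i : σ => ∑' j, offBlock p (Sum.inr i, j)) = fun i => r (Sum.inr i) :=
    funext fun i => (hr (Sum.inr i)).tsum_eq
  rw [hs.tsum_prod' fun i => hs.comp_injective (Prod.mk_right_injective i)]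
  have h := HasSum.sum (f := fun i => ∑' j, offBlock p (i, j)) (hasSum_fintype _)
    (show HasSum _ a by simpa only [Function.comp_def, hinr] using ha)
  rw [h.tsum_eq]
  have := sum_row_offBlock_le hp hps hc hb
  simp only [Function.comp_def]
  linarith

lemma entTerm_tail_le {X Y m M : ℝ} (hX : 0 ≤ X) (hY : 0 ≤ Y) (hXY : X + Y = M) (hYm : Y ≤ m) :
    entTerm M X + entTerm M Y ≤ ENNReal.ofReal (m + 2 * √(M * m)) := by
  have hM : 0 ≤ M := by linarith
  have hm : 0 ≤ m := hY.trans hYm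
  rw [ENNReal.ofReal_add hm (by positivity)]
  refine add_le_add ?_ ?_
  · refine ENNReal.ofReal_le_ofReal ?_
    rcases hX.eq_or_lt with rfl | hX'
    · simpa
    have hM' : 0 < M := by linarith
    have h := Real.log_le_sub_one_of_pos (x := M / X) (by positivity)
    calc X * Real.log (M / X) ≤ X * (M / X - 1) := by gcongr
      _ = Y := by field_simp; linarith
      _ ≤ m := hYm
  · refine ENNReal.ofReal_le_ofReal ?_
    rcases hY.eq_or_lt with rfl | hY'
    · simp
    have hM' : 0 < M := by linarith
    have h := Real.log_le_sub_one_of_pos (x := √(M / Y)) (by positivity)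
    rw [Real.log_sqrt (by positivity)] at h
    have h1 : Y * √(M / Y) = √(M * Y) := by
      rw [← Real.sqrt_sq hY, ← Real.sqrt_mul (by positivity), Real.sqrt_sq hY]
      congr 1
      field_simp
    have h2 : √(M * Y) ≤ √(M * m) := Real.sqrt_le_sqrt (by gcongr)
    nlinarith

end ClassicalBlock

section TensorProducts

variable {E F G : Type*}
variable [NormedAddCommGroup E] [InnerProductSpace ℂ E] [CompleteSpace E]
variable [NormedAddCommGroup F] [InnerProductSpace ℂ F] [CompleteSpace F]
variable [NormedAddCommGroup G] [InnerProductSpace ℂ G] [CompleteSpace G]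

/-- The tensor product with its factors exchanged. -/
def TensorData.swap (T : TensorData E F G) : TensorData F E G where
  tmul y x := T.tmul x y
  add_left _ _ _ := T.add_right _ _ _
  add_right _ _ _ := T.add_left _ _ _
  smul_left _ _ _ := T.smul_right _ _ _
  smul_right _ _ _ := T.smul_left _ _ _
  inner_tmul _ _ _ _ := by rw [T.inner_tmul, mul_comm]
  dense_span := by
    have h : {z | ∃ (y : F) (x : E), z = T.tmul x y} = {z | ∃ x y, z = T.tmul x y} := by
      ext z; exact exists_comm
    rw [h]
    exact T.dense_span
  omul B A := T.omul A B
  omul_tmul _ _ _ _ := T.omul_tmul _ _ _ _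

lemma TensorData.norm_tmul (T : TensorData E F G) (x : E) (y : F) :
    ‖T.tmul x y‖ = ‖x‖ * ‖y‖ := by
  have h := T.inner_tmul x x y y
  simp only [inner_self_eq_norm_sq_to_K] at h
  have h' : ‖T.tmul x y‖ ^ 2 = (‖x‖ * ‖y‖) ^ 2 := by
    rw [mul_pow]
    exact_mod_cast h
  exact (pow_left_inj₀ (norm_nonneg _) (by positivity) two_ne_zero).1 h'

/-- The map `y ↦ x ⊗ y`. -/
def TensorData.lmul (T : TensorData E F G) (x : E) : F →L[ℂ] G :=
  LinearMap.mkContinuous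
    { toFun := T.tmul x
      map_add' := T.add_right x
      map_smul' := fun c y => T.smul_right c x y } ‖x‖ fun y => (T.norm_tmul x y).le

@[simp] lemma TensorData.lmul_apply (T : TensorData E F G) (x : E) (y : F) :
    T.lmul x y = T.tmul x y := rfl

lemma TensorData.orthonormal_tmul (T : TensorData E F G) {ι κ : Type*} {e : ι → E} {f : κ → F}
    (he : Orthonormal ℂ e) (hf : Orthonormal ℂ f) :
    Orthonormal ℂ fun k : ι × κ => T.tmul (e k.1) (f k.2) := by
  refine ⟨fun k => by simp [T.norm_tmul, he.1, hf.1], fun k l hkl => ?_⟩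
  simp only [T.inner_tmul]
  by_cases h : k.1 = l.1
  · rw [hf.2 fun h' => hkl (Prod.ext h h'), mul_zero]
  · rw [he.2 h, zero_mul]

lemma eq_zero_of_inner_hilbertBasis {ι : Type*} (b : HilbertBasis ι ℂ E) {x : E}
    (h : ∀ i, (inner ℂ (b i) x : ℂ) = 0) : x = 0 := by
  have h1 := tsum_norm_inner_sq b x
  simp only [h, norm_zero, ne_eq, OfNat.ofNat_ne_zero, not_false_eq_true, zero_pow,
    ENNReal.ofReal_zero, tsum_zero] at h1
  have h2 : ‖x‖ ^ 2 ≤ 0 := ENNReal.ofReal_eq_zero.1 h1.symm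
  exact norm_eq_zero.1 (pow_eq_zero_iff two_ne_zero |>.1 (le_antisymm h2 (by positivity)))

lemma TensorData.eq_zero_of_inner (T : TensorData E F G) {z : G}
    (h : ∀ x y, (inner ℂ (T.tmul x y) z : ℂ) = 0) : z = 0 := by
  refine T.dense_span.eq_zero_of_inner_right ℂ fun w hw => ?_
  induction hw using Submodule.span_induction with
  | mem w hw => obtain ⟨x, y, rfl⟩ := hw; exact h x y
  | zero => exact inner_zero_left _
  | add w w' _ _ h h' => rw [inner_add_left, h, h', add_zero]
  | smul c w _ h => rw [inner_smul_left, h, mul_zero]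

lemma TensorData.inner_tmul_eq_zero (T : TensorData E F G) {κ : Type*} (f : HilbertBasis κ ℂ F)
    {x : E} {z : G} (h : ∀ j, (inner ℂ (T.tmul x (f j)) z : ℂ) = 0) (y : F) :
    (inner ℂ (T.tmul x y) z : ℂ) = 0 := by
  have h : ContinuousLinearMap.adjoint (T.lmul x) z = 0 :=
    eq_zero_of_inner_hilbertBasis f fun j => by
      rw [ContinuousLinearMap.adjoint_inner_right, T.lmul_apply, h j]
  rw [← T.lmul_apply, ← ContinuousLinearMap.adjoint_inner_right, h, inner_zero_right]

lemma TensorData.exists_hilbertBasis (T : TensorData E F G) {ι κ : Type*}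
    (e : HilbertBasis ι ℂ E) (f : HilbertBasis κ ℂ F) :
    ∃ b : HilbertBasis (ι × κ) ℂ G, ∀ k, b k = T.tmul (e k.1) (f k.2) := by
  have ho := T.orthonormal_tmul e.orthonormal f.orthonormal
  refine ⟨HilbertBasis.mkOfOrthogonalEqBot ho ?_, fun k => by
    rw [HilbertBasis.coe_mkOfOrthogonalEqBot]⟩
  rw [Submodule.eq_bot_iff]
  intro z hz
  refine T.eq_zero_of_inner fun x y => T.swap.inner_tmul_eq_zero e (fun i => ?_) x
  exact T.inner_tmul_eq_zero f (fun j => (Submodule.mem_orthogonal _ _).1 hz _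
    (Submodule.subset_span ⟨(i, j), rfl⟩)) y

/-- Replace finitely many vectors of an orthonormal basis by another orthonormal basis of their
span. -/
lemma exists_replaced_basis {ι κ τ : Type*} [Fintype κ] (P : HilbertBasis ι ℂ G) (e : κ → ι)
    {V : EuclideanSpace ℂ κ →ₗᵢ[ℂ] G} (hV : ∀ k, V (EuclideanSpace.basisFun κ ℂ k) = P (e k))
    (u : HilbertBasis τ ℂ (EuclideanSpace ℂ κ)) :
    ∃ b : HilbertBasis (τ ⊕ ↥(Set.range e)ᶜ) ℂ G, (∀ t, b (Sum.inl t) = V (u t)) ∧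
      ∀ s : ↥(Set.range e)ᶜ, b (Sum.inr s) = P s := by
  let z : τ ⊕ ↥(Set.range e)ᶜ → G := Sum.elim (fun t => V (u t)) fun s => P s
  have h₁ : Orthonormal ℂ fun t => V (u t) := u.orthonormal.comp_linearIsometry V
  have h₂ : Orthonormal ℂ fun s : ↥(Set.range e)ᶜ => P s :=
    P.orthonormal.comp _ Subtype.val_injective
  have hVs : ∀ x, ∀ s : ↥(Set.range e)ᶜ, (inner ℂ (V x) (P s) : ℂ) = 0 := by
    intro x s
    rw [← (EuclideanSpace.basisFun κ ℂ).sum_repr x, map_sum, sum_inner]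
    refine Finset.sum_eq_zero fun k _ => ?_
    rw [map_smul, hV, inner_smul_left,
      P.orthonormal.2 fun h => s.2 ⟨k, h⟩, mul_zero]
  have hz : Orthonormal ℂ z := by
    refine ⟨?_, ?_⟩
    · rintro (i | j)
      · exact h₁.1 i
      · exact h₂.1 j
    · rintro (i | i) (j | j) hij
      · exact h₁.2 (by simpa using hij)
      · exact hVs _ _
      · exact inner_eq_zero_symm.1 (hVs _ _)
      · exact h₂.2 (by simpa using hij)
  refine ⟨HilbertBasis.mkOfOrthogonalEqBot hz ?_, fun i => ?_, fun j => ?_⟩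
  rotate_left
  · rw [HilbertBasis.coe_mkOfOrthogonalEqBot]; rfl
  · rw [HilbertBasis.coe_mkOfOrthogonalEqBot]; rfl
  rw [Submodule.eq_bot_iff]
  intro x hx
  have hx' : ∀ k, (inner ℂ (z k) x : ℂ) = 0 := fun k =>
    (Submodule.mem_orthogonal _ _).1 hx _ (Submodule.subset_span ⟨k, rfl⟩)
  refine eq_zero_of_inner_hilbertBasis P fun i => ?_
  by_cases hi : i ∈ Set.range e
  · obtain ⟨k, rfl⟩ := hi
    have h : ContinuousLinearMap.adjoint V.toContinuousLinearMap x = 0 :=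
      eq_zero_of_inner_hilbertBasis u fun t => by
        rw [ContinuousLinearMap.adjoint_inner_right]
        exact hx' (Sum.inl t)
    rw [← hV, ← V.coe_toContinuousLinearMap, ← ContinuousLinearMap.adjoint_inner_right, h,
      inner_zero_right]
  · exact hx' (Sum.inr ⟨i, hi⟩)

/-- `A` is the partial trace of `C` over the second factor. -/
def IsMarginal (T : TensorData E F G) (C : G →L[ℂ] G) (A : E →L[ℂ] E) : Prop :=
  ∀ v, traceENN (compr (T.lmul v) C) = ENNReal.ofReal (qf A v)

variable {T : TensorData E F G} {C : G →L[ℂ] G} {A : E →L[ℂ] E} {B : F →L[ℂ] F}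

lemma IsMarginal.hasSum (h : IsMarginal T C A) (hC : C.IsPositive) (hA : A.IsPositive)
    {ι : Type*} (b : HilbertBasis ι ℂ F) (v : E) :
    HasSum (fun j => qf C (T.tmul v (b j))) (qf A v) := by
  have hp := compr_isPositive (T.lmul v) hC
  have ht : IsTC (compr (T.lmul v) C) := by
    rw [IsTC, traceNorm_eq_traceENN hp, h v]
    exact ENNReal.ofReal_ne_top
  have hs := hasSum_qf hp ht b
  rw [rtr, h v, ENNReal.toReal_ofReal (qf_nonneg hA v)] at hs
  simpa only [qf_compr, T.lmul_apply] using hs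

lemma qEntropy_le_marginals (hC : C.IsPositive) (hCT : IsTC C) (hA : A.IsPositive)
    (hAT : IsTC A) (hB : B.IsPositive) (hBT : IsTC B) (hCA : IsMarginal T C A)
    (hCB : IsMarginal T.swap C B) : qEntropy C ≤ qEntropy A + qEntropy B := by
  obtain ⟨s, e, he⟩ := exists_eigenbasis hA hAT
  obtain ⟨s', f, hf⟩ := exists_eigenbasis hB hBT
  obtain ⟨b, hb⟩ := T.exists_hilbertBasis e f
  rw [qEntropy_eq hA hAT he, qEntropy_eq hB hBT hf]
  refine (qEntropy_le C b).trans (clEntropy_prod_le (fun k => qf_nonneg hC _)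
    (hasSum_qf hC hCT b).summable (fun i => ?_) fun j => ?_)
  · simpa only [hb] using hCA.hasSum hC hA f (e i)
  · simp only [hb]; exact hCB.hasSum hC hB e (f j)

lemma hasSum_qf_inr {κ σ : Type*} [Fintype κ] (hA : A.IsPositive) (hAT : IsTC A)
    (b : HilbertBasis (κ ⊕ σ) ℂ E) :
    HasSum (fun j => qf A (b (Sum.inr j))) (rtr A - ∑ i, qf A (b (Sum.inl i))) := by
  have h := hasSum_qf hA hAT b
  have hs : Summable fun j => qf A (b (Sum.inr j)) :=
    h.summable.comp_injective Sum.inr_injective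
  have h' := HasSum.sum (f := fun k => qf A (b k)) (hasSum_fintype _) hs.hasSum
  have := h.unique h'
  rw [this]
  simpa [Function.comp_def] using hs.hasSum

/-- The entropy of a bipartite operator is estimated through its restriction to a finite block
and through the tails of its marginals. -/
lemma qEntropy_le_block (hC : C.IsPositive) (hCT : IsTC C) (hA : A.IsPositive)
    (hAT : IsTC A) (hB : B.IsPositive) (hBT : IsTC B) (hCA : IsMarginal T C A)
    (hCB : IsMarginal T.swap C B) {κ κ' τ : Type*} [Fintype κ] [Fintype κ']
    {v : κ → E} {v' : κ' → F} (hv : Orthonormal ℂ v) (hv' : Orthonormal ℂ v') {N : ℝ}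
    (hN : (Fintype.card κ : ℝ) ≤ N) (hN' : (Fintype.card κ' : ℝ) ≤ N) (hN₁ : 1 ≤ N)
    {V : EuclideanSpace ℂ (κ × κ') →ₗᵢ[ℂ] G}
    (hV : ∀ k, V (EuclideanSpace.basisFun (κ × κ') ℂ k) = T.tmul (v k.1) (v' k.2))
    (u : HilbertBasis τ ℂ (EuclideanSpace ℂ (κ × κ'))) {m : ℝ}
    (hm : m = (rtr A - ∑ i, qf A (v i)) + (rtr B - ∑ j, qf B (v' j))) :
    qEntropy C ≤ clEntropy (fun t => qf C (V (u t))) +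
      qEntropy (compr (complIncl v).toContinuousLinearMap A) +
      qEntropy (compr (complIncl v').toContinuousLinearMap B) +
      ENNReal.ofReal (m * Real.log N + 2 * m * Real.log 2 + (m + 2 * √(rtr C * m))) := by
  obtain ⟨s, w, hw⟩ := exists_eigenbasis
    (compr_isPositive (complIncl v).toContinuousLinearMap hA) (compr_isTC (complIncl v) hAT)
  obtain ⟨s', w', hw'⟩ := exists_eigenbasis
    (compr_isPositive (complIncl v').toContinuousLinearMap hB) (compr_isTC (complIncl v') hBT)
  obtain ⟨e, he, he'⟩ := exists_glued_basis hv w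
  obtain ⟨f, hf, hf'⟩ := exists_glued_basis hv' w'
  obtain ⟨P, hP⟩ := T.exists_hilbertBasis e f
  let ι : κ × κ' → (κ ⊕ s) × (κ' ⊕ s') := fun k => (Sum.inl k.1, Sum.inl k.2)
  obtain ⟨b, hb, hb'⟩ := exists_replaced_basis P ι (V := V)
    (fun k => by rw [hV, hP, he, hf]) u
  let p : (κ ⊕ s) × (κ' ⊕ s') → ℝ := fun k => qf C (P k)
  have hp : ∀ k, 0 ≤ p k := fun k => qf_nonneg hC _
  have hps : Summable p := (hasSum_qf hC hCT P).summable
  have hr : ∀ i, HasSum (fun j => p (i, j)) (qf A (e i)) := fun i => by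
    simpa only [p, hP] using hCA.hasSum hC hA f (e i)
  have hc : ∀ j, HasSum (fun i => p (i, j)) (qf B (f j)) := fun j => by
    simp only [p, hP]; exact hCB.hasSum hC hB e (f j)
  have ha := hasSum_qf_inr hA hAT e
  have hb₀ := hasSum_qf_inr hB hBT f
  have hS := clEntropy_offBlock_le hp hps hr hc ha hb₀ hN hN' hN₁
  have hT := tsum_offBlock_le hp hps hr hc ha hb₀
  simp only [he, hf] at hS hT
  rw [← hm] at hS hT
  have hm0 : 0 ≤ m := (tsum_nonneg fun k => offBlock_nonneg hp k).trans hT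
  have hoff : ∀ k : ↥(Set.range ι)ᶜ, qf C (b (Sum.inr k)) = offBlock p k := by
    rintro ⟨⟨i | i, j | j⟩, hk⟩
    · exact absurd ⟨(i, j), rfl⟩ hk
    all_goals rw [hb']; rfl
  have hoff0 : ∀ k ∉ (Set.range ι)ᶜ, offBlock p k = 0 := by
    intro k hk
    obtain ⟨l, rfl⟩ := not_not.1 hk
    rfl
  have hs : Summable (offBlock p) :=
    Summable.of_nonneg_of_le (offBlock_nonneg hp) (offBlock_le hp) hps
  have hX := (hasSum_qf hC hCT b).summable.comp_injective Sum.inl_injective |>.hasSum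
  have hY : HasSum (fun k : ↥(Set.range ι)ᶜ => qf C (b (Sum.inr k))) (∑' k, offBlock p k) := by
    simp_rw [hoff]
    exact (hasSum_subtype_iff_of_support_subset
      (fun k hk => by_contra fun h => hk (hoff0 k h))).2 hs.hasSum
  have hM := (hasSum_qf hC hCT b).unique (HasSum.sum hX hY)
  have htail := entTerm_tail_le (hX.nonneg fun t => qf_nonneg hC _) (hY.nonneg fun t =>
    qf_nonneg hC _) hM.symm hT
  have hle := qEntropy_le C b
  rw [clEntropy_sum (fun k => qf_nonneg hC _) hX hY, ← hM] at hle
  have hcl : clEntropy (fun k : ↥(Set.range ι)ᶜ => qf C (b (Sum.inr k))) =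
      clEntropy (offBlock p) := by
    simp_rw [hoff]
    exact clEntropy_subtype _ hoff0
  have hA' : clEntropy (fun i => qf A (e (Sum.inr i))) =
      qEntropy (compr (complIncl v).toContinuousLinearMap A) := by
    rw [qEntropy_eq (compr_isPositive _ hA) (compr_isTC _ hAT) hw]
    simp_rw [qf_compr, he']
    rfl
  have hB' : clEntropy (fun i => qf B (f (Sum.inr i))) =
      qEntropy (compr (complIncl v').toContinuousLinearMap B) := by
    rw [qEntropy_eq (compr_isPositive _ hB) (compr_isTC _ hBT) hw']
    simp_rw [qf_compr, hf']
    rfl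
  have hl := Real.log_nonneg hN₁
  have hl2 : 0 ≤ Real.log 2 := Real.log_nonneg one_le_two
  rw [hA', hB'] at hS
  rw [ENNReal.ofReal_add (by positivity) (by positivity)]
  refine hle.trans ?_
  have hcl' : clEntropy ((fun k => qf C (b k)) ∘ Sum.inl) =
      clEntropy (fun t => qf C (V (u t))) := by
    simp only [Function.comp_def, hb]
  calc _ = clEntropy (fun t => qf C (V (u t))) + clEntropy (offBlock p) +
        (entTerm (rtr C) (∑' t, ((fun k => qf C (b k)) ∘ Sum.inl) t) +
          entTerm (rtr C) (∑' k, offBlock p k)) := by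
        rw [← hcl, ← hcl']
        simp only [Function.comp_def]
        ring
    _ ≤ _ := add_le_add (add_le_add_right hS _) htail
    _ = _ := by ring

end TensorProducts

section Limits

variable {E F G : Type*}
variable [NormedAddCommGroup E] [InnerProductSpace ℂ E] [CompleteSpace E]
variable [NormedAddCommGroup F] [InnerProductSpace ℂ F] [CompleteSpace F]
variable [NormedAddCommGroup G] [InnerProductSpace ℂ G] [CompleteSpace G]

lemma eventually_le_add_ofReal {ι : Type*} {l : Filter ι} {f : ι → ℝ≥0∞} {a : ℝ≥0∞}
    (h : Tendsto f l (𝓝 a)) (ha : a ≠ ∞) {ε : ℝ} (hε : 0 < ε) :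
    ∀ᶠ k in l, a ≤ f k + ENNReal.ofReal ε ∧ f k ≤ a + ENNReal.ofReal ε := by
  filter_upwards [(ENNReal.tendsto_nhds ha).1 h _ (ENNReal.ofReal_pos.2 hε)] with k hk
  exact ⟨tsub_le_iff_right.1 hk.1, hk.2⟩

lemma abs_rtr_sub_le {A B : E →L[ℂ] E} (hA : A.IsPositive) (hAT : IsTC A) (hB : B.IsPositive)
    (hBT : IsTC B) : |rtr A - rtr B| ≤ (traceNorm (A - B)).toReal := by
  have key : ∀ {A B : E →L[ℂ] E}, A.IsPositive → IsTC A → B.IsPositive → IsTC B →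
      rtr A ≤ rtr B + (traceNorm (A - B)).toReal := by
    intro A B hA hAT hB hBT
    rw [rtr, rtr, ← traceNorm_eq_traceENN hA, ← traceNorm_eq_traceENN hB,
      ← ENNReal.toReal_add hBT (hAT.sub hBT)]
    refine ENNReal.toReal_mono (ENNReal.add_ne_top.2 ⟨hBT, hAT.sub hBT⟩) ?_
    simpa using traceNorm_add_le B (A - B)
  rw [abs_le]
  have h1 := key hA hAT hB hBT
  have h2 := key hB hBT hA hAT
  rw [traceNorm_sub_comm] at h2
  constructor <;> linarith

section Sequence

variable {A : ℕ → E →L[ℂ] E} {A₀ : E →L[ℂ] E}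

lemma tendsto_rtr (hA : ∀ n, (A n).IsPositive) (hAT : ∀ n, IsTC (A n))
    (hA₀ : A₀.IsPositive) (hAT₀ : IsTC A₀)
    (hlim : Tendsto (fun n => traceNorm (A n - A₀)) atTop (𝓝 0)) :
    Tendsto (fun n => rtr (A n)) atTop (𝓝 (rtr A₀)) :=
  tendsto_iff_dist_tendsto_zero.2 (squeeze_zero (fun _ => dist_nonneg)
    (fun n => abs_rtr_sub_le (hA n) (hAT n) hA₀ hAT₀) (toReal_traceNorm_tendsto hlim))

lemma tendsto_qf (hAT : ∀ n, IsTC (A n)) (hAT₀ : IsTC A₀)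
    (hlim : Tendsto (fun n => traceNorm (A n - A₀)) atTop (𝓝 0)) {x : E} (hx : ‖x‖ = 1) :
    Tendsto (fun n => qf (A n) x) atTop (𝓝 (qf A₀ x)) :=
  tendsto_iff_dist_tendsto_zero.2 (squeeze_zero (fun _ => dist_nonneg)
    (fun n => abs_qf_sub_le (hAT n) hAT₀ hx) (toReal_traceNorm_tendsto hlim))

lemma clEntropy_ne_top {κ : Type*} [Fintype κ] {x : κ → ℝ} (hx : ∀ i, 0 ≤ x i) :
    clEntropy x ≠ ∞ := by
  rw [clEntropy_fintype hx]
  exact ENNReal.ofReal_ne_top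

lemma tendsto_clEntropy_qf {κ : Type*} [Fintype κ] (hA : ∀ n, (A n).IsPositive)
    (hAT : ∀ n, IsTC (A n)) (hA₀ : A₀.IsPositive) (hAT₀ : IsTC A₀)
    (hlim : Tendsto (fun n => traceNorm (A n - A₀)) atTop (𝓝 0)) {v : κ → E}
    (hv : ∀ i, ‖v i‖ = 1) : Tendsto (fun n => clEntropy fun i => qf (A n) (v i)) atTop
      (𝓝 (clEntropy fun i => qf A₀ (v i))) := by
  simp_rw [clEntropy_fintype fun i => qf_nonneg (hA _) (v i),
    clEntropy_fintype fun i => qf_nonneg hA₀ (v i)]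
  have h : ∀ i, Tendsto (fun n => qf (A n) (v i)) atTop (𝓝 (qf A₀ (v i))) :=
    fun i => tendsto_qf hAT hAT₀ hlim (hv i)
  refine ENNReal.tendsto_ofReal (Tendsto.sub (tendsto_finsetSum _ fun i _ => ?_) ?_)
  · exact (Real.continuous_negMulLog.tendsto _).comp (h i)
  · exact (Real.continuous_negMulLog.tendsto _).comp (tendsto_finsetSum _ fun i _ => h i)

/-- Lower semicontinuity of the quantum entropy. -/
lemma eventually_qEntropy_ge (hA : ∀ n, (A n).IsPositive) (hAT : ∀ n, IsTC (A n))
    (hA₀ : A₀.IsPositive) (hAT₀ : IsTC A₀)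
    (hlim : Tendsto (fun n => traceNorm (A n - A₀)) atTop (𝓝 0)) (hfin : qEntropy A₀ ≠ ∞)
    {ε : ℝ} (hε : 0 < ε) :
    ∀ᶠ n in atTop, qEntropy A₀ ≤ qEntropy (A n) + ENNReal.ofReal ε := by
  obtain ⟨s, b, hb⟩ := exists_eigenbasis hA₀ hAT₀
  have heq := qEntropy_eq hA₀ hAT₀ hb
  obtain ⟨S, -, -, -, hS⟩ := exists_truncation (fun i => qf_nonneg hA₀ (b i))
    (hasSum_qf hA₀ hAT₀ b) (heq ▸ hfin)
  rw [← heq] at hS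
  obtain ⟨k, hk, -⟩ := (eventually_le_add_ofReal hS hfin (half_pos hε)).exists
  filter_upwards [eventually_tail hA hAT hA₀ hAT₀ hlim (v := fun i : S k => b i)
    (b.orthonormal.comp _ Subtype.val_injective) (fun i => hb i) (half_pos hε)] with n hn
  calc qEntropy A₀ ≤ _ := hk
    _ ≤ qEntropy (A n) + ENNReal.ofReal (ε / 2) + ENNReal.ofReal (ε / 2) := by
      gcongr
      exact le_self_add.trans hn
    _ = _ := by
      rw [add_assoc, ← ENNReal.ofReal_add (by positivity) (by positivity), add_halves]

lemma eventually_qEntropy_tail_le {κ : Type*} [Fintype κ] (hA : ∀ n, (A n).IsPositive)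
    (hAT : ∀ n, IsTC (A n)) (hA₀ : A₀.IsPositive) (hAT₀ : IsTC A₀)
    (hlim : Tendsto (fun n => traceNorm (A n - A₀)) atTop (𝓝 0)) {η : ℝ} (hη : 0 < η)
    (hle : ∀ᶠ n in atTop, qEntropy (A n) ≤ qEntropy A₀ + ENNReal.ofReal η)
    {v : κ → E} (hv : Orthonormal ℂ v) (hev : ∀ i, A₀ (v i) = (qf A₀ (v i) : ℂ) • v i)
    (hk : qEntropy A₀ ≤ clEntropy (fun i => qf A₀ (v i)) + ENNReal.ofReal η) :
    ∀ᶠ n in atTop, qEntropy (compr (complIncl v).toContinuousLinearMap (A n)) ≤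
      ENNReal.ofReal (3 * η) := by
  filter_upwards [hle, eventually_tail hA hAT hA₀ hAT₀ hlim hv hev hη] with n h₁ h₂
  refine (ENNReal.add_le_add_iff_left
    (clEntropy_ne_top fun i => qf_nonneg hA₀ (v i))).1 (h₂.trans ?_)
  calc _ ≤ clEntropy (fun i => qf A₀ (v i)) + ENNReal.ofReal η + ENNReal.ofReal η +
        ENNReal.ofReal η := by gcongr; exact h₁.trans (by gcongr)
    _ = _ := by
      rw [add_assoc, add_assoc, ← ENNReal.ofReal_add hη.le hη.le,
        ← ENNReal.ofReal_add hη.le (by positivity)]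
      congr 2; ring

end Sequence

lemma qEntropy_compr_le_qEntropy (V : F →ₗᵢ[ℂ] E) {A : E →L[ℂ] E} (hA : A.IsPositive)
    (hAT : IsTC A) : qEntropy (compr V.toContinuousLinearMap A) ≤ qEntropy A := by
  obtain ⟨s, u, hu⟩ := exists_eigenbasis hA hAT
  rw [qEntropy_eq hA hAT hu]
  refine (qEntropy_compr_le V hA hAT hu).trans (clEntropy_mono (fun i => ?_) (fun i => ?_)
    (hasSum_qf hA hAT u).summable)
  · exact mul_nonneg (qf_nonneg hA _) (by positivity)
  · refine mul_le_of_le_one_right (qf_nonneg hA _) (pow_le_one₀ (norm_nonneg _) ?_)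
    refine (ContinuousLinearMap.le_opNorm _ _).trans ?_
    rw [u.orthonormal.1 i, mul_one, LinearIsometryEquiv.norm_map]
    exact V.norm_toContinuousLinearMap_le

/-- Upper semicontinuity of the entropy of a bipartite operator along a sequence whose marginals
have convergent entropy. -/
lemma eventually_qEntropy_le {T : TensorData E F G} {C : ℕ → G →L[ℂ] G} {C₀ : G →L[ℂ] G}
    {A : ℕ → E →L[ℂ] E} {A₀ : E →L[ℂ] E} {B : ℕ → F →L[ℂ] F} {B₀ : F →L[ℂ] F}
    (hC : ∀ n, (C n).IsPositive) (hCT : ∀ n, IsTC (C n)) (hC₀ : C₀.IsPositive) (hCT₀ : IsTC C₀)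
    (hA : ∀ n, (A n).IsPositive) (hAT : ∀ n, IsTC (A n)) (hA₀ : A₀.IsPositive) (hAT₀ : IsTC A₀)
    (hB : ∀ n, (B n).IsPositive) (hBT : ∀ n, IsTC (B n)) (hB₀ : B₀.IsPositive) (hBT₀ : IsTC B₀)
    (hCA : ∀ n, IsMarginal T (C n) (A n)) (hCB : ∀ n, IsMarginal T.swap (C n) (B n))
    (hClim : Tendsto (fun n => traceNorm (C n - C₀)) atTop (𝓝 0))
    (hAlim : Tendsto (fun n => traceNorm (A n - A₀)) atTop (𝓝 0))
    (hBlim : Tendsto (fun n => traceNorm (B n - B₀)) atTop (𝓝 0))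
    (hAfin : qEntropy A₀ ≠ ∞) (hBfin : qEntropy B₀ ≠ ∞)
    (hAent : Tendsto (fun n => qEntropy (A n)) atTop (𝓝 (qEntropy A₀)))
    (hBent : Tendsto (fun n => qEntropy (B n)) atTop (𝓝 (qEntropy B₀))) {ε : ℝ} (hε : 0 < ε) :
    ∀ᶠ n in atTop, qEntropy (C n) ≤ qEntropy C₀ + ENNReal.ofReal ε := by
  obtain ⟨η, hη, rfl⟩ : ∃ η : ℝ, 0 < η ∧ ε = 8 * η := ⟨ε / 8, by positivity, by ring⟩
  obtain ⟨s, e, he⟩ := exists_eigenbasis hA₀ hAT₀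
  obtain ⟨s', f, hf⟩ := exists_eigenbasis hB₀ hBT₀
  have heq := qEntropy_eq hA₀ hAT₀ he
  have hfq := qEntropy_eq hB₀ hBT₀ hf
  obtain ⟨S, hSc, hS₁, hS₂, hS₃⟩ := exists_truncation (fun i => qf_nonneg hA₀ (e i))
    (hasSum_qf hA₀ hAT₀ e) (heq ▸ hAfin)
  obtain ⟨S', hSc', hS₁', hS₂', hS₃'⟩ := exists_truncation (fun i => qf_nonneg hB₀ (f i))
    (hasSum_qf hB₀ hBT₀ f) (hfq ▸ hBfin)
  rw [← heq] at hS₃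
  rw [← hfq] at hS₃'
  let g : ℝ → ℝ → ℝ → ℝ := fun c M m => m * c + 2 * m * Real.log 2 + (m + 2 * √(M * m))
  have hg : ∀ᶠ k : ℕ in atTop, g (Real.log (k + 1)) (rtr C₀)
      ((rtr A₀ - ∑ i ∈ S k, qf A₀ (e i)) + (rtr B₀ - ∑ j ∈ S' k, qf B₀ (f j))) < η := by
    have hm := hS₁.add hS₁'
    have hm' := hS₂.add hS₂'
    simp only [add_zero, ← add_mul] at hm hm'
    have h := ((hm'.add ((hm.const_mul 2).mul_const (Real.log 2))).add
      (hm.add (((hm.const_mul (rtr C₀)).sqrt).const_mul 2)))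
    simp only [mul_zero, zero_mul, add_zero, Real.sqrt_zero] at h
    exact h.eventually_lt_const hη
  obtain ⟨k, ⟨hk, -⟩, ⟨hk', -⟩, hgk⟩ := ((eventually_le_add_ofReal hS₃ hAfin hη).and
    ((eventually_le_add_ofReal hS₃' hBfin hη).and hg)).exists
  let v : S k → E := fun i => e i
  let v' : S' k → F := fun j => f j
  have hv : Orthonormal ℂ v := e.orthonormal.comp _ Subtype.val_injective
  have hv' : Orthonormal ℂ v' := f.orthonormal.comp _ Subtype.val_injective
  obtain ⟨V, hV⟩ := exists_isometry_of_orthonormal (T.orthonormal_tmul hv hv')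
  obtain ⟨u, hu⟩ := exists_eigenbasis_fin (compr_isPositive V.toContinuousLinearMap hC₀)
  have hunit : ∀ t, ‖V (u t)‖ = 1 := fun t => by rw [V.norm_map]; exact u.orthonormal.1 t
  have hblock : clEntropy (fun t => qf C₀ (V (u t))) ≤ qEntropy C₀ := by
    refine le_trans (le_of_eq ?_) (qEntropy_compr_le_qEntropy V hC₀ hCT₀)
    rw [qEntropy_eq (compr_isPositive _ hC₀) (compr_isTC V hCT₀) hu]
    simp_rw [qf_compr]
    rfl
  let m : ℕ → ℝ := fun n => (rtr (A n) - ∑ i, qf (A n) (v i)) + (rtr (B n) - ∑ j, qf (B n) (v' j))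
  have hgn : ∀ᶠ n in atTop, g (Real.log (k + 1)) (rtr (C n)) (m n) < η := by
    have hm : Tendsto m atTop (𝓝 ((rtr A₀ - ∑ i ∈ S k, qf A₀ (e i)) +
        (rtr B₀ - ∑ j ∈ S' k, qf B₀ (f j)))) := by
      rw [← Finset.sum_coe_sort (S k), ← Finset.sum_coe_sort (S' k)]
      exact ((tendsto_rtr hA hAT hA₀ hAT₀ hAlim).sub (tendsto_finsetSum _ fun i _ =>
        tendsto_qf hAT hAT₀ hAlim (hv.1 i))).add ((tendsto_rtr hB hBT hB₀ hBT₀ hBlim).sub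
          (tendsto_finsetSum _ fun j _ => tendsto_qf hBT hBT₀ hBlim (hv'.1 j)))
    have hM := tendsto_rtr hC hCT hC₀ hCT₀ hClim
    exact (((hm.mul_const _).add ((hm.const_mul 2).mul_const (Real.log 2))).add
      (hm.add (((hM.mul hm).sqrt).const_mul 2))).eventually_lt_const hgk
  filter_upwards [hgn,
    eventually_qEntropy_tail_le hA hAT hA₀ hAT₀ hAlim hη
      ((eventually_le_add_ofReal hAent hAfin hη).mono fun _ h => h.2) hv (fun i => he i) hk,
    eventually_qEntropy_tail_le hB hBT hB₀ hBT₀ hBlim hη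
      ((eventually_le_add_ofReal hBent hBfin hη).mono fun _ h => h.2) hv' (fun i => hf i) hk',
    eventually_le_add_ofReal (tendsto_clEntropy_qf hC hCT hC₀ hCT₀ hClim hunit)
      (clEntropy_ne_top fun i => qf_nonneg hC₀ _) hη] with n h₁ h₂ h₃ h₄
  have hN₁ : (1 : ℝ) ≤ k + 1 := by simp
  refine (qEntropy_le_block (hC n) (hCT n) (hA n) (hAT n) (hB n) (hBT n) (hCA n) (hCB n) hv hv'
    (by simpa using hSc k) (by simpa using hSc' k) hN₁ hV u (m := m n) rfl).trans ?_
  calc _ ≤ qEntropy C₀ + ENNReal.ofReal η + ENNReal.ofReal (3 * η) + ENNReal.ofReal (3 * η) +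
        ENNReal.ofReal η := by
        gcongr
        exact h₄.2.trans (by gcongr)
    _ = _ := by
      rw [add_assoc, add_assoc, add_assoc, ← ENNReal.ofReal_add (by positivity) (by positivity),
        ← ENNReal.ofReal_add (by positivity) (by positivity),
        ← ENNReal.ofReal_add (by positivity) (by positivity)]
      congr 2; ring

end Limits

section PartialTrace

/-- A trace-norm bounded linear functional on the trace class. -/
structure TCFunctional (E : Type*) [NormedAddCommGroup E] [InnerProductSpace ℂ E]
    [CompleteSpace E] where
  toFun : (E →L[ℂ] E) → ℂ
  map_add : ∀ {A B}, IsTC A → IsTC B → toFun (A + B) = toFun A + toFun B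
  map_smul : ∀ (c : ℂ) {A}, IsTC A → toFun (c • A) = c * toFun A
  bound : ∃ K : ℝ≥0, ∀ {A}, IsTC A → ENNReal.ofReal ‖toFun A‖ ≤ K * traceNorm A

variable {E F G E' F' G' : Type*}
variable [NormedAddCommGroup E] [InnerProductSpace ℂ E] [CompleteSpace E]
variable [NormedAddCommGroup F] [InnerProductSpace ℂ F] [CompleteSpace F]
variable [NormedAddCommGroup G] [InnerProductSpace ℂ G] [CompleteSpace G]
variable [NormedAddCommGroup E'] [InnerProductSpace ℂ E'] [CompleteSpace E']
variable [NormedAddCommGroup F'] [InnerProductSpace ℂ F'] [CompleteSpace F']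
variable [NormedAddCommGroup G'] [InnerProductSpace ℂ G'] [CompleteSpace G']

lemma TCFunctional.norm_le (φ : TCFunctional E) :
    ∃ K : ℝ≥0, ∀ {A}, IsTC A → ‖φ.toFun A‖ ≤ K * (traceNorm A).toReal := by
  obtain ⟨K, hK⟩ := φ.bound
  refine ⟨K, fun {A} hA => ?_⟩
  have h := ENNReal.toReal_mono (ENNReal.mul_ne_top ENNReal.coe_ne_top hA) (hK hA)
  rwa [ENNReal.toReal_ofReal (norm_nonneg _), ENNReal.toReal_mul, ENNReal.coe_toReal] at h

section StandardTrace

lemma exists_stdBasis (E : Type*) [NormedAddCommGroup E] [InnerProductSpace ℂ E]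
    [CompleteSpace E] : ∃ b : HilbertBasis (stdONB E) ℂ E, ∀ v, b v = v := by
  have h : IsONB (stdONB E) := (exists_isONB E).choose_spec
  obtain ⟨b, hb⟩ := h.exists_hilbertBasis
  exact ⟨b, fun v => by rw [hb]⟩

lemma tsum_norm_inner_le (A : E →L[ℂ] E) {ι : Type*} (b : HilbertBasis ι ℂ E) :
    ∑' i, ENNReal.ofReal ‖(inner ℂ (b i) (A (b i)) : ℂ)‖ ≤ traceNorm A := by
  rw [ENNReal.tsum_eq_iSup_sum]
  refine iSup_le fun s => ?_
  rw [← Finset.sum_coe_sort]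
  exact sum_le_traceNorm A (b.orthonormal.comp _ Subtype.val_injective)
    (b.orthonormal.comp _ Subtype.val_injective)

lemma summable_norm_inner {A : E →L[ℂ] E} (hA : IsTC A) {ι : Type*} (b : HilbertBasis ι ℂ E) :
    Summable fun i => ‖(inner ℂ (b i) (A (b i)) : ℂ)‖ := by
  have h := ENNReal.summable_toReal (ne_top_of_le_ne_top hA (tsum_norm_inner_le A b))
  simpa only [ENNReal.toReal_ofReal (norm_nonneg _)] using h

lemma hasSum_traceC {A : E →L[ℂ] E} (hA : IsTC A) {b : HilbertBasis (stdONB E) ℂ E}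
    (hb : ∀ v, b v = v) :
    HasSum (fun v => (inner ℂ (b v) (A (b v)) : ℂ)) (traceC A) := by
  have h := (summable_norm_inner hA b).of_norm.hasSum
  simp only [hb] at h ⊢
  exact h

/-- The trace as a bounded functional on the trace class. -/
def traceFunctional (E : Type*) [NormedAddCommGroup E] [InnerProductSpace ℂ E]
    [CompleteSpace E] : TCFunctional E where
  toFun := traceC
  map_add {A B} hA hB := by
    obtain ⟨b, hb⟩ := exists_stdBasis E
    refine (hasSum_traceC (hA.add hB) hb).unique ?_
    simpa [inner_add_right] using (hasSum_traceC hA hb).add (hasSum_traceC hB hb)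
  map_smul c {A} hA := by
    obtain ⟨b, hb⟩ := exists_stdBasis E
    refine (hasSum_traceC (hA.smul c) hb).unique ?_
    simpa [inner_smul_right] using (hasSum_traceC hA hb).mul_left c
  bound := by
    obtain ⟨b, hb⟩ := exists_stdBasis E
    refine ⟨1, fun {A} hA => ?_⟩
    rw [ENNReal.coe_one, one_mul, ← (hasSum_traceC hA hb).tsum_eq]
    refine le_trans ?_ (tsum_norm_inner_le A b)
    rw [← ENNReal.ofReal_tsum_of_nonneg (fun _ => norm_nonneg _) (summable_norm_inner hA b)]
    exact ENNReal.ofReal_le_ofReal (norm_tsum_le_tsum_norm (summable_norm_inner hA b))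

lemma traceC_of_isPositive {A : E →L[ℂ] E} (hA : A.IsPositive) (hAT : IsTC A) :
    traceC A = (rtr A : ℂ) := by
  obtain ⟨b, hb⟩ := exists_stdBasis E
  refine (hasSum_traceC hAT hb).unique ?_
  simp only [inner_eq_qf hA]
  exact (Complex.hasSum_ofReal).2 (hasSum_qf hA hAT b)

end StandardTrace

section RankOne

@[simp] lemma rankOneM_apply (x y z : E) : rankOneM x y z = (inner ℂ y z : ℂ) • x := rfl

lemma rankOneM_isPositive (x : E) : (rankOneM x x).IsPositive := by
  rw [ContinuousLinearMap.isPositive_iff_complex]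
  intro z
  have h : (inner ℂ (rankOneM x x z) z : ℂ) = ((‖(inner ℂ x z : ℂ)‖ ^ 2 : ℝ) : ℂ) := by
    rw [rankOneM_apply, inner_smul_left, ← Complex.normSq_eq_conj_mul_self,
      Complex.normSq_eq_norm_sq]
  rw [h]
  refine ⟨rfl, ?_⟩
  simp only [RCLike.re_to_complex, Complex.ofReal_re]
  positivity

lemma qf_rankOneM (x z : E) : qf (rankOneM x x) z = ‖(inner ℂ x z : ℂ)‖ ^ 2 := by
  rw [qf, rankOneM_apply, inner_smul_right, ← inner_conj_symm z x, ← Complex.normSq_eq_norm_sq,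
    Complex.mul_conj, Complex.ofReal_re]

lemma qf_sum {ι : Type*} (s : Finset ι) (A : ι → E →L[ℂ] E) (x : E) :
    qf (∑ i ∈ s, A i) x = ∑ i ∈ s, qf (A i) x := by
  induction s using Finset.induction_on with
  | empty => simp [qf]
  | insert i s hi ih => rw [Finset.sum_insert hi, Finset.sum_insert hi, qf_add, ih]

lemma traceNorm_rankOneM_le (x y : E) : traceNorm (rankOneM x y) ≤ ENNReal.ofReal (‖x‖ * ‖y‖) := by
  refine traceNorm_le fun n e f he hf => ?_
  rw [← ENNReal.ofReal_sum_of_nonneg fun _ _ => norm_nonneg _]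
  refine ENNReal.ofReal_le_ofReal ?_
  have h : ∀ i, ‖(inner ℂ (e i) (rankOneM x y (f i)) : ℂ)‖ =
      ‖(inner ℂ (e i) x : ℂ)‖ * ‖(inner ℂ (f i) y : ℂ)‖ := fun i => by
    rw [rankOneM_apply, inner_smul_right, norm_mul, mul_comm, norm_inner_symm y]
  simp_rw [h]
  have hb : ∀ {g : Fin n → E}, Orthonormal ℂ g → ∀ z : E,
      ∑ i, ‖(inner ℂ (g i) z : ℂ)‖ ^ 2 ≤ ‖z‖ ^ 2 := fun hg z =>
    hg.sum_inner_products_le z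
  refine (Real.sum_mul_le_sqrt_mul_sqrt _ _ _).trans ?_
  gcongr
  · exact Real.sqrt_le_iff.2 ⟨norm_nonneg _, hb he x⟩
  · exact Real.sqrt_le_iff.2 ⟨norm_nonneg _, hb hf y⟩

lemma rankOneM_isTC (x y : E) : IsTC (rankOneM x y) :=
  ne_top_of_le_ne_top ENNReal.ofReal_ne_top (traceNorm_rankOneM_le x y)

lemma IsTC.sum {ι : Type*} (s : Finset ι) {A : ι → E →L[ℂ] E} (h : ∀ i, IsTC (A i)) :
    IsTC (∑ i ∈ s, A i) := by
  induction s using Finset.induction_on with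
  | empty => simpa using isTC_zero
  | insert i s hi ih => rw [Finset.sum_insert hi]; exact (h i).add ih

/-- Spectral truncations approximate a positive trace-class operator. -/
lemma exists_spectral_approx {A : E →L[ℂ] E} (hA : A.IsPositive) (hAT : IsTC A) :
    ∃ (s : Set E) (b : HilbertBasis s ℂ E), Tendsto (fun S : Finset s =>
      (traceNorm (A - ∑ i ∈ S, (qf A (b i) : ℂ) • rankOneM (b i) (b i))).toReal)
        atTop (𝓝 0) := by
  obtain ⟨s, b, hb⟩ := exists_eigenbasis hA hAT
  refine ⟨s, b, ?_⟩
  let R : Finset s → E →L[ℂ] E := fun S => ∑ i ∈ S, (qf A (b i) : ℂ) • rankOneM (b i) (b i)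
  have hRT : ∀ S, IsTC (R S) := fun S => IsTC.sum S fun i => (rankOneM_isTC _ _).smul _
  have hqR : ∀ S x, qf (R S) x = ∑ i ∈ S, qf A (b i) * ‖(inner ℂ (b i) x : ℂ)‖ ^ 2 := by
    intro S x
    simp_rw [R, qf_sum, qf_real_smul, qf_rankOneM]
  have hR : ∀ S, (A - R S).IsPositive := by
    intro S
    have hsym : (R S).IsPositive := ContinuousLinearMap.isPositive_sum S fun i _ =>
      isPositive_real_smul (rankOneM_isPositive _) (qf_nonneg hA _)
    refine ⟨hA.isSymmetric.sub hsym.isSymmetric, fun x => ?_⟩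
    rw [ContinuousLinearMap.reApplyInnerSelf_apply, inner_re_symm]
    change 0 ≤ qf (A - R S) x
    rw [qf_sub, sub_nonneg, hqR]
    have h := ENNReal.sum_le_tsum (f := fun i =>
      ENNReal.ofReal (qf A (b i) * ‖(inner ℂ (b i) x : ℂ)‖ ^ 2)) S
    rw [qf_eq_tsum_eigen hA hb, ← ENNReal.ofReal_sum_of_nonneg fun i _ =>
      mul_nonneg (qf_nonneg hA _) (by positivity)] at h
    exact (ENNReal.ofReal_le_ofReal_iff (qf_nonneg hA x)).1 h
  have htr : ∀ S, rtr (A - R S) = rtr A - ∑ i ∈ S, qf A (b i) := by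
    intro S
    refine (hasSum_qf (hR S) (hAT.sub (hRT S)) b).unique ?_
    simp_rw [qf_sub]
    refine (hasSum_qf hA hAT b).sub ?_
    simp_rw [hqR]
    refine hasSum_sum fun i _ => ?_
    have h := hasSum_single (f := fun j => qf A (b i) * ‖(inner ℂ (b i) (b j) : ℂ)‖ ^ 2) i
      fun j hj => by simp [b.orthonormal.2 hj.symm]
    simpa [inner_self_eq_norm_sq_to_K, b.orthonormal.1 i] using h
  have h : Tendsto (fun S : Finset s => rtr A - ∑ i ∈ S, qf A (b i)) atTop (𝓝 0) := by
    simpa using Tendsto.const_sub (rtr A) (hasSum_qf hA hAT b)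
  refine h.congr fun S => ?_
  rw [← htr, rtr, ← traceNorm_eq_traceENN (hR S)]

end RankOne

end PartialTrace

section Slices

variable {E F G E' F' G' : Type*}
variable [NormedAddCommGroup E] [InnerProductSpace ℂ E] [CompleteSpace E]
variable [NormedAddCommGroup F] [InnerProductSpace ℂ F] [CompleteSpace F]
variable [NormedAddCommGroup G] [InnerProductSpace ℂ G] [CompleteSpace G]
variable [NormedAddCommGroup E'] [InnerProductSpace ℂ E'] [CompleteSpace E']
variable [NormedAddCommGroup F'] [InnerProductSpace ℂ F'] [CompleteSpace F']
variable [NormedAddCommGroup G'] [InnerProductSpace ℂ G'] [CompleteSpace G']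

/-- A bounded functional on the trace class vanishing on the products `|x⊗f⟩⟨x'⊗f'|` vanishes
on the positive cone. -/
lemma TCFunctional.eq_zero_of_tmul (T : TensorData E F G) (φ : TCFunctional G)
    (h0 : ∀ x x' f f', φ.toFun (rankOneM (T.tmul x f) (T.tmul x' f')) = 0)
    {W : G →L[ℂ] G} (hW : W.IsPositive) (hWT : IsTC W) : φ.toFun W = 0 := by
  obtain ⟨K, hK⟩ := φ.norm_le
  have hK' : ∀ x y, ‖φ.toFun (rankOneM x y)‖ ≤ K * (‖x‖ * ‖y‖) := fun x y =>
    (hK (rankOneM_isTC x y)).trans (mul_le_mul_of_nonneg_left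
      (ENNReal.toReal_le_of_le_ofReal (by positivity) (traceNorm_rankOneM_le x y)) K.2)
  have add_l : ∀ x x' y : G, rankOneM (x + x') y = rankOneM x y + rankOneM x' y := by
    intros; ext; simp
  have smul_l : ∀ (c : ℂ) (x y : G), rankOneM (c • x) y = c • rankOneM x y := by
    intros; ext; simp [smul_smul, mul_comm]
  have add_r : ∀ x y y' : G, rankOneM x (y + y') = rankOneM x y + rankOneM x y' := by
    intros; ext; simp [add_smul]
  have smul_r : ∀ (c : ℂ) (x y : G), rankOneM x (c • y) = (starRingEnd ℂ c) • rankOneM x y := by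
    intros; ext; simp [smul_smul, mul_comm]
  have h1 : ∀ z x' f', φ.toFun (rankOneM z (T.tmul x' f')) = 0 := by
    intro z x' f'
    let g : G →L[ℂ] ℂ := LinearMap.mkContinuous
      { toFun := fun z => φ.toFun (rankOneM z (T.tmul x' f'))
        map_add' := fun a b => by
          rw [add_l, φ.map_add (rankOneM_isTC _ _) (rankOneM_isTC _ _)]
        map_smul' := fun c a => by
          rw [smul_l, φ.map_smul _ (rankOneM_isTC _ _)]; rfl } (K * ‖T.tmul x' f'‖)
        fun z => (hK' _ _).trans (le_of_eq (by ring))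
    have hg : g = 0 := ContinuousLinearMap.ext_on T.dense_span (by
      rintro _ ⟨x, f, rfl⟩
      exact h0 x x' f f')
    exact congrArg (fun g : G →L[ℂ] ℂ => g z) hg
  have h2 : ∀ z w, φ.toFun (rankOneM z w) = 0 := by
    intro z w
    let g : G →L⋆[ℂ] ℂ := LinearMap.mkContinuous
      { toFun := fun w => φ.toFun (rankOneM z w)
        map_add' := fun a b => by
          rw [add_r, φ.map_add (rankOneM_isTC _ _) (rankOneM_isTC _ _)]
        map_smul' := fun c a => by
          rw [smul_r, φ.map_smul _ (rankOneM_isTC _ _)]; rfl } (K * ‖z‖)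
        fun w => (hK' _ _).trans (le_of_eq (by ring))
    have hg : g = 0 := ContinuousLinearMap.ext_on T.dense_span (by
      rintro _ ⟨x, f, rfl⟩
      exact h1 z x f)
    exact congrArg (fun g : G →L⋆[ℂ] ℂ => g w) hg
  obtain ⟨s, b, hb⟩ := exists_spectral_approx hW hWT
  let R : Finset s → G →L[ℂ] G := fun S => ∑ i ∈ S, (qf W (b i) : ℂ) • rankOneM (b i) (b i)
  have hRT : ∀ S, IsTC (R S) := fun S => IsTC.sum S fun i => (rankOneM_isTC _ _).smul _
  have hR : ∀ S, φ.toFun (R S) = 0 := by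
    intro S
    induction S using Finset.induction_on with
    | empty =>
      have h := φ.map_smul 0 (isTC_zero (E := G))
      rw [zero_smul, zero_mul] at h
      simpa [R] using h
    | insert i S hi ih =>
      have hRi : R (insert i S) = (qf W (b i) : ℂ) • rankOneM (b i) (b i) + R S :=
        Finset.sum_insert hi
      rw [hRi, φ.map_add ((rankOneM_isTC _ _).smul _) (hRT S), ih,
        φ.map_smul _ (rankOneM_isTC _ _), h2, mul_zero, add_zero]
  have hle : ∀ S, ‖φ.toFun W‖ ≤ K * (traceNorm (W - R S)).toReal := fun S => by
    have h := φ.map_add (hWT.sub (hRT S)) (hRT S)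
    rw [sub_add_cancel, hR, add_zero] at h
    rw [h]
    exact hK (hWT.sub (hRT S))
  have := ge_of_tendsto' (hb.const_mul (K : ℝ)) hle
  rw [mul_zero] at this
  exact norm_le_zero_iff.1 this

/-- The operator `W ↦ (⟨x| ⊗ 1) W (|y⟩ ⊗ 1)`. -/
def TensorData.cross (T : TensorData E F G) (x y : E) (W : G →L[ℂ] G) : F →L[ℂ] F :=
  ContinuousLinearMap.adjoint (T.lmul x) ∘L W ∘L T.lmul y

variable (T : TensorData E F G)

lemma TensorData.inner_cross (x y : E) (W : G →L[ℂ] G) (f g : F) :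
    (inner ℂ f (T.cross x y W g) : ℂ) = inner ℂ (T.tmul x f) (W (T.tmul y g)) := by
  simp [cross, ContinuousLinearMap.adjoint_inner_right]

lemma op_ext {A B : E →L[ℂ] E} (h : ∀ x y, (inner ℂ x (A y) : ℂ) = inner ℂ x (B y)) : A = B := by
  ext y
  exact ext_inner_left ℂ fun x => h x y

lemma TensorData.cross_add_left (x x' y : E) (W : G →L[ℂ] G) :
    T.cross (x + x') y W = T.cross x y W + T.cross x' y W :=
  op_ext fun f g => by
    simp only [add_apply, inner_add_right, T.inner_cross, T.add_left, inner_add_left]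

lemma TensorData.cross_add_right (x y y' : E) (W : G →L[ℂ] G) :
    T.cross x (y + y') W = T.cross x y W + T.cross x y' W :=
  op_ext fun f g => by
    simp only [add_apply, inner_add_right, T.inner_cross, T.add_left, map_add]

lemma TensorData.cross_smul_left (c : ℂ) (x y : E) (W : G →L[ℂ] G) :
    T.cross (c • x) y W = (starRingEnd ℂ c) • T.cross x y W :=
  op_ext fun f g => by
    simp only [smul_apply, inner_smul_right, T.inner_cross, T.smul_left, inner_smul_left]

lemma TensorData.cross_smul_right (c : ℂ) (x y : E) (W : G →L[ℂ] G) :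
    T.cross x (c • y) W = c • T.cross x y W :=
  op_ext fun f g => by
    simp only [smul_apply, inner_smul_right, T.inner_cross, T.smul_left, map_smul]

lemma TensorData.cross_add (x y : E) (W W' : G →L[ℂ] G) :
    T.cross x y (W + W') = T.cross x y W + T.cross x y W' :=
  op_ext fun f g => by simp only [add_apply, inner_add_right, T.inner_cross]

lemma TensorData.cross_smul (c : ℂ) (x y : E) (W : G →L[ℂ] G) :
    T.cross x y (c • W) = c • T.cross x y W :=
  op_ext fun f g => by simp only [smul_apply, inner_smul_right, T.inner_cross]

lemma TensorData.traceNorm_cross_le (x y : E) (W : G →L[ℂ] G) :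
    traceNorm (T.cross x y W) ≤ ENNReal.ofReal (‖x‖ * ‖y‖) * traceNorm W := by
  have hunit : ∀ x y : E, ‖x‖ = 1 → ‖y‖ = 1 → traceNorm (T.cross x y W) ≤ traceNorm W := by
    intro x y hx hy
    have ho : ∀ {z : E}, ‖z‖ = 1 → ∀ {n} {e : Fin n → F}, Orthonormal ℂ e →
        Orthonormal ℂ fun i => T.tmul z (e i) := by
      intro z hz n e he
      refine ⟨fun i => by rw [T.norm_tmul, hz, he.1, one_mul], fun i j hij => ?_⟩
      change (inner ℂ (T.tmul z (e i)) (T.tmul z (e j)) : ℂ) = 0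
      rw [T.inner_tmul, he.2 hij, mul_zero]
    refine traceNorm_le fun n e f he hf => ?_
    simp_rw [T.inner_cross]
    exact sum_le_traceNorm W (ho hx he) (ho hy hf)
  rcases eq_or_ne x 0 with rfl | hx
  · have h := T.cross_smul_left 0 0 y W
    simp only [smul_zero, map_zero, zero_smul] at h
    simp [h]
  rcases eq_or_ne y 0 with rfl | hy
  · have h := T.cross_smul_right 0 x 0 W
    simp only [smul_zero, zero_smul] at h
    simp [h]
  have hn : ∀ z : E, z ≠ 0 → ((‖z‖ : ℝ) : ℂ) • ((‖z‖⁻¹ : ℝ) : ℂ) • z = z := fun z hz => by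
    rw [smul_smul, ← Complex.ofReal_mul, mul_inv_cancel₀ (norm_ne_zero_iff.2 hz),
      Complex.ofReal_one, one_smul]
  have hn' : ∀ z : E, z ≠ 0 → ‖((‖z‖⁻¹ : ℝ) : ℂ) • z‖ = 1 := fun z hz => by
    rw [norm_smul, Complex.norm_real, norm_inv, norm_norm, inv_mul_cancel₀ (norm_ne_zero_iff.2 hz)]
  have h : T.cross x y W = ((‖x‖ : ℂ) * (‖y‖ : ℂ)) •
      T.cross (((‖x‖⁻¹ : ℝ) : ℂ) • x) (((‖y‖⁻¹ : ℝ) : ℂ) • y) W := by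
    conv_lhs => rw [← hn x hx, ← hn y hy]
    rw [T.cross_smul_left, T.cross_smul_right, smul_smul, Complex.conj_ofReal]
  rw [h]
  refine (traceNorm_smul_le _ _).trans ?_
  rw [norm_mul, Complex.norm_real, Complex.norm_real, norm_norm, norm_norm]
  gcongr
  exact hunit _ _ (hn' x hx) (hn' y hy)

lemma TensorData.cross_isTC (x y : E) {W : G →L[ℂ] G} (hW : IsTC W) : IsTC (T.cross x y W) :=
  ne_top_of_le_ne_top (ENNReal.mul_ne_top ENNReal.ofReal_ne_top hW) (T.traceNorm_cross_le x y W)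

lemma exists_near_traceNorm {A : E →L[ℂ] E} (hA : IsTC A) {δ : ℝ≥0∞} (hδ : δ ≠ 0) :
    ∃ (n : ℕ) (e f : Fin n → E), Orthonormal ℂ e ∧ Orthonormal ℂ f ∧
      traceNorm A ≤ ∑ i, ENNReal.ofReal ‖(inner ℂ (e i) (A (f i)) : ℂ)‖ + δ := by
  by_contra! h
  rcases eq_or_ne (traceNorm A) 0 with h0 | h0
  · have he : Orthonormal ℂ (Fin.elim0 : Fin 0 → E) := ⟨fun i => i.elim0, fun i => i.elim0⟩
    have := h 0 Fin.elim0 Fin.elim0 he he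
    rw [h0] at this
    exact not_lt_zero this
  · refine absurd (traceNorm_le (C := traceNorm A - δ) fun n e f he hf => ?_)
      (not_le.2 (ENNReal.sub_lt_self hA h0 hδ))
    exact ENNReal.le_sub_of_add_le_right (ne_top_of_le_ne_top hA
      (le_add_self.trans (h n e f he hf).le)) (h n e f he hf).le

lemma TensorData.sum_traceNorm_cross_le {n : ℕ} {x y : Fin n → E} (hx : Orthonormal ℂ x)
    (hy : Orthonormal ℂ y) {W : G →L[ℂ] G} (hW : IsTC W) :
    ∑ i, traceNorm (T.cross (x i) (y i) W) ≤ traceNorm W := by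
  refine ENNReal.le_of_forall_pos_le_add fun ε hε _ => ?_
  have hδ : (ε : ℝ≥0∞) / n ≠ 0 := ENNReal.div_ne_zero.2
    ⟨by exact_mod_cast hε.ne', ENNReal.natCast_ne_top n⟩
  choose k e f he hf hle using fun i =>
    exists_near_traceNorm (T.cross_isTC (x i) (y i) hW) hδ
  have ho : ∀ {z : Fin n → E}, Orthonormal ℂ z → ∀ {g : ∀ i, Fin (k i) → F},
      (∀ i, Orthonormal ℂ (g i)) →
      Orthonormal ℂ fun p : Σ i, Fin (k i) => T.tmul (z p.1) (g p.1 p.2) := by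
    intro z hz g hg
    refine ⟨fun p => by rw [T.norm_tmul, hz.1, (hg _).1, one_mul], ?_⟩
    rintro ⟨i, p⟩ ⟨j, q⟩ hpq
    simp only [T.inner_tmul]
    by_cases hij : i = j
    · subst hij
      rw [(hg i).2 fun h => hpq (by rw [h]), mul_zero]
    · rw [hz.2 hij, zero_mul]
  calc ∑ i, traceNorm (T.cross (x i) (y i) W) ≤ ∑ i, (∑ p, ENNReal.ofReal
        ‖(inner ℂ (e i p) (T.cross (x i) (y i) W (f i p)) : ℂ)‖ + ε / n) :=
        Finset.sum_le_sum fun i _ => hle i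
    _ ≤ traceNorm W + ε := by
        rw [Finset.sum_add_distrib]
        refine add_le_add ?_ ?_
        · simp_rw [T.inner_cross]
          rw [← Fintype.sum_sigma' fun i p => ENNReal.ofReal
            ‖(inner ℂ (T.tmul (x i) (e i p)) (W (T.tmul (y i) (f i p))) : ℂ)‖]
          exact sum_le_traceNorm W (ho hx he) (ho hy hf)
        · rw [Finset.sum_const, Finset.card_univ, Fintype.card_fin, nsmul_eq_mul]
          exact ENNReal.mul_div_le

lemma exists_slice (φ : TCFunctional F) {W : G →L[ℂ] G} (hW : IsTC W) :
    ∃ S : E →L[ℂ] E, ∀ x y, (inner ℂ x (S y) : ℂ) = φ.toFun (T.cross x y W) := by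
  obtain ⟨K, hK⟩ := φ.norm_le
  let B : E →L⋆[ℂ] E →L[ℂ] ℂ := LinearMap.mkContinuous₂
    (LinearMap.mk₂'ₛₗ (starRingEnd ℂ) (RingHom.id ℂ) (fun x y => φ.toFun (T.cross x y W))
      (fun x x' y => by
        rw [T.cross_add_left, φ.map_add (T.cross_isTC _ _ hW) (T.cross_isTC _ _ hW)])
      (fun c x y => by rw [T.cross_smul_left, φ.map_smul _ (T.cross_isTC _ _ hW)]; rfl)
      (fun x y y' => by
        rw [T.cross_add_right, φ.map_add (T.cross_isTC _ _ hW) (T.cross_isTC _ _ hW)])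
      (fun c x y => by rw [T.cross_smul_right, φ.map_smul _ (T.cross_isTC _ _ hW)]; rfl))
    (K * (traceNorm W).toReal) fun x y => by
      refine (hK (T.cross_isTC x y hW)).trans ?_
      have h := ENNReal.toReal_mono (ENNReal.mul_ne_top ENNReal.ofReal_ne_top hW)
        (T.traceNorm_cross_le x y W)
      rw [ENNReal.toReal_mul, ENNReal.toReal_ofReal (by positivity)] at h
      calc _ ≤ (K : ℝ) * (‖x‖ * ‖y‖ * (traceNorm W).toReal) := by gcongr
        _ = _ := by ring
  refine ⟨ContinuousLinearMap.adjoint (InnerProductSpace.continuousLinearMapOfBilin B),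
    fun x y => ?_⟩
  rw [ContinuousLinearMap.adjoint_inner_right,
    InnerProductSpace.continuousLinearMapOfBilin_apply]
  rfl

end Slices

section Marginals

open scoped ComplexOrder

variable {E F G E' F' G' : Type*}
variable [NormedAddCommGroup E] [InnerProductSpace ℂ E] [CompleteSpace E]
variable [NormedAddCommGroup F] [InnerProductSpace ℂ F] [CompleteSpace F]
variable [NormedAddCommGroup G] [InnerProductSpace ℂ G] [CompleteSpace G]
variable [NormedAddCommGroup E'] [InnerProductSpace ℂ E'] [CompleteSpace E']
variable [NormedAddCommGroup F'] [InnerProductSpace ℂ F'] [CompleteSpace F']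
variable [NormedAddCommGroup G'] [InnerProductSpace ℂ G'] [CompleteSpace G']

/-- The slice map `W ↦ (id ⊗ φ)(W)` defined by a functional on the trace class of the second
tensor factor. -/
def TensorData.slice (T : TensorData E F G) (φ : TCFunctional F) (W : G →L[ℂ] G) : E →L[ℂ] E :=
  if h : IsTC W then (exists_slice T φ h).choose else 0

lemma TensorData.inner_slice (T : TensorData E F G) (φ : TCFunctional F) {W : G →L[ℂ] G}
    (hW : IsTC W) (x y : E) :
    (inner ℂ x (T.slice φ W y) : ℂ) = φ.toFun (T.cross x y W) := by
  rw [slice, dif_pos hW]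
  exact (exists_slice T φ hW).choose_spec x y

lemma TensorData.slice_add (T : TensorData E F G) (φ : TCFunctional F) {W W' : G →L[ℂ] G}
    (hW : IsTC W) (hW' : IsTC W') : T.slice φ (W + W') = T.slice φ W + T.slice φ W' :=
  op_ext fun x y => by
    rw [T.inner_slice φ (hW.add hW'), add_apply, inner_add_right, T.inner_slice φ hW,
      T.inner_slice φ hW', T.cross_add, φ.map_add (T.cross_isTC _ _ hW) (T.cross_isTC _ _ hW')]

lemma TensorData.slice_smul (T : TensorData E F G) (φ : TCFunctional F) (c : ℂ) {W : G →L[ℂ] G}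
    (hW : IsTC W) : T.slice φ (c • W) = c • T.slice φ W :=
  op_ext fun x y => by
    rw [T.inner_slice φ (hW.smul c), smul_apply, inner_smul_right, T.inner_slice φ hW,
      T.cross_smul, φ.map_smul c (T.cross_isTC _ _ hW)]

lemma TensorData.slice_bound (T : TensorData E F G) (φ : TCFunctional F) :
    ∃ K : ℝ≥0, ∀ {W : G →L[ℂ] G}, IsTC W → traceNorm (T.slice φ W) ≤ K * traceNorm W := by
  obtain ⟨K, hK⟩ := φ.bound
  refine ⟨K, fun {W} hW => traceNorm_le fun n e f he hf => ?_⟩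
  calc ∑ i, ENNReal.ofReal ‖(inner ℂ (e i) (T.slice φ W (f i)) : ℂ)‖
      ≤ ∑ i, K * traceNorm (T.cross (e i) (f i) W) := Finset.sum_le_sum fun i _ => by
        rw [T.inner_slice φ hW]
        exact hK (T.cross_isTC _ _ hW)
    _ = K * ∑ i, traceNorm (T.cross (e i) (f i) W) := (Finset.mul_sum _ _ _).symm
    _ ≤ K * traceNorm W := mul_le_mul_right (T.sum_traceNorm_cross_le he hf hW) _

lemma TensorData.slice_isTC (T : TensorData E F G) (φ : TCFunctional F) {W : G →L[ℂ] G}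
    (hW : IsTC W) : IsTC (T.slice φ W) := by
  obtain ⟨K, hK⟩ := T.slice_bound φ
  exact ne_top_of_le_ne_top (ENNReal.mul_ne_top ENNReal.coe_ne_top hW) (hK hW)

lemma TensorData.slice_isPositive (T : TensorData E F G) (φ : TCFunctional F)
    (hφ : ∀ B : F →L[ℂ] F, B.IsPositive → IsTC B → 0 ≤ φ.toFun B)
    {W : G →L[ℂ] G} (hW : W.IsPositive) (hWT : IsTC W) : (T.slice φ W).IsPositive := by
  rw [ContinuousLinearMap.isPositive_iff_complex]
  intro x
  have h : 0 ≤ (inner ℂ x (T.slice φ W x) : ℂ) := by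
    rw [T.inner_slice φ hWT]
    exact hφ _ (compr_isPositive _ hW) (T.cross_isTC _ _ hWT)
  obtain ⟨hre, him⟩ := Complex.nonneg_iff.1 h
  rw [← inner_conj_symm]
  generalize (inner ℂ x (T.slice φ W x) : ℂ) = z at hre him
  refine ⟨?_, by simpa using hre⟩
  apply Complex.ext <;> simp [← him]

/-- The functional `B ↦ φ (Ψ B)`. -/
def TCFunctional.comp (φ : TCFunctional F) (Ψ : TraceMap E F) (hΨ : Ψ.Bounded) :
    TCFunctional E where
  toFun B := φ.toFun (Ψ.toFun B)
  map_add hA hB := by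
    rw [Ψ.map_add _ _ hA hB, φ.map_add (Ψ.maps_tc _ hA) (Ψ.maps_tc _ hB)]
  map_smul c {A} hA := by rw [Ψ.map_smul c A hA, φ.map_smul c (Ψ.maps_tc _ hA)]
  bound := by
    obtain ⟨K, hK⟩ := φ.bound
    obtain ⟨C, hC⟩ := hΨ
    refine ⟨K * C, fun {A} hA => (hK (Ψ.maps_tc _ hA)).trans ?_⟩
    rw [ENNReal.coe_mul, mul_assoc]
    exact mul_le_mul_right (hC A) _

/-- The functional `B ↦ Tr Ψ(B)`. -/
def TraceMap.traceOut (Ψ : TraceMap E F) (hΨ : Ψ.Bounded) : TCFunctional E :=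
  (traceFunctional F).comp Ψ hΨ

lemma TraceMap.traceOut_nonneg (Ψ : TraceMap E F) (hΨ : Ψ.Bounded) (B : E →L[ℂ] E)
    (hB : B.IsPositive) (hBT : IsTC B) : 0 ≤ (Ψ.traceOut hΨ).toFun B := by
  change 0 ≤ traceC (Ψ.toFun B)
  rw [traceC_of_isPositive (Ψ.pos _ hBT hB) (Ψ.maps_tc _ hBT)]
  exact_mod_cast rtr_nonneg _

lemma TensorData.omul_rankOneM (T : TensorData E F G) (x x' : E) (f f' : F) :
    T.omul (rankOneM x x') (rankOneM f f') = rankOneM (T.tmul x f) (T.tmul x' f') :=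
  ContinuousLinearMap.ext_on T.dense_span (by
    rintro _ ⟨y, g, rfl⟩
    rw [T.omul_tmul, rankOneM_apply, rankOneM_apply, rankOneM_apply, T.smul_left, T.smul_right,
      T.inner_tmul, smul_smul])

lemma TensorData.cross_omul (T : TensorData E F G) (x y : E) (A : E →L[ℂ] E) (B : F →L[ℂ] F) :
    T.cross x y (T.omul A B) = (inner ℂ x (A y) : ℂ) • B :=
  op_ext fun f g => by
    rw [T.inner_cross, T.omul_tmul, T.inner_tmul, smul_apply, inner_smul_right]

lemma TensorData.slice_omul (T : TensorData E F G) (φ : TCFunctional F) {A : E →L[ℂ] E}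
    {B : F →L[ℂ] F} (hB : IsTC B) (hAB : IsTC (T.omul A B)) :
    T.slice φ (T.omul A B) = φ.toFun B • A :=
  op_ext fun x y => by
    rw [T.inner_slice φ hAB, T.cross_omul, φ.map_smul _ hB, smul_apply, inner_smul_right, mul_comm]

/-- The defect between the two ways of evaluating the first marginal of `Θ(W)` at `v`. -/
def marginalDefect (T : TensorData E F G) (T' : TensorData E' F' G') (Φ : TraceMap E E')
    (Ψ : TraceMap F F') (hΦb : Φ.Bounded) (hΨb : Ψ.Bounded) (Θ : TraceMap G G')
    (hΘb : Θ.Bounded) (v : E') : TCFunctional G where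
  toFun W := traceC (T'.cross v v (Θ.toFun W)) -
    inner ℂ v (Φ.toFun (T.slice (Ψ.traceOut hΨb) W) v)
  map_add {W W'} hW hW' := by
    have h := (traceFunctional F').map_add (T'.cross_isTC v v (Θ.maps_tc _ hW))
      (T'.cross_isTC v v (Θ.maps_tc _ hW'))
    change traceC _ = traceC _ + traceC _ at h
    rw [Θ.map_add _ _ hW hW', T'.cross_add, h, T.slice_add _ hW hW',
      Φ.map_add _ _ (T.slice_isTC _ hW) (T.slice_isTC _ hW'), add_apply, inner_add_right]
    ring
  map_smul c {W} hW := by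
    have h := (traceFunctional F').map_smul c (T'.cross_isTC v v (Θ.maps_tc _ hW))
    change traceC _ = c * traceC _ at h
    rw [Θ.map_smul _ _ hW, T'.cross_smul, h, T.slice_smul _ c hW,
      Φ.map_smul _ _ (T.slice_isTC _ hW), smul_apply, inner_smul_right]
    ring
  bound := by
    obtain ⟨K, hK⟩ := (traceFunctional F').bound
    obtain ⟨L, hL⟩ := T.slice_bound (Ψ.traceOut hΨb)
    obtain ⟨C, hC⟩ := hΦb
    obtain ⟨D, hD⟩ := hΘb
    let N : ℝ≥0 := ‖v‖₊ * ‖v‖₊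
    have hN : ENNReal.ofReal (‖v‖ * ‖v‖) = N := by
      rw [← ENNReal.ofReal_coe_nnreal]; rfl
    refine ⟨K * (N * D) + N * (C * L), fun {W} hW => ?_⟩
    have h1 : ENNReal.ofReal ‖traceC (T'.cross v v (Θ.toFun W))‖ ≤
        K * (N * (D * traceNorm W)) := by
      refine (hK (T'.cross_isTC v v (Θ.maps_tc _ hW))).trans ?_
      gcongr
      refine (T'.traceNorm_cross_le v v _).trans ?_
      rw [hN]
      gcongr
      exact hD W
    have h2 : ENNReal.ofReal ‖(inner ℂ v (Φ.toFun (T.slice (Ψ.traceOut hΨb) W) v) : ℂ)‖ ≤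
        N * (C * (L * traceNorm W)) := by
      have hT := Φ.maps_tc _ (T.slice_isTC (Ψ.traceOut hΨb) hW)
      refine (ENNReal.ofReal_le_ofReal (norm_inner_le_traceNorm hT v v)).trans ?_
      rw [ENNReal.ofReal_mul (by positivity), hN, ENNReal.ofReal_toReal hT]
      gcongr
      refine (hC _).trans ?_
      gcongr
      exact hL hW
    calc _ ≤ ENNReal.ofReal (‖traceC (T'.cross v v (Θ.toFun W))‖ +
          ‖(inner ℂ v (Φ.toFun (T.slice (Ψ.traceOut hΨb) W) v) : ℂ)‖) :=
          ENNReal.ofReal_le_ofReal (norm_sub_le _ _)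
      _ ≤ K * (N * (D * traceNorm W)) + N * (C * (L * traceNorm W)) := by
          rw [ENNReal.ofReal_add (norm_nonneg _) (norm_nonneg _)]
          exact add_le_add h1 h2
      _ = _ := by push_cast; ring

/-- If `Θ = Φ ⊗ Ψ`, the first marginal of `Θ(W)` is the image under `Φ` of a slice of `W`. -/
lemma isMarginal_slice (T : TensorData E F G) (T' : TensorData E' F' G') (Φ : TraceMap E E')
    (Ψ : TraceMap F F') (hΦb : Φ.Bounded) (hΨb : Ψ.Bounded) (Θ : TraceMap G G')
    (hΘb : Θ.Bounded)
    (hΘ : ∀ A B, IsTC A → IsTC B → Θ.toFun (T.omul A B) = T'.omul (Φ.toFun A) (Ψ.toFun B))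
    {W : G →L[ℂ] G} (hW : W.IsPositive) (hWT : IsTC W) :
    IsMarginal T' (Θ.toFun W) (Φ.toFun (T.slice (Ψ.traceOut hΨb) W)) := by
  intro v
  have h := (marginalDefect T T' Φ Ψ hΦb hΨb Θ hΘb v).eq_zero_of_tmul T (fun x x' f f' => by
    have hT := rankOneM_isTC f f'
    have hAB : IsTC (T.omul (rankOneM x x') (rankOneM f f')) := by
      rw [T.omul_rankOneM]; exact rankOneM_isTC _ _
    have ht := (traceFunctional F').map_smul
      (inner ℂ v (Φ.toFun (rankOneM x x') v) : ℂ) (Ψ.maps_tc _ hT)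
    change traceC _ = _ * traceC _ at ht
    rw [← T.omul_rankOneM]
    change traceC (T'.cross v v (Θ.toFun _)) - inner ℂ v (Φ.toFun (T.slice _ _) v) = 0
    rw [hΘ _ _ (rankOneM_isTC _ _) hT, T'.cross_omul, ht, T.slice_omul _ hT hAB,
      Φ.map_smul _ _ (rankOneM_isTC _ _), smul_apply, inner_smul_right, sub_eq_zero, mul_comm]
    rfl) hW hWT
  have hpos : (compr (T'.lmul v) (Θ.toFun W)).IsPositive := compr_isPositive _ (Θ.pos _ hWT hW)
  have hTC : IsTC (compr (T'.lmul v) (Θ.toFun W)) := T'.cross_isTC v v (Θ.maps_tc _ hWT)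
  have h' : traceC (compr (T'.lmul v) (Θ.toFun W)) =
    inner ℂ v (Φ.toFun (T.slice (Ψ.traceOut hΨb) W) v) := sub_eq_zero.1 h
  have hre := congrArg Complex.re h'
  rw [traceC_of_isPositive hpos hTC, Complex.ofReal_re] at hre
  change _ = qf _ v at hre
  rw [← hre, rtr, ← traceNorm_eq_traceENN hpos, ENNReal.ofReal_toReal hTC]

end Marginals

section Continuity

variable {E F G E' F' G' : Type*}
variable [NormedAddCommGroup E] [InnerProductSpace ℂ E] [CompleteSpace E]
variable [NormedAddCommGroup F] [InnerProductSpace ℂ F] [CompleteSpace F]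
variable [NormedAddCommGroup G] [InnerProductSpace ℂ G] [CompleteSpace G]
variable [NormedAddCommGroup E'] [InnerProductSpace ℂ E'] [CompleteSpace E']
variable [NormedAddCommGroup F'] [InnerProductSpace ℂ F'] [CompleteSpace F']
variable [NormedAddCommGroup G'] [InnerProductSpace ℂ G'] [CompleteSpace G']

lemma isTC_of_mem_states {A : E →L[ℂ] E} (hA : A ∈ states E) : IsTC A := by
  rw [IsTC, traceNorm_eq_traceENN hA.1, hA.2]
  exact ENNReal.one_ne_top

lemma normalize_mem_states {A : E →L[ℂ] E} (hA : A.IsPositive) (hAT : IsTC A) (h : rtr A ≠ 0) :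
    (((rtr A)⁻¹ : ℝ) : ℂ) • A ∈ states E := by
  have hpos : 0 < rtr A := (rtr_nonneg A).lt_of_ne' h
  have hc := isPositive_real_smul hA (inv_nonneg.2 hpos.le)
  refine ⟨hc, ?_⟩
  have hA1 : traceNorm A = ENNReal.ofReal (rtr A) := by
    rw [rtr, ← traceNorm_eq_traceENN hA, ENNReal.ofReal_toReal hAT]
  rw [← traceNorm_eq_traceENN hc]
  refine le_antisymm ?_ ?_
  · refine (traceNorm_smul_le _ _).trans (le_of_eq ?_)
    rw [hA1, ← ENNReal.ofReal_mul (norm_nonneg _), Complex.norm_real, Real.norm_of_nonneg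
      (inv_nonneg.2 hpos.le), inv_mul_cancel₀ h, ENNReal.ofReal_one]
  · have h1 := traceNorm_smul_le ((rtr A : ℝ) : ℂ) ((((rtr A)⁻¹ : ℝ) : ℂ) • A)
    rw [smul_smul, ← Complex.ofReal_mul, mul_inv_cancel₀ h, Complex.ofReal_one, one_smul,
      Complex.norm_real, Real.norm_of_nonneg hpos.le, hA1] at h1
    have h2 : ENNReal.ofReal (rtr A) ≠ 0 := by simpa using hpos
    rw [← ENNReal.mul_le_mul_iff_right h2 ENNReal.ofReal_ne_top, mul_one]
    exact h1

lemma eq_zero_of_rtr_eq_zero {A : E →L[ℂ] E} (hA : A.IsPositive) (hAT : IsTC A)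
    (h : rtr A = 0) : A = 0 :=
  op_ext fun x y => by
    have h' := norm_inner_le_traceNorm hAT x y
    rw [traceNorm_eq_traceENN hA, ← rtr, h, mul_zero] at h'
    rw [norm_le_zero_iff.1 h', zero_apply, inner_zero_right]

lemma TraceMap.map_sub (Φ : TraceMap E F) {A B : E →L[ℂ] E} (hA : IsTC A) (hB : IsTC B) :
    Φ.toFun (A - B) = Φ.toFun A - Φ.toFun B := by
  have h := Φ.map_add (A - B) B (hA.sub hB) hB
  rw [sub_add_cancel] at h
  rw [h, add_sub_cancel_right]

lemma TraceMap.map_zero (Φ : TraceMap E F) : Φ.toFun 0 = 0 := by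
  have h := Φ.map_smul 0 0 isTC_zero
  rwa [zero_smul, zero_smul] at h

lemma TraceMap.tendsto_traceNorm (Φ : TraceMap E F) (hb : Φ.Bounded) {σ : ℕ → E →L[ℂ] E}
    {σ₀ : E →L[ℂ] E} (hσ : ∀ n, IsTC (σ n)) (hσ₀ : IsTC σ₀)
    (hlim : Tendsto (fun n => traceNorm (σ n - σ₀)) atTop (𝓝 0)) :
    Tendsto (fun n => traceNorm (Φ.toFun (σ n) - Φ.toFun σ₀)) atTop (𝓝 0) := by
  obtain ⟨C, hC⟩ := hb
  have h := ENNReal.Tendsto.const_mul (a := (C : ℝ≥0∞)) hlim (Or.inr ENNReal.coe_ne_top)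
  rw [mul_zero] at h
  refine tendsto_of_tendsto_of_tendsto_of_le_of_le tendsto_const_nhds h (fun _ => zero_le)
    fun n => ?_
  change traceNorm _ ≤ _
  rw [← Φ.map_sub (hσ n) hσ₀]
  exact hC _

lemma TensorData.tendsto_traceNorm_slice (T : TensorData E F G) (φ : TCFunctional F)
    {ω : ℕ → G →L[ℂ] G} {ω₀ : G →L[ℂ] G} (hω : ∀ n, IsTC (ω n)) (hω₀ : IsTC ω₀)
    (hlim : Tendsto (fun n => traceNorm (ω n - ω₀)) atTop (𝓝 0)) :
    Tendsto (fun n => traceNorm (T.slice φ (ω n) - T.slice φ ω₀)) atTop (𝓝 0) := by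
  obtain ⟨C, hC⟩ := T.slice_bound φ
  have h := ENNReal.Tendsto.const_mul (a := (C : ℝ≥0∞)) hlim (Or.inr ENNReal.coe_ne_top)
  rw [mul_zero] at h
  refine tendsto_of_tendsto_of_tendsto_of_le_of_le tendsto_const_nhds h (fun _ => zero_le)
    fun n => ?_
  have hadd := T.slice_add φ ((hω n).sub hω₀) hω₀
  rw [sub_add_cancel] at hadd
  change traceNorm _ ≤ _
  rw [hadd, add_sub_cancel_right]
  exact hC ((hω n).sub hω₀)

lemma ContOn.tendsto {f : (E →L[ℂ] E) → ℝ≥0∞} {𝒜 : Set (E →L[ℂ] E)} (hf : ContOn f 𝒜)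
    {ρ : ℕ → E →L[ℂ] E} {ρ₀ : E →L[ℂ] E} (hρ : ∀ᶠ n in atTop, ρ n ∈ 𝒜) (hρ₀ : ρ₀ ∈ 𝒜)
    (hlim : Tendsto (fun n => traceNorm (ρ n - ρ₀)) atTop (𝓝 0)) :
    Tendsto (fun n => f (ρ n)) atTop (𝓝 (f ρ₀)) := by
  have h : Tendsto (fun n => (f (ρ n)).toReal) atTop (𝓝 (f ρ₀).toReal) := by
    rw [Metric.tendsto_nhds]
    intro ε hε
    obtain ⟨δ, hδ, hfδ⟩ := hf.2 ρ₀ hρ₀ ε hε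
    filter_upwards [hρ, hlim.eventually_lt_const (ENNReal.ofReal_pos.2 hδ)] with n hn hlt
    exact hfδ _ hn hlt
  have h' := ENNReal.tendsto_ofReal h
  rw [ENNReal.ofReal_toReal (hf.1 _ hρ₀)] at h'
  refine h'.congr' ?_
  filter_upwards [hρ] with n hn
  exact ENNReal.ofReal_toReal (hf.1 _ hn)

lemma outEntropy_eq_rtr_mul (Φ : TraceMap E F) {A : E →L[ℂ] E} (hA : A.IsPositive)
    (hAT : IsTC A) (h : rtr A ≠ 0) : outEntropy Φ A =
      ENNReal.ofReal (rtr A) * outEntropy Φ ((((rtr A)⁻¹ : ℝ) : ℂ) • A) := by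
  have hs := normalize_mem_states hA hAT h
  have hsT := isTC_of_mem_states hs
  rw [outEntropy, outEntropy, ← qEntropy_smul (Φ.pos _ hsT hs.1) (Φ.maps_tc _ hsT) (rtr_nonneg A),
    ← Φ.map_smul _ _ hsT, smul_smul, ← Complex.ofReal_mul, mul_inv_cancel₀ h, Complex.ofReal_one,
    one_smul]

lemma outEntropy_ne_top (Φ : TraceMap E F) (hΦ : ContOn (outEntropy Φ) (states E))
    {A : E →L[ℂ] E} (hA : A.IsPositive) (hAT : IsTC A) : outEntropy Φ A ≠ ∞ := by
  by_cases h : rtr A = 0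
  · rw [eq_zero_of_rtr_eq_zero hA hAT h, outEntropy, Φ.map_zero, qEntropy_zero]
    exact ENNReal.zero_ne_top
  · rw [outEntropy_eq_rtr_mul Φ hA hAT h]
    exact ENNReal.mul_ne_top ENNReal.ofReal_ne_top (hΦ.1 _ (normalize_mem_states hA hAT h))

section Sequences

variable {σ : ℕ → E →L[ℂ] E} {σ₀ : E →L[ℂ] E}

lemma tendsto_outEntropy_of_rtr_ne_zero (Φ : TraceMap E F)
    (hΦ : ContOn (outEntropy Φ) (states E)) (hσ : ∀ n, (σ n).IsPositive)
    (hσT : ∀ n, IsTC (σ n)) (hσ₀ : σ₀.IsPositive) (hσT₀ : IsTC σ₀)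
    (hlim : Tendsto (fun n => traceNorm (σ n - σ₀)) atTop (𝓝 0)) (h0 : rtr σ₀ ≠ 0) :
    Tendsto (fun n => outEntropy Φ (σ n)) atTop (𝓝 (outEntropy Φ σ₀)) := by
  have ht := tendsto_rtr hσ hσT hσ₀ hσT₀ hlim
  have hne : ∀ᶠ n in atTop, rtr (σ n) ≠ 0 := ht.eventually_ne h0
  have hinv := ht.inv₀ h0
  have hρlim : Tendsto (fun n => traceNorm ((((rtr (σ n))⁻¹ : ℝ) : ℂ) • σ n -
      (((rtr σ₀)⁻¹ : ℝ) : ℂ) • σ₀)) atTop (𝓝 0) := by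
    have h1 : Tendsto (fun n => ENNReal.ofReal ‖(rtr (σ n))⁻¹‖ * traceNorm (σ n - σ₀) +
        ENNReal.ofReal ‖(rtr (σ n))⁻¹ - (rtr σ₀)⁻¹‖ * traceNorm σ₀) atTop (𝓝 0) := by
      have ha := ENNReal.Tendsto.mul (ENNReal.tendsto_ofReal hinv.norm)
        (Or.inr ENNReal.zero_ne_top) hlim (Or.inr ENNReal.ofReal_ne_top)
      have hb := ENNReal.Tendsto.mul_const (b := traceNorm σ₀)
        (ENNReal.tendsto_ofReal (hinv.sub_const (rtr σ₀)⁻¹).norm) (Or.inr hσT₀)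
      simpa using ha.add hb
    refine tendsto_of_tendsto_of_tendsto_of_le_of_le tendsto_const_nhds h1 (fun _ => zero_le)
      fun n => ?_
    have hd : (((rtr (σ n))⁻¹ : ℝ) : ℂ) • σ n - (((rtr σ₀)⁻¹ : ℝ) : ℂ) • σ₀ =
        (((rtr (σ n))⁻¹ : ℝ) : ℂ) • (σ n - σ₀) +
          (((rtr (σ n))⁻¹ - (rtr σ₀)⁻¹ : ℝ) : ℂ) • σ₀ := by
      rw [Complex.ofReal_sub, smul_sub, sub_smul]; abel
    change traceNorm _ ≤ _
    rw [hd]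
    refine (traceNorm_add_le _ _).trans (add_le_add ?_ ?_)
    · exact (traceNorm_smul_le _ _).trans_eq (by rw [Complex.norm_real])
    · exact (traceNorm_smul_le _ _).trans_eq (by rw [Complex.norm_real])
  have hent := hΦ.tendsto (hne.mono fun n hn => normalize_mem_states (hσ n) (hσT n) hn)
    (normalize_mem_states hσ₀ hσT₀ h0) hρlim
  rw [outEntropy_eq_rtr_mul Φ hσ₀ hσT₀ h0]
  refine (ENNReal.Tendsto.mul (ENNReal.tendsto_ofReal ht)
    (Or.inr (hΦ.1 _ (normalize_mem_states hσ₀ hσT₀ h0))) hent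
    (Or.inr ENNReal.ofReal_ne_top)).congr' ?_
  filter_upwards [hne] with n hn
  exact (outEntropy_eq_rtr_mul Φ (hσ n) (hσT n) hn).symm

/-- Continuity of the output entropy on states extends to the cone of positive trace-class
operators. -/
lemma tendsto_outEntropy (Φ : TraceMap E F)
    (hΦ : ContOn (outEntropy Φ) (states E)) (hσ : ∀ n, (σ n).IsPositive)
    (hσT : ∀ n, IsTC (σ n)) (hσ₀ : σ₀.IsPositive) (hσT₀ : IsTC σ₀)
    (hlim : Tendsto (fun n => traceNorm (σ n - σ₀)) atTop (𝓝 0)) :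
    Tendsto (fun n => outEntropy Φ (σ n)) atTop (𝓝 (outEntropy Φ σ₀)) := by
  by_cases h0 : rtr σ₀ = 0
  swap
  · exact tendsto_outEntropy_of_rtr_ne_zero Φ hΦ hσ hσT hσ₀ hσT₀ hlim h0
  obtain rfl := eq_zero_of_rtr_eq_zero hσ₀ hσT₀ h0
  have hz : outEntropy Φ 0 = 0 := by rw [outEntropy, Φ.map_zero, qEntropy_zero]
  rw [hz]
  by_cases hall : ∀ n, rtr (σ n) = 0
  · refine tendsto_const_nhds.congr fun n => ?_
    rw [eq_zero_of_rtr_eq_zero (hσ n) (hσT n) (hall n), hz]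
  push Not at hall
  obtain ⟨m, hm⟩ := hall
  have hfin := outEntropy_ne_top Φ hΦ (hσ m) (hσT m)
  have h := tendsto_outEntropy_of_rtr_ne_zero (σ := fun n => σ m + σ n) Φ hΦ
    (fun n => (hσ m).add (hσ n)) (fun n => (hσT m).add (hσT n)) (hσ m) (hσT m)
    (by simpa using hlim) hm
  have hsub := ENNReal.Tendsto.sub h (tendsto_const_nhds (x := outEntropy Φ (σ m))) (Or.inl hfin)
  rw [tsub_self] at hsub
  refine tendsto_of_tendsto_of_tendsto_of_le_of_le tendsto_const_nhds hsub (fun _ => zero_le)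
    fun n => ENNReal.le_sub_of_add_le_left hfin ?_
  rw [outEntropy, outEntropy, outEntropy, Φ.map_add _ _ (hσT m) (hσT n)]
  exact qEntropy_superadd (Φ.pos _ (hσT m) (hσ m)) (Φ.maps_tc _ (hσT m))
    (Φ.pos _ (hσT n) (hσ n)) (Φ.maps_tc _ (hσT n))

end Sequences

end Continuity

/-- Corollary 3 of the paper. If `Φ : 𝔗(ℋ) → 𝔗(ℋ')` and
`Ψ : 𝔗(𝒦) → 𝔗(𝒦')` are positive linear bounded maps with continuous output entropy and
the (unique bounded) tensor product map `Φ⊗Ψ : 𝔗(ℋ⊗𝒦) → 𝔗(ℋ'⊗𝒦')` is positive, then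
`Φ⊗Ψ` has continuous output entropy.  Here `G` (resp. `G'`) realizes the Hilbert tensor
product `ℋ⊗𝒦` (resp. `ℋ'⊗𝒦'`) via `TensorData`, and `Θ` is the tensor product map,
characterized by `Θ(A⊗B) = Φ(A)⊗Ψ(B)`, trace-norm boundedness and linearity; positivity
of `Θ` is part of the `TraceMap` structure. -/
theorem statement4
    {E F G E' F' G' : Type*}
    [NormedAddCommGroup E] [InnerProductSpace ℂ E] [CompleteSpace E]
    [TopologicalSpace.SeparableSpace E]
    [NormedAddCommGroup F] [InnerProductSpace ℂ F] [CompleteSpace F]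
    [TopologicalSpace.SeparableSpace F]
    [NormedAddCommGroup G] [InnerProductSpace ℂ G] [CompleteSpace G]
    [TopologicalSpace.SeparableSpace G]
    [NormedAddCommGroup E'] [InnerProductSpace ℂ E'] [CompleteSpace E']
    [TopologicalSpace.SeparableSpace E']
    [NormedAddCommGroup F'] [InnerProductSpace ℂ F'] [CompleteSpace F']
    [TopologicalSpace.SeparableSpace F']
    [NormedAddCommGroup G'] [InnerProductSpace ℂ G'] [CompleteSpace G']
    [TopologicalSpace.SeparableSpace G']
    (T : TensorData E F G) (T' : TensorData E' F' G')
    (Φ : TraceMap E E') (Ψ : TraceMap F F')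
    (hΦb : Φ.Bounded) (hΨb : Ψ.Bounded)
    (hΦ : ContOn (outEntropy Φ) (states E)) (hΨ : ContOn (outEntropy Ψ) (states F))
    (Θ : TraceMap G G') (hΘb : Θ.Bounded)
    (hΘ : ∀ A B, IsTC A → IsTC B →
      Θ.toFun (T.omul A B) = T'.omul (Φ.toFun A) (Ψ.toFun B)) :
    ContOn (outEntropy Θ) (states G) := by
  have hΘs : ∀ B A, IsTC B → IsTC A →
      Θ.toFun (T.swap.omul B A) = T'.swap.omul (Ψ.toFun B) (Φ.toFun A) :=
    fun B A hB hA => hΘ A B hA hB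
  let σ : (G →L[ℂ] G) → E →L[ℂ] E := T.slice (Ψ.traceOut hΨb)
  let τ : (G →L[ℂ] G) → F →L[ℂ] F := T.swap.slice (Φ.traceOut hΦb)
  have hT : ∀ {W}, W ∈ states G → IsTC W := fun hW => isTC_of_mem_states hW
  have hσT : ∀ {W}, W ∈ states G → IsTC (σ W) := fun hW => T.slice_isTC _ (hT hW)
  have hτT : ∀ {W}, W ∈ states G → IsTC (τ W) := fun hW => T.swap.slice_isTC _ (hT hW)
  have hσ : ∀ {W}, W ∈ states G → (σ W).IsPositive := fun hW =>
    T.slice_isPositive _ (Ψ.traceOut_nonneg hΨb) hW.1 (hT hW)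
  have hτ : ∀ {W}, W ∈ states G → (τ W).IsPositive := fun hW =>
    T.swap.slice_isPositive _ (Φ.traceOut_nonneg hΦb) hW.1 (hT hW)
  have hσM : ∀ {W}, W ∈ states G → IsMarginal T' (Θ.toFun W) (Φ.toFun (σ W)) := fun hW =>
    isMarginal_slice T T' Φ Ψ hΦb hΨb Θ hΘb hΘ hW.1 (hT hW)
  have hτM : ∀ {W}, W ∈ states G → IsMarginal T'.swap (Θ.toFun W) (Ψ.toFun (τ W)) := fun hW =>
    isMarginal_slice T.swap T'.swap Ψ Φ hΨb hΦb Θ hΘb hΘs hW.1 (hT hW)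
  have hσfin : ∀ {W}, W ∈ states G → qEntropy (Φ.toFun (σ W)) ≠ ∞ := fun hW =>
    outEntropy_ne_top Φ hΦ (hσ hW) (hσT hW)
  have hτfin : ∀ {W}, W ∈ states G → qEntropy (Ψ.toFun (τ W)) ≠ ∞ := fun hW =>
    outEntropy_ne_top Ψ hΨ (hτ hW) (hτT hW)
  have hfin : ∀ W ∈ states G, outEntropy Θ W ≠ ∞ := fun W hW =>
    ne_top_of_le_ne_top (ENNReal.add_ne_top.2 ⟨hσfin hW, hτfin hW⟩)
      (qEntropy_le_marginals (Θ.pos _ (hT hW) hW.1) (Θ.maps_tc _ (hT hW))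
        (Φ.pos _ (hσT hW) (hσ hW)) (Φ.maps_tc _ (hσT hW)) (Ψ.pos _ (hτT hW) (hτ hW))
        (Ψ.maps_tc _ (hτT hW)) (hσM hW) (hτM hW))
  refine ⟨hfin, fun W₀ hW₀ ε hε => ?_⟩
  by_contra! hcon
  choose W hW hlt hge using fun n : ℕ => hcon (1 / (n + 1)) Nat.one_div_pos_of_nat
  have hlim : Tendsto (fun n => traceNorm (W n - W₀)) atTop (𝓝 0) := by
    have h := ENNReal.tendsto_ofReal tendsto_one_div_add_atTop_nhds_zero_nat
    rw [ENNReal.ofReal_zero] at h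
    exact tendsto_of_tendsto_of_tendsto_of_le_of_le tendsto_const_nhds h (fun _ => zero_le)
      fun n => (hlt n).le
  have hWT := fun n => hT (hW n)
  have hσlim := T.tendsto_traceNorm_slice (Ψ.traceOut hΨb) hWT (hT hW₀) hlim
  have hτlim := T.swap.tendsto_traceNorm_slice (Φ.traceOut hΦb) hWT (hT hW₀) hlim
  have hΘlim := Θ.tendsto_traceNorm hΘb hWT (hT hW₀) hlim
  have hpos := fun n => Θ.pos _ (hWT n) (hW n).1
  have htc := fun n => Θ.maps_tc _ (hWT n)
  have hpos₀ := Θ.pos _ (hT hW₀) hW₀.1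
  have htc₀ := Θ.maps_tc _ (hT hW₀)
  have hε2 : 0 < ε / 2 := half_pos hε
  have hlower := eventually_qEntropy_ge hpos htc hpos₀ htc₀ hΘlim (hfin W₀ hW₀) hε2
  have hupper := eventually_qEntropy_le hpos htc hpos₀ htc₀
    (fun n => Φ.pos _ (hσT (hW n)) (hσ (hW n))) (fun n => Φ.maps_tc _ (hσT (hW n)))
    (Φ.pos _ (hσT hW₀) (hσ hW₀)) (Φ.maps_tc _ (hσT hW₀))
    (fun n => Ψ.pos _ (hτT (hW n)) (hτ (hW n))) (fun n => Ψ.maps_tc _ (hτT (hW n)))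
    (Ψ.pos _ (hτT hW₀) (hτ hW₀)) (Ψ.maps_tc _ (hτT hW₀))
    (fun n => hσM (hW n)) (fun n => hτM (hW n)) hΘlim
    (Φ.tendsto_traceNorm hΦb (fun n => hσT (hW n)) (hσT hW₀) hσlim)
    (Ψ.tendsto_traceNorm hΨb (fun n => hτT (hW n)) (hτT hW₀) hτlim)
    (hσfin hW₀) (hτfin hW₀)
    (tendsto_outEntropy Φ hΦ (fun n => hσ (hW n)) (fun n => hσT (hW n)) (hσ hW₀) (hσT hW₀) hσlim)
    (tendsto_outEntropy Ψ hΨ (fun n => hτ (hW n)) (fun n => hτT (hW n)) (hτ hW₀) (hτT hW₀) hτlim)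
    hε2
  obtain ⟨n, hl, hu⟩ := (hlower.and hupper).exists
  have hreal : ∀ {a b : ℝ≥0∞}, a ≠ ∞ → b ≠ ∞ → a ≤ b + ENNReal.ofReal (ε / 2) →
      a.toReal ≤ b.toReal + ε / 2 := fun ha hb h => by
    have h' := ENNReal.toReal_mono (ENNReal.add_ne_top.2 ⟨hb, ENNReal.ofReal_ne_top⟩) h
    rwa [ENNReal.toReal_add hb ENNReal.ofReal_ne_top, ENNReal.toReal_ofReal hε2.le] at h'
  have h1 := hreal (hfin W₀ hW₀) (hfin _ (hW n)) hl
  have h2 := hreal (hfin _ (hW n)) (hfin W₀ hW₀) hu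
  have h3 := hge n
  rcases le_abs.1 h3 with h | h <;> linarith

end QIT
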